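/- arXiv:1712.08431 — 2 statements merged into one kernel-verified Lean document; each statement's English description precedes it below -/
import Mathlib

section
/- Let Ω = B(0,R) \ closure B(z,ρ) ⊂ ℝ² be an eccentric circular annulus, where z ≠ 0, 0 < ρ < R, and closure B(z,ρ) ⊂ B(0,R), so that Ω is symmetric with respect to the line through 0 and z. Let H ∈ ℝ, and let u ∈ C²(Ω) ∩ C(closure Ω) be a solution of the constant mean curvature equation div(∇u/√(1+|∇u|²)) = H in Ω with u = 0 on ∂Ω, real analytic in Ω, and not identically zero. Then the critical set K = {x ∈ Ω : ∇u(x) = 0} is a finite set; in particular every critical point of u is isolated. -/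
open Set Metric

noncomputable section

/-- The coefficients `a_{ij}(p) = (1+|p|²)^{-1/2}(δ_{ij} − pᵢpⱼ/(1+|p|²))`
of the mean curvature operator. -/
def mcCoeff {n : ℕ} (p : EuclideanSpace ℝ (Fin n)) (i j : Fin n) : ℝ :=
  (Real.sqrt (1 + ‖p‖ ^ 2))⁻¹ * ((if i = j then 1 else 0) - p i * p j / (1 + ‖p‖ ^ 2))

/-- Second partial derivative `∂²u/∂xᵢ∂xⱼ`. -/
def hessEntry {n : ℕ} (u : EuclideanSpace ℝ (Fin n) → ℝ) (x : EuclideanSpace ℝ (Fin n))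
    (i j : Fin n) : ℝ :=
  iteratedFDeriv ℝ 2 u x ![EuclideanSpace.single i 1, EuclideanSpace.single j 1]

/-- The Hessian matrix `D²u(x)`. -/
def hessMatrix {n : ℕ} (u : EuclideanSpace ℝ (Fin n) → ℝ) (x : EuclideanSpace ℝ (Fin n)) :
    Matrix (Fin n) (Fin n) ℝ :=
  Matrix.of fun i j => hessEntry u x i j

/-- The mean curvature operator `L u = div(∇u/√(1+|∇u|²)) = Σ a_{ij}(∇u) ∂²u/∂xᵢ∂xⱼ`. -/
def meanCurv {n : ℕ} (u : EuclideanSpace ℝ (Fin n) → ℝ) (x : EuclideanSpace ℝ (Fin n)) : ℝ :=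
  ∑ i, ∑ j, mcCoeff (gradient u x) i j * hessEntry u x i j

/-- A solution of the Dirichlet problem `L u = f(u)` in `Ω`, `u = 0` on `∂Ω`:
`u ∈ C²(Ω) ∩ C(closure Ω)`. -/
def IsMCSolution {n : ℕ} (Ω : Set (EuclideanSpace ℝ (Fin n))) (f : ℝ → ℝ)
    (u : EuclideanSpace ℝ (Fin n) → ℝ) : Prop :=
  ContDiffOn ℝ 2 u Ω ∧ ContinuousOn u (closure Ω) ∧
    (∀ x ∈ Ω, meanCurv u x = f (u x)) ∧ (∀ x ∈ frontier Ω, u x = 0)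

/-- The Euclidean plane. -/
abbrev Plane := EuclideanSpace ℝ (Fin 2)

/-- Rotation by a right angle. -/
def rot (p : Plane) : Plane := !₂[-p 1, p 0]

/-- The numerator of the planar mean curvature operator, as a function of the gradient `p` and the
second derivative `A`. -/
def jetOp (p : Plane) (A : Plane →L[ℝ] Plane →L[ℝ] ℝ) : ℝ :=
  A (EuclideanSpace.single 0 1) (EuclideanSpace.single 0 1) +
    A (EuclideanSpace.single 1 1) (EuclideanSpace.single 1 1) + A (rot p) (rot p)

lemma rot_eq (p : Plane) :
    rot p = (-p 1) • EuclideanSpace.single 0 1 + p 0 • EuclideanSpace.single 1 1 := by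
  ext i; fin_cases i <;> simp [rot]

lemma plane_norm_sq (p : Plane) : ‖p‖ ^ 2 = p 0 ^ 2 + p 1 ^ 2 := by
  simp [EuclideanSpace.norm_sq_eq, Fin.sum_univ_two]

lemma plane_inner (p q : Plane) : inner ℝ p q = p 0 * q 0 + p 1 * q 1 := by
  simp [PiLp.inner_apply, Fin.sum_univ_two, mul_comm]

lemma hessEntry_eq {n : ℕ} (u : EuclideanSpace ℝ (Fin n) → ℝ) (x : EuclideanSpace ℝ (Fin n))
    (i j : Fin n) :
    hessEntry u x i j =
      fderiv ℝ (fderiv ℝ u) x (EuclideanSpace.single i 1) (EuclideanSpace.single j 1) := by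
  simp [hessEntry, iteratedFDeriv_two_apply]

lemma sum_mcCoeff_mul_eq (p : Plane) (A : Plane →L[ℝ] Plane →L[ℝ] ℝ) :
    ∑ i, ∑ j, mcCoeff p i j * A (EuclideanSpace.single i 1) (EuclideanSpace.single j 1) =
      jetOp p A / √(1 + ‖p‖ ^ 2) ^ 3 := by
  obtain ⟨s, hs0, hs, hs2⟩ : ∃ s > 0, √(1 + ‖p‖ ^ 2) = s ∧ 1 + ‖p‖ ^ 2 = s ^ 2 :=
    ⟨_, Real.sqrt_pos.2 (by positivity), rfl, (Real.sq_sqrt (by positivity)).symm⟩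
  have hs3 : s ^ 2 = 1 + p 0 ^ 2 + p 1 ^ 2 := by rw [← hs2, plane_norm_sq]; ring
  simp only [Fin.sum_univ_two, mcCoeff, jetOp, rot_eq p, map_add, map_smul, add_apply, smul_apply,
    smul_eq_mul]
  rw [hs, hs2]
  rw [eq_div_iff (by positivity)]
  simp
  field_simp
  rw [hs3]
  ring

lemma meanCurv_eq (u : Plane → ℝ) (x : Plane) :
    meanCurv u x =
      jetOp (gradient u x) (fderiv ℝ (fderiv ℝ u) x) / √(1 + ‖gradient u x‖ ^ 2) ^ 3 := by
  rw [← sum_mcCoeff_mul_eq]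
  simp only [meanCurv, hessEntry_eq]

lemma jetOp_mono (p : Plane) {A B : Plane →L[ℝ] Plane →L[ℝ] ℝ} (h : ∀ v, A v v ≤ B v v) :
    jetOp p A ≤ jetOp p B :=
  add_le_add (add_le_add (h _) (h _)) (h _)

lemma gradient_congr {E : Type*} [NormedAddCommGroup E] [InnerProductSpace ℝ E] [CompleteSpace E]
    {f g : E → ℝ} {x y : E} (h : fderiv ℝ f x = fderiv ℝ g y) : gradient f x = gradient g y := by
  simp [gradient, h]

section SecondOrder

variable {E : Type*} [NormedAddCommGroup E] [NormedSpace ℝ E]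

lemma IsLocalMin.fderiv_fderiv_nonneg {h : E → ℝ} {x : E} (hC : ContDiffAt ℝ 2 h x)
    (hmin : IsLocalMin h x) (v : E) : 0 ≤ fderiv ℝ (fderiv ℝ h) x v v := by
  set f : ℝ → ℝ := fun t => h (x + t • v) with hf
  have hline : ∀ t, HasDerivAt (fun t : ℝ => x + t • v) v t := fun t => by
    simpa using ((hasDerivAt_id t).smul_const v).const_add x
  have hcont : Filter.Tendsto (fun t : ℝ => x + t • v) (nhds 0) (nhds x) := by
    simpa using (hline 0).continuousAt.tendsto
  have hd : ∀ᶠ t in nhds (0 : ℝ), deriv f t = fderiv ℝ h (x + t • v) v := by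
    have h1 : ∀ᶠ y in nhds x, DifferentiableAt ℝ h y :=
      (hC.eventually (by simp)).mono fun y hy => hy.differentiableAt (by simp)
    filter_upwards [hcont.eventually h1] with t ht
    exact (ht.hasFDerivAt.comp_hasDerivAt t (hline t)).deriv
  have hdd : deriv (deriv f) 0 = fderiv ℝ (fderiv ℝ h) x v v := by
    rw [Filter.EventuallyEq.deriv_eq hd]
    have h2 : DifferentiableAt ℝ (fderiv ℝ h) (x + (0 : ℝ) • v) := by
      simpa using (hC.fderiv_right (m := 1) (by norm_num)).differentiableAt (by simp)
    have h3 : HasDerivAt (fun t : ℝ => fderiv ℝ h (x + t • v) v)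
        (fderiv ℝ (fderiv ℝ h) (x + (0 : ℝ) • v) v v) 0 :=
      (ContinuousLinearMap.apply ℝ ℝ v).hasFDerivAt.comp_hasDerivAt 0
        (h2.hasFDerivAt.comp_hasDerivAt 0 (hline 0))
    rw [h3.deriv, zero_smul, add_zero]
  have hfmin : IsLocalMin f 0 := by
    have := hcont.eventually hmin
    simpa [IsLocalMin, IsMinFilter, hf] using this
  by_contra! hneg
  rw [← hdd] at hneg
  have hfc : ContinuousAt f 0 := by
    have : ContinuousAt h (x + (0 : ℝ) • v) := by simpa using hC.continuousAt
    exact ContinuousAt.comp (f := fun t : ℝ => x + t • v) this (hline 0).continuousAt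
  have hfmax := isLocalMax_of_deriv_deriv_neg hneg hfmin.deriv_eq_zero hfc
  have hconst : f =ᶠ[nhds 0] fun _ => f 0 := by
    filter_upwards [hfmin, hfmax] with t h1 h2 using le_antisymm h2 h1
  have : deriv (deriv f) 0 = 0 := by
    rw [hconst.deriv.deriv_eq]; simp
  linarith

lemma fderiv_fderiv_sub {f g : E → ℝ} {x : E} (hf : ContDiffAt ℝ 2 f x)
    (hg : ContDiffAt ℝ 2 g x) :
    fderiv ℝ (fderiv ℝ (fun y => f y - g y)) x =
      fderiv ℝ (fderiv ℝ f) x - fderiv ℝ (fderiv ℝ g) x := by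
  have h : fderiv ℝ (fun y => f y - g y) =ᶠ[nhds x] fun y => fderiv ℝ f y - fderiv ℝ g y := by
    filter_upwards [hf.eventually (by simp), hg.eventually (by simp)] with y h1 h2
    exact fderiv_fun_sub (h1.differentiableAt (by simp)) (h2.differentiableAt (by simp))
  rw [h.fderiv_eq]
  exact fderiv_fun_sub ((hf.fderiv_right (m := 1) (by norm_num)).differentiableAt (by simp))
    ((hg.fderiv_right (m := 1) (by norm_num)).differentiableAt (by simp))

lemma fderiv_eq_of_isLocalMin_sub {f g : E → ℝ} {x : E} (hf : ContDiffAt ℝ 2 f x)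
    (hg : ContDiffAt ℝ 2 g x) (h : IsLocalMin (fun y => f y - g y) x) :
    fderiv ℝ f x = fderiv ℝ g x := by
  have := h.fderiv_eq_zero
  rwa [fderiv_fun_sub (hf.differentiableAt (by simp)) (hg.differentiableAt (by simp)),
    sub_eq_zero] at this

lemma fderiv_fderiv_le_of_isLocalMin_sub {f g : E → ℝ} {x : E} (hf : ContDiffAt ℝ 2 f x)
    (hg : ContDiffAt ℝ 2 g x) (h : IsLocalMin (fun y => f y - g y) x) (v : E) :
    fderiv ℝ (fderiv ℝ g) x v v ≤ fderiv ℝ (fderiv ℝ f) x v v := by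
  have := h.fderiv_fderiv_nonneg (hf.sub hg) v
  rw [fderiv_fderiv_sub hf hg] at this
  simpa using this

end SecondOrder

/-- The touching principle for the mean curvature operator. -/
lemma meanCurv_le_of_isLocalMin_sub {f g : Plane → ℝ} {x : Plane} (hf : ContDiffAt ℝ 2 f x)
    (hg : ContDiffAt ℝ 2 g x) (h : IsLocalMin (fun y => f y - g y) x) :
    meanCurv g x ≤ meanCurv f x := by
  rw [meanCurv_eq, meanCurv_eq, gradient_congr (fderiv_eq_of_isLocalMin_sub hf hg h)]
  gcongr
  exact jetOp_mono _ (fderiv_fderiv_le_of_isLocalMin_sub hf hg h)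

section Radial

variable {E : Type*} [NormedAddCommGroup E] [InnerProductSpace ℝ E]

lemma hasFDerivAt_comp_norm_sub_sq {Φ : ℝ → ℝ} {Φ' : ℝ} (y x : E)
    (h : HasDerivAt Φ Φ' (‖x - y‖ ^ 2)) :
    HasFDerivAt (fun x => Φ (‖x - y‖ ^ 2)) ((2 * Φ') • innerSL ℝ (x - y)) x := by
  have h1 : HasFDerivAt (fun x : E => ‖x - y‖ ^ 2) (2 • innerSL ℝ (x - y)) x := by
    simpa using ((hasFDerivAt_id x).sub_const y).norm_sq
  refine (h.comp_hasFDerivAt x h1).congr_fderiv ?_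
  ext v
  simp
  ring

lemma contDiff_comp_norm_sub_sq {Φ : ℝ → ℝ} (hΦ : ContDiff ℝ 2 Φ) (y : E) :
    ContDiff ℝ 2 (fun x => Φ (‖x - y‖ ^ 2)) :=
  hΦ.comp ((contDiff_id.sub contDiff_const).norm_sq ℝ)

lemma fderiv_comp_norm_sub_sq {Φ : ℝ → ℝ} (hΦ : ContDiff ℝ 2 Φ) (y x : E) :
    fderiv ℝ (fun x => Φ (‖x - y‖ ^ 2)) x = (2 * deriv Φ (‖x - y‖ ^ 2)) • innerSL ℝ (x - y) :=
  (hasFDerivAt_comp_norm_sub_sq y x (hΦ.differentiable (by simp) _).hasDerivAt).fderiv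

lemma fderiv_fderiv_comp_norm_sub_sq {Φ : ℝ → ℝ} (hΦ : ContDiff ℝ 2 Φ) (y x v : E) :
    fderiv ℝ (fderiv ℝ (fun x => Φ (‖x - y‖ ^ 2))) x v v =
      4 * deriv (deriv Φ) (‖x - y‖ ^ 2) * inner ℝ (x - y) v ^ 2 +
        2 * deriv Φ (‖x - y‖ ^ 2) * ‖v‖ ^ 2 := by
  have h1 : fderiv ℝ (fun x => Φ (‖x - y‖ ^ 2)) =
      fun x => (2 * deriv Φ (‖x - y‖ ^ 2)) • innerSL ℝ (x - y) :=
    funext fun x => fderiv_comp_norm_sub_sq hΦ y x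
  have h2 : DifferentiableAt ℝ (deriv Φ) (‖x - y‖ ^ 2) :=
    ((contDiff_succ_iff_deriv (n := 1)).1 hΦ).2.2.differentiable (by simp) _
  have h3 := (hasFDerivAt_comp_norm_sub_sq y x h2.hasDerivAt).const_mul 2
  have h4 : HasFDerivAt (fun x : E => innerSL ℝ (x - y)) (innerSL ℝ : E →L[ℝ] E →L[ℝ] ℝ) x :=
    (innerSL ℝ : E →L[ℝ] E →L[ℝ] ℝ).hasFDerivAt.comp x ((hasFDerivAt_id x).sub_const y)
  have h5 : (innerSL ℝ : E →L[ℝ] E →L[ℝ] ℝ) v v = ‖v‖ ^ 2 := by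
    rw [innerSL_apply_apply, real_inner_self_eq_norm_sq]
  rw [h1, (h3.fun_smul h4).fderiv]
  simp [h5, inner_sub_left]
  ring

end Radial

lemma gradient_comp_norm_sub_sq {Φ : ℝ → ℝ} (hΦ : ContDiff ℝ 2 Φ) (y x : Plane) :
    gradient (fun x => Φ (‖x - y‖ ^ 2)) x = (2 * deriv Φ (‖x - y‖ ^ 2)) • (x - y) := by
  refine (hasGradientAt_iff_hasFDerivAt.2 ?_).gradient
  refine (hasFDerivAt_comp_norm_sub_sq y x
    (hΦ.differentiable (by simp) _).hasDerivAt).congr_fderiv ?_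
  ext v
  simp

lemma norm_rot (p : Plane) : ‖rot p‖ = ‖p‖ := by
  rw [← sq_eq_sq₀ (norm_nonneg _) (norm_nonneg _), plane_norm_sq, plane_norm_sq]
  simp [rot]; ring

/-- The mean curvature numerator of a radial function about `y`, evaluated at the gradient `p`. -/
lemma jetOp_comp_norm_sub_sq {Φ : ℝ → ℝ} (hΦ : ContDiff ℝ 2 Φ) (y x p : Plane) :
    jetOp p (fderiv ℝ (fderiv ℝ (fun x => Φ (‖x - y‖ ^ 2))) x) =
      4 * deriv (deriv Φ) (‖x - y‖ ^ 2) * (‖x - y‖ ^ 2 + inner ℝ (x - y) (rot p) ^ 2) +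
        2 * deriv Φ (‖x - y‖ ^ 2) * (2 + ‖p‖ ^ 2) := by
  simp only [jetOp, fderiv_fderiv_comp_norm_sub_sq hΦ, norm_rot]
  rw [plane_inner, plane_inner, plane_norm_sq (x - y)]
  simp; ring

lemma meanCurv_comp_norm_sub_sq {Φ : ℝ → ℝ} (hΦ : ContDiff ℝ 2 Φ) (y x : Plane) :
    meanCurv (fun x => Φ (‖x - y‖ ^ 2)) x =
      (4 * deriv (deriv Φ) (‖x - y‖ ^ 2) * ‖x - y‖ ^ 2 + 4 * deriv Φ (‖x - y‖ ^ 2) +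
        8 * deriv Φ (‖x - y‖ ^ 2) ^ 3 * ‖x - y‖ ^ 2) /
      √(1 + 4 * deriv Φ (‖x - y‖ ^ 2) ^ 2 * ‖x - y‖ ^ 2) ^ 3 := by
  rw [meanCurv_eq, jetOp_comp_norm_sub_sq hΦ, gradient_comp_norm_sub_sq hΦ, norm_smul]
  have : inner ℝ (x - y) (rot ((2 * deriv Φ (‖x - y‖ ^ 2)) • (x - y))) = 0 := by
    rw [plane_inner]; simp [rot]; ring
  rw [this, mul_pow, Real.norm_eq_abs, sq_abs]
  congr 1
  · ring
  · ring_nf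

lemma contDiff_mcCoeff {n : ℕ} :
    ContDiff ℝ 1 fun (p : EuclideanSpace ℝ (Fin n)) (i j : Fin n) => mcCoeff p i j := by
  refine contDiff_pi.2 fun i => contDiff_pi.2 fun j => ?_
  have h : ContDiff ℝ 1 fun p : EuclideanSpace ℝ (Fin n) => 1 + ‖p‖ ^ 2 :=
    contDiff_const.add (contDiff_id.norm_sq ℝ)
  have hc : ∀ k, ContDiff ℝ 1 fun p : EuclideanSpace ℝ (Fin n) => p k := fun k => by fun_prop
  have hpos : ∀ p : EuclideanSpace ℝ (Fin n), 1 + ‖p‖ ^ 2 ≠ 0 := fun p => by positivity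
  exact ((h.sqrt hpos).inv fun p => Real.sqrt_ne_zero'.2 (by positivity)).mul
    (contDiff_const.sub (((hc i).mul (hc j)).div h hpos))

lemma exists_forall_abs_sum_mcCoeff_sub_le (M : ℝ) :
    ∃ L, ∀ p q : Plane, ‖p‖ ≤ M → ‖q‖ ≤ M → ∀ A : Plane →L[ℝ] Plane →L[ℝ] ℝ, ‖A‖ ≤ M →
      jetOp q A / √(1 + ‖q‖ ^ 2) ^ 3 - jetOp p A / √(1 + ‖p‖ ^ 2) ^ 3 ≤ L * ‖p - q‖ := by
  obtain ⟨L, hL⟩ := (contDiff_mcCoeff (n := 2)).contDiffOn.exists_lipschitzOnWith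
    (s := closedBall 0 M) (by simp) (convex_closedBall _ _) (isCompact_closedBall _ _)
  refine ⟨4 * (L * M), fun p q hp hq A hA => ?_⟩
  rw [← sum_mcCoeff_mul_eq, ← sum_mcCoeff_mul_eq, ← Finset.sum_sub_distrib]
  simp_rw [← Finset.sum_sub_distrib, ← sub_mul]
  have key : ∀ i j, (mcCoeff q i j - mcCoeff p i j) *
      A (EuclideanSpace.single i 1) (EuclideanSpace.single j 1) ≤ L * ‖p - q‖ * M := by
    intro i j
    have h1 := hL.dist_le_mul q (by simpa using hq) p (by simpa using hp)
    have h2 := (dist_le_pi_dist _ _ j).trans ((dist_le_pi_dist _ _ i).trans h1)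
    rw [Real.dist_eq, dist_comm, dist_eq_norm] at h2
    have h3 := A.le_opNorm₂ (EuclideanSpace.single i 1) (EuclideanSpace.single j 1)
    simp only [PiLp.norm_single, norm_one, mul_one, Real.norm_eq_abs] at h3
    calc _ ≤ |_| := le_abs_self _
      _ ≤ L * ‖p - q‖ * M := by
        rw [abs_mul]
        exact mul_le_mul h2 (h3.trans hA) (abs_nonneg _) (by positivity)
  refine (Finset.sum_le_sum fun i _ => Finset.sum_le_sum fun j _ => key i j).trans ?_
  simp
  linarith

lemma ContDiffOn.continuousOn_gradient {u : Plane → ℝ} {W : Set Plane} (hW : IsOpen W)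
    (hu : ContDiffOn ℝ 2 u W) : ContinuousOn (gradient u) W :=
  (InnerProductSpace.toDual ℝ Plane).symm.continuous.comp_continuousOn
    (hu.continuousOn_fderiv_of_isOpen hW (by norm_num))

/-- A decaying radial exponential is, for a large exponent, a strict barrier for the difference of
two functions of equal mean curvature. -/
lemma exists_exp_barrier {W K : Set Plane} {u v : Plane → ℝ} (hW : IsOpen W) (hK : IsCompact K)
    (hKW : K ⊆ W) (hu : ContDiffOn ℝ 2 u W) (hv : ContDiffOn ℝ 2 v W)
    (h : ∀ x ∈ K, meanCurv u x = meanCurv v x) {y : Plane} (hy : y ∉ K) :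
    ∃ γ > 0, ∀ δ > 0, ∀ x ∈ K,
      ¬ IsLocalMin (fun x => u x - v x - δ * Real.exp (-γ * ‖x - y‖ ^ 2)) x := by
  have hgu := (hu.continuousOn_gradient hW).mono hKW
  have hgv := (hv.continuousOn_gradient hW).mono hKW
  have hHv : ContinuousOn (fderiv ℝ (fderiv ℝ v)) K :=
    ((hv.fderiv_of_isOpen hW (m := 1) (by norm_num)).continuousOn_fderiv_of_isOpen hW
      (by simp)).mono hKW
  obtain ⟨M₁, hM₁⟩ := hK.exists_bound_of_continuousOn hgu
  obtain ⟨M₂, hM₂⟩ := hK.exists_bound_of_continuousOn hgv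
  obtain ⟨M₃, hM₃⟩ := hK.exists_bound_of_continuousOn
    (E := Plane →L[ℝ] Plane →L[ℝ] ℝ) hHv
  obtain ⟨L, hL⟩ := exists_forall_abs_sum_mcCoeff_sub_le (max M₁ (max M₂ M₃))
  have hξ : ∀ x ∈ K, 0 < ‖x - y‖ := fun x hx => by
    rw [norm_pos_iff, sub_ne_zero]; rintro rfl; exact hy hx
  obtain ⟨C, hC⟩ := hK.exists_bound_of_continuousOn (f := fun x =>
      (2 + ‖gradient u x‖ ^ 2 + √(1 + ‖gradient u x‖ ^ 2) ^ 3 * L * ‖x - y‖) / (2 * ‖x - y‖ ^ 2)) <|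
    ContinuousOn.div (by fun_prop) (by fun_prop) fun x hx => by have := hξ x hx; positivity
  refine ⟨|C| + 1, by positivity, fun δ hδ x hx hmin => ?_⟩
  set γ := |C| + 1 with hγ
  have hγ0 : 0 < γ := by positivity
  set Φ : ℝ → ℝ := fun s => δ * Real.exp (-γ * s) with hΦ
  have hΦc : ContDiff ℝ 2 Φ := by fun_prop
  have hd : deriv Φ = fun s => -γ * Φ s := by
    ext s
    have : HasDerivAt Φ (δ * (Real.exp (-γ * s) * (-γ * 1))) s :=
      ((hasDerivAt_id s).const_mul (-γ)).exp.const_mul δ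
    rw [this.deriv]; simp only [hΦ]; ring
  have hdd : deriv (deriv Φ) = fun s => γ ^ 2 * Φ s := by
    ext s
    rw [hd, deriv_const_mul _ (hΦc.differentiable (by simp) s), hd]; ring
  have hxW := hW.mem_nhds (hKW hx)
  have huv := (hu.contDiffAt hxW).sub (hv.contDiffAt hxW)
  have hψ := (contDiff_comp_norm_sub_sq hΦc y).contDiffAt (x := x)
  have h1 := fderiv_eq_of_isLocalMin_sub huv hψ hmin
  have h2 := fderiv_fderiv_le_of_isLocalMin_sub huv hψ hmin
  rw [fderiv_fun_sub ((hu.contDiffAt hxW).differentiableAt (by simp))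
    ((hv.contDiffAt hxW).differentiableAt (by simp))] at h1
  have h3 : gradient u x - gradient v x = (2 * deriv Φ (‖x - y‖ ^ 2)) • (x - y) := by
    rw [← gradient_comp_norm_sub_sq hΦc]
    simp only [gradient, ← map_sub, h1]
  have h4 := jetOp_mono (gradient u x) h2
  rw [fderiv_fderiv_sub (hu.contDiffAt hxW) (hv.contDiffAt hxW),
    jetOp_comp_norm_sub_sq hΦc] at h4
  have h5 : ∀ A B : Plane →L[ℝ] Plane →L[ℝ] ℝ, ∀ p, jetOp p (A - B) = jetOp p A - jetOp p B := by
    intro A B p; simp [jetOp]; ring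
  have h6 := h x hx
  rw [meanCurv_eq, meanCurv_eq] at h6
  have h7 := hL (gradient u x) (gradient v x) ((hM₁ x hx).trans (by simp))
    ((hM₂ x hx).trans (by simp)) (fderiv ℝ (fderiv ℝ v) x) ((hM₃ x hx).trans (by simp))
  have hT : 0 < Φ (‖x - y‖ ^ 2) := by positivity
  rw [← h6, ← sub_div, ← h5, div_le_iff₀ (by positivity), h3, norm_smul] at h7
  have h8 := h4.trans h7
  have hx0 := hξ x hx
  have h9 := (le_abs_self _).trans (hC x hx)
  rw [div_le_iff₀ (by positivity)] at h9
  rw [hdd, hd] at h8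
  simp only [Real.norm_eq_abs, abs_mul, abs_neg, abs_of_pos hT, abs_of_pos hγ0, abs_two] at h8
  set T := Φ (‖x - y‖ ^ 2)
  set N := √(1 + ‖gradient u x‖ ^ 2) ^ 3
  have h10 : 0 ≤ γ * T * inner ℝ (x - y) (rot (gradient u x)) ^ 2 := by positivity
  have h11 : 2 * γ * T * (2 * γ * ‖x - y‖ ^ 2) ≤
      2 * γ * T * (2 + ‖gradient u x‖ ^ 2 + N * L * ‖x - y‖) := by
    nlinarith [mul_nonneg hγ0.le h10]
  have h12 := le_of_mul_le_mul_left h11 (by positivity)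
  have h13 : C < γ := by rw [hγ]; linarith [le_abs_self C]
  nlinarith [mul_pos (sub_pos.2 h13) (pow_pos hx0 2)]

/-- The weak comparison principle. -/
lemma le_of_meanCurv_eq_of_frontier {S : Set Plane} {u v : Plane → ℝ} (hS : IsOpen S)
    (hb : Bornology.IsBounded S) (hu : ContDiffOn ℝ 2 u S) (hv : ContDiffOn ℝ 2 v S)
    (huc : ContinuousOn u (closure S)) (hvc : ContinuousOn v (closure S))
    (h : ∀ x ∈ S, meanCurv u x = meanCurv v x) (hfr : ∀ x ∈ frontier S, v x ≤ u x) :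
    ∀ x ∈ S, v x ≤ u x := by
  by_contra! hcon
  obtain ⟨x₀, hx₀, hlt⟩ := hcon
  set ε := (v x₀ - u x₀) / 2 with hε
  have hε0 : 0 < ε := by linarith
  have hcpt : IsCompact (closure S) := hb.isCompact_closure
  obtain ⟨y, hy⟩ : ∃ y, y ∉ closure S := by
    by_contra! hall
    exact NormedSpace.unbounded_univ ℝ Plane (hb.closure.subset fun x _ => hall x)
  have hwc := huc.sub hvc
  set K := closure S ∩ (fun x => u x - v x) ⁻¹' Iic (-ε) with hK
  have hKc : IsCompact K :=
    hcpt.of_isClosed_subset (hwc.preimage_isClosed_of_isClosed isClosed_closure isClosed_Iic)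
      inter_subset_left
  have hKS : K ⊆ S := by
    rintro x ⟨hx, hxε⟩
    by_contra hxS
    have := hfr x ⟨hx, by rwa [hS.interior_eq]⟩
    simp only [mem_preimage, mem_Iic] at hxε
    linarith
  obtain ⟨γ, hγ, hbar⟩ := exists_exp_barrier hS hKc hKS hu hv (fun x hx => h x (hKS hx))
    (fun hyK => hy hyK.1)
  have hψ : ∀ x : Plane, Real.exp (-γ * ‖x - y‖ ^ 2) ≤ 1 := fun x =>
    Real.exp_le_one_iff.2 (by have : 0 ≤ γ * ‖x - y‖ ^ 2 := by positivity
                              linarith)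
  obtain ⟨m, hm, hmin⟩ := hcpt.exists_isMinOn ⟨x₀, subset_closure hx₀⟩
    (f := fun x => u x - v x - ε / 2 * Real.exp (-γ * ‖x - y‖ ^ 2)) (hwc.sub (by fun_prop))
  have hmK : m ∈ K := by
    refine ⟨hm, ?_⟩
    have h1 := hmin (subset_closure hx₀)
    simp only [mem_ofPred_eq] at h1
    have h2 := mul_le_mul_of_nonneg_left (hψ m) (half_pos hε0).le
    have h3 : 0 < ε / 2 * Real.exp (-γ * ‖x₀ - y‖ ^ 2) := by positivity
    simp only [mem_preimage, mem_Iic]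
    linarith
  exact hbar (ε / 2) (half_pos hε0) m hmK
    ((hmin.on_subset subset_closure).isLocalMin (hS.mem_nhds (hKS hmK)))

/-- The boundary point lemma on a ball. -/
lemma fderiv_ne_of_meanCurv_eq_of_lt {W : Set Plane} {u v : Plane → ℝ} (hW : IsOpen W)
    (hu : ContDiffOn ℝ 2 u W) (hv : ContDiffOn ℝ 2 v W)
    (h : ∀ x ∈ W, meanCurv u x = meanCurv v x) {y q : Plane} {d : ℝ} (hd : 0 < d)
    (hball : closedBall y d ⊆ W) (hlt : ∀ x ∈ ball y d, v x < u x)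
    (hle : ∀ x ∈ sphere y d, v x ≤ u x) (hq : q ∈ sphere y d)
    (huv : u q = v q) : fderiv ℝ u q ≠ fderiv ℝ v q := by
  intro hder
  set K := closedBall y d \ ball y (d / 2) with hKdef
  have hKc : IsCompact K := (isCompact_closedBall y d).diff isOpen_ball
  have hKW : K ⊆ W := sdiff_subset.trans hball
  obtain ⟨γ, hγ, hbar⟩ := exists_exp_barrier hW hKc hKW hu hv (fun x hx => h x (hKW hx))
    (y := y) (fun hy => hy.2 (by simpa using hd))
  have hwc : ContinuousOn (fun x => u x - v x) W := hu.continuousOn.sub hv.continuousOn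
  have hsph : sphere y (d / 2) ⊆ ball y d := fun x hx => by
    rw [mem_sphere] at hx; rw [mem_ball]; linarith
  obtain ⟨δ, hδ0, hδ⟩ : ∃ δ > 0, ∀ x ∈ sphere y (d / 2), δ ≤ u x - v x := by
    obtain ⟨x, hx, hmin⟩ := (isCompact_sphere y (d / 2)).exists_isMinOn
      (NormedSpace.sphere_nonempty.2 (by positivity))
      (hwc.mono (hsph.trans (ball_subset_closedBall.trans hball)))
    exact ⟨u x - v x, sub_pos.2 (hlt x (hsph hx)), fun z hz => hmin hz⟩
  have hqy : ‖q - y‖ = d := by rwa [← dist_eq_norm]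
  have hqW : q ∈ W := hball (sphere_subset_closedBall hq)
  have hqK : q ∈ K := ⟨sphere_subset_closedBall hq, by
    rw [mem_sphere] at hq; rw [mem_ball]; linarith⟩
  have hmin : IsMinOn (fun x => u x - v x - δ * Real.exp (-γ * ‖x - y‖ ^ 2)) K q := by
    obtain ⟨m, hm, hmin⟩ := hKc.exists_isMinOn ⟨q, hqK⟩
      (f := fun x => u x - v x - δ * Real.exp (-γ * ‖x - y‖ ^ 2))
      ((hwc.mono hKW).sub (by fun_prop))
    suffices hqm : u q - v q - δ * Real.exp (-γ * ‖q - y‖ ^ 2) ≤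
        u m - v m - δ * Real.exp (-γ * ‖m - y‖ ^ 2) from fun x hx => hqm.trans (hmin hx)
    have hm1 : dist m y ≤ d := hm.1
    have hm2 : d / 2 ≤ dist m y := not_lt.1 hm.2
    rcases hm1.eq_or_lt with hm1 | hm1
    · rw [hqy, ← dist_eq_norm m, hm1, huv, sub_self]
      linarith [hle m hm1]
    rcases hm2.eq_or_lt with hm2 | hm2
    · have h1 := hδ m hm2.symm
      have h2 : Real.exp (-γ * ‖m - y‖ ^ 2) ≤ 1 := Real.exp_le_one_iff.2 (by
        have : 0 ≤ γ * ‖m - y‖ ^ 2 := by positivity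
        linarith)
      have h3 : 0 < δ * Real.exp (-γ * ‖q - y‖ ^ 2) := by positivity
      rw [huv]
      nlinarith
    · refine absurd (hmin.isLocalMin ?_) (hbar δ hδ0 m hm)
      have hopen : IsOpen {x | d / 2 < dist x y ∧ dist x y < d} :=
        (isOpen_lt continuous_const (continuous_id.dist continuous_const)).and
          (isOpen_lt (continuous_id.dist continuous_const) continuous_const)
      exact Filter.mem_of_superset (hopen.mem_nhds ⟨hm2, hm1⟩)
        fun x hx => ⟨hx.2.le, not_lt.2 hx.1.le⟩
  have hdu := ((hu.contDiffAt (hW.mem_nhds hqW)).differentiableAt (by simp)).hasFDerivAt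
  have hdv := ((hv.contDiffAt (hW.mem_nhds hqW)).differentiableAt (by simp)).hasFDerivAt
  have hexp : HasDerivAt (fun s => δ * Real.exp (-γ * s))
      (δ * (Real.exp (-γ * ‖q - y‖ ^ 2) * (-γ * 1))) (‖q - y‖ ^ 2) :=
    ((hasDerivAt_id _).const_mul (-γ)).exp.const_mul δ
  have hdF := (hdu.sub hdv).sub (hasFDerivAt_comp_norm_sub_sq y q hexp)
  have hcone : (1 / 2 : ℝ) • (y - q) ∈ posTangentConeAt K q := by
    refine mem_posTangentConeAt_of_segment_subset ?_
    rintro _ ⟨a, b, ha, hb, hab, rfl⟩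
    have : dist (a • q + b • (q + (1 / 2 : ℝ) • (y - q))) y = (1 - b / 2) * d := by
      have h1 : a • q + b • (q + (1 / 2 : ℝ) • (y - q)) - y = (1 - b / 2) • (q - y) := by
        obtain rfl : a = 1 - b := by linarith
        module
      rw [dist_eq_norm, h1, norm_smul, hqy, Real.norm_of_nonneg (by linarith)]
    constructor
    · rw [mem_closedBall, this]; nlinarith
    · rw [mem_ball, this]; nlinarith
  have := hmin.localize.hasFDerivWithinAt_nonneg hdF.hasFDerivWithinAt hcone
  rw [hder] at this
  have hinner : inner ℝ (q - y) (y - q) = -d ^ 2 := by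
    rw [← neg_sub q y, inner_neg_right, real_inner_self_eq_norm_sq, hqy]
  rw [inner_sub_left] at hinner
  simp [hinner, hqy] at this
  have hpos : 0 < γ * d ^ 2 * δ * Real.exp (-(γ * d ^ 2)) := by positivity
  nlinarith

/-- The strong maximum principle for the difference of two functions of equal mean curvature. -/
lemma eventuallyEq_of_meanCurv_eq_of_le {W : Set Plane} {u v : Plane → ℝ} (hW : IsOpen W)
    (hu : ContDiffOn ℝ 2 u W) (hv : ContDiffOn ℝ 2 v W)
    (h : ∀ x ∈ W, meanCurv u x = meanCurv v x) (hle : ∀ x ∈ W, v x ≤ u x) {q : Plane}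
    (hq : q ∈ W) (huv : u q = v q) : u =ᶠ[nhds q] v := by
  obtain ⟨r, hr, hrW⟩ := Metric.nhds_basis_closedBall.mem_iff.1 (hW.mem_nhds hq)
  filter_upwards [ball_mem_nhds q (half_pos hr)] with y hy
  rw [mem_ball] at hy
  by_contra hne
  set Z := closedBall q r ∩ (fun x => u x - v x) ⁻¹' {0} with hZ
  have hwc : ContinuousOn (fun x => u x - v x) W := hu.continuousOn.sub hv.continuousOn
  have hZc : IsCompact Z := (isCompact_closedBall q r).of_isClosed_subset
    ((hwc.mono hrW).preimage_isClosed_of_isClosed isClosed_closedBall isClosed_singleton)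
    inter_subset_left
  have hqZ : q ∈ Z := ⟨mem_closedBall_self hr.le, by simp [huv]⟩
  obtain ⟨p, hp, hpy⟩ := hZc.exists_infDist_eq_dist ⟨q, hqZ⟩ y
  have hpW : p ∈ W := hrW hp.1
  have hpuv : u p = v p := sub_eq_zero.1 hp.2
  have hd : 0 < dist y p := by
    rw [dist_pos]; rintro rfl; exact hne hpuv
  have hdq : dist y p < r / 2 := by
    rw [← hpy]; exact (infDist_le_dist_of_mem hqZ).trans_lt hy
  have hsub : closedBall y (dist y p) ⊆ closedBall q r := fun x hx => by
    rw [mem_closedBall] at hx ⊢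
    linarith [dist_triangle x y q]
  refine fderiv_ne_of_meanCurv_eq_of_lt hW hu hv h hd (hsub.trans hrW) (fun x hx => ?_)
    (fun x hx => hle x (hrW (hsub (sphere_subset_closedBall hx)))) (mem_sphere'.2 rfl) hpuv ?_
  · have hx' := hsub (ball_subset_closedBall hx)
    refine (hle x (hrW hx')).lt_of_ne fun hxe => ?_
    have : x ∈ Z := ⟨hx', by simp [hxe]⟩
    have := infDist_le_dist_of_mem this (x := y)
    rw [hpy, dist_comm y x] at this
    exact absurd hx (not_lt.2 this)
  · refine fderiv_eq_of_isLocalMin_sub (hu.contDiffAt (hW.mem_nhds hpW))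
      (hv.contDiffAt (hW.mem_nhds hpW)) ?_
    filter_upwards [hW.mem_nhds hpW] with x hx
    simp only [hpuv, sub_self]
    exact sub_nonneg.2 (hle x hx)

/-- The linear reflection in the line orthogonal to the unit vector `n`. -/
def linMirror (n : Plane) : Plane →L[ℝ] Plane :=
  ContinuousLinearMap.id ℝ Plane - (2 : ℝ) • (innerSL ℝ n).smulRight n

/-- The reflection in the line through `z` orthogonal to the unit vector `n`. -/
def mirror (z n x : Plane) : Plane := x - (2 * inner ℝ (x - z) n) • n

lemma linMirror_apply (n v : Plane) : linMirror n v = v - (2 * inner ℝ n v) • n := by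
  simp [linMirror, smul_smul]

lemma hasFDerivAt_mirror (z n x : Plane) : HasFDerivAt (mirror z n) (linMirror n) x := by
  have h : mirror z n = fun x => linMirror n x + (2 * inner ℝ n z) • n := by
    ext1 x
    rw [linMirror_apply, mirror, real_inner_comm, inner_sub_right]
    module
  rw [h]
  exact (linMirror n).hasFDerivAt.add_const _

lemma contDiff_mirror (z n : Plane) : ContDiff ℝ 2 (mirror z n) :=
  contDiff_id.sub ((contDiff_const.mul
    ((contDiff_id.sub contDiff_const).inner ℝ contDiff_const)).smul contDiff_const)

lemma continuous_mirror (z n : Plane) : Continuous (mirror z n) := (contDiff_mirror z n).continuous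

lemma inner_linMirror {n : Plane} (hn : ‖n‖ = 1) (v w : Plane) :
    inner ℝ (linMirror n v) (linMirror n w) = inner ℝ v w := by
  simp only [linMirror_apply, inner_sub_left, inner_sub_right, inner_smul_left, inner_smul_right,
    real_inner_self_eq_norm_sq, hn, real_inner_comm n v]
  simp
  ring

lemma inner_linMirror_left (n v w : Plane) :
    inner ℝ (linMirror n v) w = inner ℝ v (linMirror n w) := by
  simp only [linMirror_apply, inner_sub_left, inner_sub_right, inner_smul_left, inner_smul_right,
    real_inner_comm n v]
  simp
  ring

lemma norm_linMirror {n : Plane} (hn : ‖n‖ = 1) (v : Plane) : ‖linMirror n v‖ = ‖v‖ := by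
  rw [← sq_eq_sq₀ (norm_nonneg _) (norm_nonneg _), ← real_inner_self_eq_norm_sq,
    inner_linMirror hn, real_inner_self_eq_norm_sq]

lemma jetOp_linMirror {n : Plane} (hn : ‖n‖ = 1) (p : Plane) {A B : Plane →L[ℝ] Plane →L[ℝ] ℝ}
    (hB : ∀ v, B v v = A (linMirror n v) (linMirror n v)) :
    jetOp (linMirror n p) B = jetOp p A := by
  have hn2 : n 0 ^ 2 + n 1 ^ 2 = 1 := by rw [← plane_norm_sq, hn, one_pow]
  have h1 : linMirror n (rot (linMirror n p)) = -rot p := by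
    ext i
    fin_cases i
    · simp [linMirror_apply, plane_inner, rot]
      linear_combination (2 * p 1) * hn2
    · simp [linMirror_apply, plane_inner, rot]
      linear_combination (-2 * p 0) * hn2
  have h2 : linMirror n (EuclideanSpace.single 0 1) = (1 - 2 * n 0 ^ 2) • EuclideanSpace.single 0 1
      + (-2 * n 0 * n 1) • EuclideanSpace.single 1 1 := by
    ext i; fin_cases i
    · simp [linMirror_apply, plane_inner]; ring
    · simp [linMirror_apply, plane_inner]
  have h3 : linMirror n (EuclideanSpace.single 1 1) = (-2 * n 0 * n 1) • EuclideanSpace.single 0 1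
      + (1 - 2 * n 1 ^ 2) • EuclideanSpace.single 1 1 := by
    ext i; fin_cases i <;> simp [linMirror_apply, plane_inner] <;> ring
  simp only [jetOp, hB, h1, h2, h3, map_neg, map_add, map_smul, add_apply, smul_apply, neg_apply,
    smul_eq_mul]
  set a := A (EuclideanSpace.single 0 1) (EuclideanSpace.single 0 1)
  set b := A (EuclideanSpace.single 0 1) (EuclideanSpace.single 1 1)
  set c := A (EuclideanSpace.single 1 1) (EuclideanSpace.single 0 1)
  set d := A (EuclideanSpace.single 1 1) (EuclideanSpace.single 1 1)
  linear_combination (4 * n 0 ^ 2 * a + 4 * n 1 ^ 2 * d + 4 * n 0 * n 1 * b + 4 * n 0 * n 1 * c)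
    * hn2

lemma fderiv_comp_mirror {u : Plane → ℝ} {z n x : Plane}
    (hu : DifferentiableAt ℝ u (mirror z n x)) :
    fderiv ℝ (fun y => u (mirror z n y)) x = (fderiv ℝ u (mirror z n x)).comp (linMirror n) :=
  (hu.hasFDerivAt.comp x (hasFDerivAt_mirror z n x)).fderiv

lemma meanCurv_comp_mirror {u : Plane → ℝ} {z n x : Plane} (hn : ‖n‖ = 1)
    (hu : ContDiffAt ℝ 2 u (mirror z n x)) :
    meanCurv (fun y => u (mirror z n y)) x = meanCurv u (mirror z n x) := by
  have h1 : fderiv ℝ (fun y => u (mirror z n y)) =ᶠ[nhds x]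
      fun y => (fderiv ℝ u (mirror z n y)).comp (linMirror n) := by
    filter_upwards [(continuous_mirror z n).continuousAt.eventually (hu.eventually (by simp))]
      with y hy
    exact fderiv_comp_mirror (hy.differentiableAt (by simp))
  have h2 : gradient (fun y => u (mirror z n y)) x = linMirror n (gradient u (mirror z n x)) := by
    refine ext_inner_right ℝ fun w => ?_
    rw [inner_linMirror_left, inner_gradient_left, inner_gradient_left, h1.eq_of_nhds]
    rfl
  have h3 : ∀ v, fderiv ℝ (fderiv ℝ (fun y => u (mirror z n y))) x v v =
      fderiv ℝ (fderiv ℝ u) (mirror z n x) (linMirror n v) (linMirror n v) := by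
    intro v
    have h4 : DifferentiableAt ℝ (fderiv ℝ u) (mirror z n x) :=
      (hu.fderiv_right (m := 1) (by norm_num)).differentiableAt (by simp)
    have h5 : HasFDerivAt (fun y => fderiv ℝ u (mirror z n y))
        ((fderiv ℝ (fderiv ℝ u) (mirror z n x)).comp (linMirror n)) x :=
      h4.hasFDerivAt.comp x (hasFDerivAt_mirror z n x)
    rw [h1.fderiv_eq, (h5.clm_comp (hasFDerivAt_const (linMirror n) x)).fderiv]
    simp
  rw [meanCurv_eq, meanCurv_eq, h2, jetOp_linMirror hn _ h3, norm_linMirror hn]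

lemma mirror_sub (z n x : Plane) : mirror z n x - z = linMirror n (x - z) := by
  rw [mirror, linMirror_apply, real_inner_comm]; abel

lemma norm_mirror_sub {n : Plane} (hn : ‖n‖ = 1) (z x : Plane) : ‖mirror z n x - z‖ = ‖x - z‖ := by
  rw [mirror_sub, norm_linMirror hn]

lemma norm_mirror_sq {n : Plane} (hn : ‖n‖ = 1) (z x : Plane) :
    ‖mirror z n x‖ ^ 2 = ‖x‖ ^ 2 - 4 * inner ℝ (x - z) n * inner ℝ z n := by
  rw [mirror, norm_sub_sq_real, norm_smul, inner_smul_right, hn, mul_one, Real.norm_eq_abs, sq_abs,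
    inner_sub_left]
  ring

lemma mirror_eq_self {z n x : Plane} (h : inner ℝ (x - z) n = 0) : mirror z n x = x := by
  simp [mirror, h]

/-- The disc of radius `R` about the origin with the closed disc of radius `ρ` about `z` removed. -/
def annulus (z : Plane) (ρ R : ℝ) : Set Plane := ball 0 R \ closedBall z ρ

lemma mem_annulus {z : Plane} {ρ R : ℝ} {x : Plane} :
    x ∈ annulus z ρ R ↔ ‖x‖ < R ∧ ρ < ‖x - z‖ := by
  simp [annulus, dist_eq_norm]

lemma isOpen_annulus {z : Plane} {ρ R : ℝ} : IsOpen (annulus z ρ R) :=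
  isOpen_ball.sdiff isClosed_closedBall

lemma isBounded_annulus {z : Plane} {ρ R : ℝ} : Bornology.IsBounded (annulus z ρ R) :=
  isBounded_ball.subset sdiff_subset

/-- `u` has constant mean curvature `H < 0` in an annulus and vanishes on its boundary. -/
structure IsAnnulusSolution (z : Plane) (ρ R H : ℝ) (u : Plane → ℝ) : Prop where
  radius_pos : 0 < ρ
  norm_add_lt : ‖z‖ + ρ < R
  neg : H < 0
  contDiffOn : ContDiffOn ℝ 2 u (annulus z ρ R)
  continuousOn : ContinuousOn u (closure (annulus z ρ R))
  meanCurv_eq : ∀ x ∈ annulus z ρ R, meanCurv u x = H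
  frontier_eq : ∀ x ∈ frontier (annulus z ρ R), u x = 0

lemma meanCurv_const (c : ℝ) (x : Plane) : meanCurv (fun _ => c) x = 0 := by
  rw [_root_.meanCurv_eq]
  simp [jetOp]

lemma IsAnnulusSolution.contDiffAt {z : Plane} {ρ R H : ℝ} {u : Plane → ℝ}
    (hu : IsAnnulusSolution z ρ R H u) {x : Plane} (hx : x ∈ annulus z ρ R) : ContDiffAt ℝ 2 u x :=
  hu.contDiffOn.contDiffAt (isOpen_annulus.mem_nhds hx)

namespace IsAnnulusSolution

lemma not_isLocalMin {z : Plane} {ρ R H : ℝ} {u : Plane → ℝ} (hu : IsAnnulusSolution z ρ R H u)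
    {x : Plane} (hx : x ∈ annulus z ρ R) : ¬ IsLocalMin u x := by
  intro h
  have h1 := meanCurv_le_of_isLocalMin_sub (g := fun _ => 0) (hu.contDiffAt hx) contDiffAt_const
    (by simpa using h)
  rw [meanCurv_const, hu.meanCurv_eq x hx] at h1
  exact h1.not_gt hu.neg

lemma mem_frontier {z : Plane} {ρ R : ℝ} {x : Plane} (hx : x ∈ closure (annulus z ρ R))
    (hx' : x ∉ annulus z ρ R) : x ∈ frontier (annulus z ρ R) := by
  rw [isOpen_annulus.frontier_eq]
  exact ⟨hx, hx'⟩

lemma nonneg {z : Plane} {ρ R H : ℝ} {u : Plane → ℝ} (hu : IsAnnulusSolution z ρ R H u)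
    {x : Plane} (hx : x ∈ closure (annulus z ρ R)) : 0 ≤ u x := by
  obtain ⟨y, hy, hmin⟩ := isBounded_annulus.isCompact_closure.exists_isMinOn ⟨x, hx⟩
    hu.continuousOn
  by_cases hyΩ : y ∈ annulus z ρ R
  · exact absurd ((hmin.on_subset subset_closure).isLocalMin (isOpen_annulus.mem_nhds hyΩ))
      (hu.not_isLocalMin hyΩ)
  · rw [← hu.frontier_eq y (mem_frontier hy hyΩ)]
    exact hmin hx

lemma pos {z : Plane} {ρ R H : ℝ} {u : Plane → ℝ} (hu : IsAnnulusSolution z ρ R H u)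
    {x : Plane} (hx : x ∈ annulus z ρ R) : 0 < u x := by
  refine lt_of_le_of_ne (hu.nonneg (subset_closure hx)) fun h => hu.not_isLocalMin hx ?_
  filter_upwards [isOpen_annulus.mem_nhds hx] with y hy
  rw [← h]
  exact hu.nonneg (subset_closure hy)

end IsAnnulusSolution

lemma mirror_mem_annulus {z n x : Plane} {ρ R : ℝ} (hn : ‖n‖ = 1) (hzn : 0 ≤ inner ℝ z n)
    (hx : x ∈ annulus z ρ R) (hxn : 0 ≤ inner ℝ (x - z) n) : mirror z n x ∈ annulus z ρ R := by
  rw [mem_annulus] at hx ⊢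
  rw [norm_mirror_sub hn]
  refine ⟨lt_of_le_of_lt ?_ hx.1, hx.2⟩
  rw [← sq_le_sq₀ (norm_nonneg _) (norm_nonneg _), norm_mirror_sq hn]
  have := mul_nonneg hxn hzn
  linarith

/-- The part of the annulus in the open half plane through `z` with inner normal `n`. -/
def cap (z n : Plane) (ρ R : ℝ) : Set Plane := {x ∈ annulus z ρ R | 0 < inner ℝ (x - z) n}

lemma isOpen_cap {z n : Plane} {ρ R : ℝ} : IsOpen (cap z n ρ R) :=
  isOpen_annulus.inter (isOpen_lt (g := fun x => inner ℝ (x - z) n) continuous_const (by fun_prop))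

lemma cap_subset {z n : Plane} {ρ R : ℝ} : cap z n ρ R ⊆ annulus z ρ R := fun _ h => h.1

lemma inner_nonneg_of_mem_closure_cap {z n x : Plane} {ρ R : ℝ} (hx : x ∈ closure (cap z n ρ R)) :
    0 ≤ inner ℝ (x - z) n :=
  closure_minimal (t := {x | 0 ≤ inner ℝ (x - z) n}) (fun _ h => h.2.le)
    (isClosed_le continuous_const (by fun_prop)) hx

lemma mapsTo_mirror_cap {z n : Plane} {ρ R : ℝ} (hn : ‖n‖ = 1) (hzn : 0 ≤ inner ℝ z n) :
    MapsTo (mirror z n) (cap z n ρ R) (annulus z ρ R) :=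
  fun _ h => mirror_mem_annulus hn hzn h.1 h.2.le

lemma mapsTo_mirror_closure_cap {z n : Plane} {ρ R : ℝ} (hn : ‖n‖ = 1) (hzn : 0 ≤ inner ℝ z n) :
    MapsTo (mirror z n) (closure (cap z n ρ R)) (closure (annulus z ρ R)) :=
  (mapsTo_mirror_cap hn hzn).closure (continuous_mirror z n)

namespace IsAnnulusSolution

lemma contDiffOn_comp_mirror {z : Plane} {ρ R H : ℝ} {u : Plane → ℝ}
    (hu : IsAnnulusSolution z ρ R H u) {n : Plane} {W : Set Plane}
    (hW : MapsTo (mirror z n) W (annulus z ρ R)) :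
    ContDiffOn ℝ 2 (fun x => u (mirror z n x)) W :=
  hu.contDiffOn.comp (contDiff_mirror z n).contDiffOn hW

lemma meanCurv_comp_mirror_eq {z : Plane} {ρ R H : ℝ} {u : Plane → ℝ}
    (hu : IsAnnulusSolution z ρ R H u) {n x : Plane} (hn : ‖n‖ = 1) (hx : x ∈ annulus z ρ R)
    (hx' : mirror z n x ∈ annulus z ρ R) :
    meanCurv (fun x => u (mirror z n x)) x = meanCurv u x := by
  rw [meanCurv_comp_mirror hn (hu.contDiffAt hx'), hu.meanCurv_eq x hx, hu.meanCurv_eq _ hx']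

lemma le_mirror {z : Plane} {ρ R H : ℝ} {u : Plane → ℝ} (hu : IsAnnulusSolution z ρ R H u)
    {n x : Plane} (hn : ‖n‖ = 1) (hzn : 0 ≤ inner ℝ z n) (hx : x ∈ annulus z ρ R)
    (hxn : 0 ≤ inner ℝ (x - z) n) : u x ≤ u (mirror z n x) := by
  rcases hxn.eq_or_lt with h | h
  · rw [mirror_eq_self h.symm]
  have hcl : closure (cap z n ρ R) ⊆ closure (annulus z ρ R) := closure_mono cap_subset
  refine le_of_meanCurv_eq_of_frontier isOpen_cap (isBounded_annulus.subset cap_subset)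
    (hu.contDiffOn_comp_mirror (mapsTo_mirror_cap hn hzn)) (hu.contDiffOn.mono cap_subset)
    (hu.continuousOn.comp (continuous_mirror z n).continuousOn (mapsTo_mirror_closure_cap hn hzn))
    (hu.continuousOn.mono hcl)
    (fun y hy => hu.meanCurv_comp_mirror_eq hn hy.1 (mapsTo_mirror_cap hn hzn hy))
    (fun y hy => ?_) x ⟨hx, h⟩
  rw [isOpen_cap.frontier_eq] at hy
  by_cases hyΩ : y ∈ annulus z ρ R
  · have : inner ℝ (y - z) n = 0 := (inner_nonneg_of_mem_closure_cap hy.1).antisymm'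
      (not_lt.1 fun h => hy.2 ⟨hyΩ, h⟩)
    simp [mirror_eq_self this]
  · rw [hu.frontier_eq y (mem_frontier (hcl hy.1) hyΩ)]
    exact hu.nonneg (mapsTo_mirror_closure_cap hn hzn hy.1)

end IsAnnulusSolution

/-- A ray issuing from `z` leaves the cap through the outer circle. -/
lemma exists_ray_exit {z n q : Plane} {ρ R : ℝ} (hρ : 0 < ρ) (hq : q ∈ cap z n ρ R) :
    ∃ T : ℝ, 1 < T ∧ ‖z + T • (q - z)‖ = R ∧
      ∀ t ∈ Ico 1 T, z + t • (q - z) ∈ cap z n ρ R := by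
  obtain ⟨hqΩ, hqn⟩ := hq
  rw [mem_annulus] at hqΩ
  have hqz : 0 < ‖q - z‖ := hρ.trans hqΩ.2
  have hcont : Continuous fun t : ℝ => ‖z + t • (q - z)‖ := by fun_prop
  have hT0 : 1 ≤ (R + ‖z‖) / ‖q - z‖ := by
    rw [one_le_div hqz]
    linarith [norm_sub_le q z]
  obtain ⟨T, hT, hTR⟩ : R ∈ (fun t : ℝ => ‖z + t • (q - z)‖) '' Icc 1 ((R + ‖z‖) / ‖q - z‖) := by
    refine intermediate_value_Icc hT0 hcont.continuousOn ⟨by simpa using hqΩ.1.le, ?_⟩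
    have h1 := norm_sub_norm_le (((R + ‖z‖) / ‖q - z‖) • (q - z)) (-z)
    rw [norm_smul, Real.norm_of_nonneg (by linarith), div_mul_cancel₀ _ hqz.ne', norm_neg,
      sub_neg_eq_add, add_comm _ z] at h1
    simpa using h1
  have hT1 : 1 < T := by
    refine lt_of_le_of_ne hT.1 ?_
    rintro rfl
    simp only [one_smul, add_sub_cancel] at hTR
    exact hqΩ.1.ne hTR
  refine ⟨T, hT1, hTR, fun t ht => ⟨mem_annulus.2 ⟨?_, ?_⟩, ?_⟩⟩
  · have hTt : 0 < T - 1 := by linarith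
    obtain ⟨α, β, hα, hβ, hαβ, hαβT⟩ : ∃ α β : ℝ, 0 < α ∧ 0 ≤ β ∧ α + β = 1 ∧ α + β * T = t :=
      ⟨(T - t) / (T - 1), (t - 1) / (T - 1), div_pos (by linarith [ht.2]) hTt,
        div_nonneg (by linarith [ht.1]) hTt.le, by field_simp; ring, by field_simp; ring⟩
    have h1 : z + t • (q - z) = α • q + β • (z + T • (q - z)) := by
      rw [← hαβT, eq_sub_of_add_eq hαβ]
      module
    rw [h1]
    refine (norm_add_le _ _).trans_lt ?_
    simp only at hTR
    rw [norm_smul, norm_smul, Real.norm_of_nonneg hα.le, Real.norm_of_nonneg hβ, hTR]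
    have h2 : α * R + β * R = R := by rw [← add_mul, hαβ, one_mul]
    linarith [mul_lt_mul_of_pos_left hqΩ.1 hα]
  · rw [add_sub_cancel_left, norm_smul, Real.norm_of_nonneg (by linarith [ht.1])]
    nlinarith [ht.1, hqΩ.2]
  · rw [add_sub_cancel_left, inner_smul_left]
    exact mul_pos (by simpa using by linarith [ht.1]) hqn

namespace IsAnnulusSolution

lemma lt_mirror {z : Plane} {ρ R H : ℝ} {u : Plane → ℝ} (hu : IsAnnulusSolution z ρ R H u)
    {n q : Plane} (hn : ‖n‖ = 1) (hzn : 0 < inner ℝ z n) (hq : q ∈ cap z n ρ R) :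
    u q < u (mirror z n q) := by
  refine lt_of_le_of_ne (hu.le_mirror hn hzn.le hq.1 hq.2.le) fun heq => ?_
  obtain ⟨T, hT, hTR, hray⟩ := exists_ray_exit hu.radius_pos hq
  set γ : ℝ → Plane := fun t => z + t • (q - z) with hγ
  have hγc : Continuous γ := by fun_prop
  have hcl : MapsTo γ (Icc 1 T) (closure (cap z n ρ R)) := by
    rw [← closure_Ico hT.ne]
    exact MapsTo.closure hray hγc
  have hclΩ : MapsTo γ (Icc 1 T) (closure (annulus z ρ R)) :=
    hcl.mono_right (closure_mono cap_subset)
  have hmcl : MapsTo (fun t => mirror z n (γ t)) (Icc 1 T) (closure (annulus z ρ R)) :=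
    (mapsTo_mirror_closure_cap hn hzn.le).comp hcl
  have hc : ContinuousOn (fun t => u (mirror z n (γ t)) - u (γ t)) (Icc 1 T) :=
    (hu.continuousOn.comp ((continuous_mirror z n).comp hγc).continuousOn hmcl).sub
      (hu.continuousOn.comp hγc.continuousOn hclΩ)
  have hsub : Icc 1 T ⊆ (fun t => u (mirror z n (γ t)) - u (γ t)) ⁻¹' {0} := by
    refine IsClosed.Icc_subset_of_forall_mem_nhdsWithin ?_ ?_ ?_
    · rw [inter_comm]
      exact hc.preimage_isClosed_of_isClosed isClosed_Icc isClosed_singleton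
    · simp [hγ, heq]
    · rintro t ⟨ht0, ht⟩
      have hev := eventuallyEq_of_meanCurv_eq_of_le isOpen_cap
        (hu.contDiffOn_comp_mirror (mapsTo_mirror_cap hn hzn.le)) (hu.contDiffOn.mono cap_subset)
        (fun y hy => hu.meanCurv_comp_mirror_eq hn hy.1 (mapsTo_mirror_cap hn hzn.le hy))
        (fun y hy => hu.le_mirror hn hzn.le hy.1 hy.2.le) (hray t ht) (sub_eq_zero.1 ht0)
      filter_upwards [nhdsWithin_le_nhds (hγc.continuousAt.eventually hev)] with s hs
      exact sub_eq_zero.2 hs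
  have hTmem : T ∈ Icc 1 T := right_mem_Icc.2 hT.le
  have h0 : u (γ T) = 0 := hu.frontier_eq _ (mem_frontier (hclΩ hTmem) fun h =>
    (mem_annulus.1 h).1.ne hTR)
  have hmem : mirror z n (γ T) ∈ annulus z ρ R := by
    have hqz := (mem_annulus.1 hq.1).2
    have hγz : γ T - z = T • (q - z) := by simp [hγ]
    rw [mem_annulus, norm_mirror_sub hn, hγz]
    constructor
    · rw [← sq_lt_sq₀ (norm_nonneg _) ((norm_nonneg _).trans_eq hTR), norm_mirror_sq hn, hTR, hγz,
        inner_smul_left]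
      have : 0 < T * inner ℝ (q - z) n * inner ℝ z n :=
        mul_pos (mul_pos (by linarith) hq.2) hzn
      simp only [conj_trivial]
      linarith
    · rw [norm_smul, Real.norm_of_nonneg (by linarith)]
      nlinarith [norm_nonneg (q - z)]
  have h1 : u (mirror z n (γ T)) - u (γ T) = 0 := hsub hTmem
  linarith [hu.pos hmem]

lemma fderiv_ne_zero_of_inner_eq_zero {z : Plane} {ρ R H : ℝ} {u : Plane → ℝ}
    (hu : IsAnnulusSolution z ρ R H u) {n p : Plane} (hn : ‖n‖ = 1) (hzn : 0 < inner ℝ z n)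
    (hp : p ∈ annulus z ρ R) (hpn : inner ℝ (p - z) n = 0) : fderiv ℝ u p ≠ 0 := by
  intro h0
  have hpm : mirror z n p = p := mirror_eq_self hpn
  set W := annulus z ρ R ∩ mirror z n ⁻¹' annulus z ρ R with hWdef
  have hW : IsOpen W := isOpen_annulus.inter (isOpen_annulus.preimage (continuous_mirror z n))
  obtain ⟨ε, hε, hεW⟩ := Metric.nhds_basis_closedBall.mem_iff.1
    (hW.mem_nhds (show p ∈ W from ⟨hp, by rw [mem_preimage, hpm]; exact hp⟩))
  set d := ε / 2 with hd
  have hd0 : 0 < d := half_pos hε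
  have hsub : closedBall (p + d • n) d ⊆ W := by
    refine (closedBall_subset_closedBall' ?_).trans hεW
    rw [dist_eq_norm, add_sub_cancel_left, norm_smul, hn, mul_one, Real.norm_of_nonneg hd0.le, hd]
    linarith
  have hin : ∀ x, inner ℝ (x - z) n = inner ℝ (x - (p + d • n)) n + d := by
    intro x
    have : x - z = (x - (p + d • n)) + (p - z) + d • n := by abel
    rw [this, inner_add_left, inner_add_left, hpn, inner_smul_left, real_inner_self_eq_norm_sq, hn]
    simp
  have hcs : ∀ x, -dist x (p + d • n) ≤ inner ℝ (x - (p + d • n)) n := fun x => by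
    have := neg_le_of_abs_le (abs_real_inner_le_norm (x - (p + d • n)) n)
    rwa [hn, mul_one, ← dist_eq_norm] at this
  refine fderiv_ne_of_meanCurv_eq_of_lt hW
    (hu.contDiffOn_comp_mirror (n := n) (W := W) fun x hx => hx.2)
    (hu.contDiffOn.mono inter_subset_left)
    (fun x hx => hu.meanCurv_comp_mirror_eq hn hx.1 hx.2) hd0 hsub
    (fun x hx => hu.lt_mirror hn hzn ⟨(hsub (ball_subset_closedBall hx)).1, ?_⟩)
    (fun x hx => hu.le_mirror hn hzn.le (hsub (sphere_subset_closedBall hx)).1 ?_)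
    (q := p) ?_ (by simp only [hpm]) ?_
  · rw [hin]
    linarith [hcs x, mem_ball.1 hx]
  · rw [hin]
    linarith [hcs x, mem_sphere.1 hx]
  · rw [mem_sphere, dist_eq_norm, sub_add_cancel_left, norm_neg, norm_smul, hn, mul_one,
      Real.norm_of_nonneg hd0.le]
  · rw [fderiv_comp_mirror (by rw [hpm]; exact (hu.contDiffAt hp).differentiableAt (by simp)), hpm,
      h0]
    simp

/-- Critical points lie on the axis of symmetry. -/
lemma exists_eq_add_smul_of_fderiv_eq_zero {z : Plane} {ρ R H : ℝ} {u : Plane → ℝ}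
    (hu : IsAnnulusSolution z ρ R H u) (hz : z ≠ 0) {p : Plane} (hp : p ∈ annulus z ρ R)
    (h0 : fderiv ℝ u p = 0) : ∃ c : ℝ, p = z + c • z := by
  by_cases h : inner ℝ z (rot (p - z)) = 0
  · have hz2 : z 0 ^ 2 + z 1 ^ 2 ≠ 0 := by
      rw [← plane_norm_sq]
      exact pow_ne_zero 2 (norm_ne_zero_iff.2 hz)
    refine ⟨inner ℝ (p - z) z / (z 0 ^ 2 + z 1 ^ 2), ?_⟩
    rw [plane_inner] at h
    simp only [rot] at h
    ext i
    fin_cases i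
    all_goals
      simp [plane_inner] at h ⊢
      field_simp
    · linear_combination z 1 * h
    · linear_combination (-z 0) * h
  · exfalso
    have hpz : inner ℝ (p - z) (rot (p - z)) = 0 := by
      rw [plane_inner]; simp [rot]; ring
    have hr : rot (p - z) ≠ 0 := fun h' => h (by rw [h', inner_zero_right])
    have hr0 : 0 < ‖rot (p - z)‖ := norm_pos_iff.2 hr
    obtain ⟨n, hn, hzn, hpn⟩ : ∃ n : Plane, ‖n‖ = 1 ∧ 0 < inner ℝ z n ∧ inner ℝ (p - z) n = 0 := by
      rcases lt_or_gt_of_ne h with h | h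
      · refine ⟨-(‖rot (p - z)‖⁻¹ • rot (p - z)), ?_, ?_, ?_⟩
        · rw [norm_neg, norm_smul, norm_inv, norm_norm, inv_mul_cancel₀ hr0.ne']
        · rw [inner_neg_right, inner_smul_right]
          have := mul_pos (inv_pos.2 hr0) (neg_pos.2 h)
          linarith
        · rw [inner_neg_right, inner_smul_right, hpz, mul_zero, neg_zero]
      · refine ⟨‖rot (p - z)‖⁻¹ • rot (p - z), ?_, ?_, ?_⟩
        · rw [norm_smul, norm_inv, norm_norm, inv_mul_cancel₀ hr0.ne']
        · rw [inner_smul_right]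
          exact mul_pos (inv_pos.2 hr0) h
        · rw [inner_smul_right, hpz, mul_zero]
    exact hu.fderiv_ne_zero_of_inner_eq_zero hn hzn hp hpn h0

/-- On circles about `z`, the solution decreases in the direction of `z`. -/
lemma mem_and_le_of_norm_sub_eq {z : Plane} {ρ R H : ℝ} {u : Plane → ℝ}
    (hu : IsAnnulusSolution z ρ R H u) {x y : Plane} (hx : x ∈ annulus z ρ R)
    (hxy : ‖y - z‖ = ‖x - z‖) (hz : inner ℝ z y ≤ inner ℝ z x) :
    y ∈ annulus z ρ R ∧ u x ≤ u y := by
  rcases eq_or_ne x y with rfl | hne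
  · exact ⟨hx, le_rfl⟩
  have hd : 0 < ‖x - y‖ := norm_pos_iff.2 (sub_ne_zero.2 hne)
  set n := ‖x - y‖⁻¹ • (x - y) with hndef
  have hn : ‖n‖ = 1 := by rw [hndef, norm_smul, norm_inv, norm_norm, inv_mul_cancel₀ hd.ne']
  have hzn : 0 ≤ inner ℝ z n := by
    rw [hndef, inner_smul_right, inner_sub_right]
    exact mul_nonneg (inv_nonneg.2 hd.le) (by linarith)
  have h1 : inner ℝ (x - z) (x - y) = ‖x - y‖ ^ 2 / 2 := by
    have h2 : x - y = (x - z) - (y - z) := by abel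
    rw [h2, inner_sub_right, norm_sub_sq_real, real_inner_self_eq_norm_sq, hxy]
    ring
  have hxn : inner ℝ (x - z) n = ‖x - y‖ / 2 := by
    rw [hndef, inner_smul_right, h1]
    field_simp
  have hm : mirror z n x = y := by
    rw [mirror, hxn, hndef, smul_smul, mul_div_cancel₀ _ two_ne_zero, mul_inv_cancel₀ hd.ne',
      one_smul, sub_sub_cancel]
  have hxn0 : 0 ≤ inner ℝ (x - z) n := by rw [hxn]; positivity
  rw [← hm]
  exact ⟨mirror_mem_annulus hn hzn hx hxn0, hu.le_mirror hn hzn hx hxn0⟩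

end IsAnnulusSolution

lemma exists_isLocalMax_of_lt {f : ℝ → ℝ} {a b m : ℝ} (hc : ContinuousOn f (Icc a b))
    (hm : m ∈ Ioo a b) (ha : f a < f m) (hb : f b < f m) : ∃ c ∈ Ioo a b, IsLocalMax f c := by
  obtain ⟨c, hcI, hmax⟩ := isCompact_Icc.exists_isMaxOn ⟨m, Ioo_subset_Icc_self hm⟩ hc
  have hmc : f m ≤ f c := hmax (Ioo_subset_Icc_self hm)
  have hac : a ≠ c := by rintro rfl; linarith
  have hcb : c ≠ b := by rintro rfl; linarith
  have hcI' : c ∈ Ioo a b := ⟨lt_of_le_of_ne hcI.1 hac, lt_of_le_of_ne hcI.2 hcb⟩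
  exact ⟨c, hcI', hmax.isLocalMax (Icc_mem_nhds hcI'.1 hcI'.2)⟩

lemma exists_mem_Ioo_lt_of_deriv_pos {f : ℝ → ℝ} {f' a b : ℝ} (hab : a < b)
    (hf : HasDerivAt f f' a) (hf' : 0 < f') : ∃ m ∈ Ioo a b, f a < f m := by
  have h := ((hasDerivAt_iff_tendsto_slope.1 hf).eventually (lt_mem_nhds hf')).filter_mono
    (nhdsGT_le_nhdsNE a)
  obtain ⟨m, hm, hmI⟩ := (h.and (Ioo_mem_nhdsGT hab)).exists
  refine ⟨m, hmI, ?_⟩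
  rw [slope_def_field, div_pos_iff_of_pos_right (sub_pos.2 hmI.1)] at hm
  exact sub_pos.1 hm

lemma exists_mem_Ioo_lt_of_deriv_neg {f : ℝ → ℝ} {f' a b : ℝ} (hab : a < b)
    (hf : HasDerivAt f f' b) (hf' : f' < 0) : ∃ m ∈ Ioo a b, f b < f m := by
  have h : HasDerivAt (fun x => f (-x)) (-f') (-b) := by
    rw [← neg_neg b] at hf
    simpa [Function.comp_def] using hf.comp (-b) (hasDerivAt_neg (-b))
  obtain ⟨m, hm, hlt⟩ := exists_mem_Ioo_lt_of_deriv_pos (neg_lt_neg hab) h (neg_pos.2 hf')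
  exact ⟨-m, ⟨by linarith [hm.2], by linarith [hm.1]⟩, by simpa using hlt⟩

lemma lt_meanCurv_comp_norm_sub_sq {Φ : ℝ → ℝ} (hΦ : ContDiff ℝ 2 Φ) {y x : Plane} {H : ℝ}
    (hH : H < 0) (h : H < 4 * deriv (deriv Φ) (‖x - y‖ ^ 2) * ‖x - y‖ ^ 2 +
      4 * deriv Φ (‖x - y‖ ^ 2) + 8 * deriv Φ (‖x - y‖ ^ 2) ^ 3 * ‖x - y‖ ^ 2) :
    H < meanCurv (fun x => Φ (‖x - y‖ ^ 2)) x := by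
  rw [meanCurv_comp_norm_sub_sq hΦ]
  have h1 : 1 ≤ √(1 + 4 * deriv Φ (‖x - y‖ ^ 2) ^ 2 * ‖x - y‖ ^ 2) ^ 3 :=
    one_le_pow₀ (Real.one_le_sqrt.2 (le_add_of_nonneg_right (by positivity)))
  rw [lt_div_iff₀ (by linarith)]
  nlinarith

/-- The quadratic profile `s ↦ η (s - p) (q - s)`. -/
def hump (η p q s : ℝ) : ℝ := η * ((s - p) * (q - s))

lemma contDiff_hump (η p q : ℝ) : ContDiff ℝ 2 (hump η p q) := by
  unfold hump; fun_prop

lemma hasDerivAt_hump (η p q s : ℝ) : HasDerivAt (hump η p q) (η * (p + q - 2 * s)) s := by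
  refine ((((hasDerivAt_id s).sub_const p).mul ((hasDerivAt_id s).const_sub q)).const_mul
    η).congr_deriv ?_
  simp only [id]
  ring

lemma deriv_hump (η p q : ℝ) : deriv (hump η p q) = fun s => η * (p + q - 2 * s) :=
  funext fun s => (hasDerivAt_hump η p q s).deriv

lemma deriv_deriv_hump (η p q s : ℝ) : deriv (deriv (hump η p q)) s = -2 * η := by
  rw [deriv_hump]
  refine ((((hasDerivAt_id s).const_mul 2).const_sub (p + q)).const_mul η).deriv.trans ?_
  simp
  ring

lemma exists_lt_meanCurv_hump {H : ℝ} (hH : H < 0) (p q Q : ℝ) :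
    ∃ η > 0, ∀ y x : Plane, ‖x - y‖ ^ 2 ≤ Q →
      H < meanCurv (fun x => hump η p q (‖x - y‖ ^ 2)) x := by
  rcases lt_or_ge Q 0 with hQ | hQ
  · exact ⟨1, one_pos, fun y x h => absurd h (hQ.trans_le (sq_nonneg _)).not_ge⟩
  set L := |p + q| + 2 * Q with hL
  have hL0 : 0 ≤ L := by positivity
  set K := 8 * Q + 4 * L + 8 * L ^ 3 * Q + 1 with hK
  have hK0 : 0 < K := by positivity
  refine ⟨min 1 (-H / K), lt_min one_pos (div_pos (neg_pos.2 hH) hK0), fun y x hx => ?_⟩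
  set η := min 1 (-H / K) with hη
  have hη0 : 0 < η := lt_min one_pos (div_pos (neg_pos.2 hH) hK0)
  have hη1 : η ≤ 1 := min_le_left _ _
  have hηK : η * K ≤ -H := (le_div_iff₀ hK0).1 (min_le_right _ _)
  refine lt_meanCurv_comp_norm_sub_sq (contDiff_hump η p q) hH ?_
  rw [deriv_deriv_hump, deriv_hump]
  have hs0 : 0 ≤ ‖x - y‖ ^ 2 := sq_nonneg _
  set s := ‖x - y‖ ^ 2
  have hℓ : |p + q - 2 * s| ≤ L := by
    rw [abs_le]
    constructor <;> linarith [neg_abs_le (p + q), le_abs_self (p + q)]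
  have hℓ1 := neg_le_of_abs_le hℓ
  have hℓ3 : -(L ^ 3 * Q) ≤ (p + q - 2 * s) ^ 3 * s := by
    refine neg_le_of_abs_le ?_
    rw [abs_mul, abs_pow, abs_of_nonneg hs0]
    gcongr
  have hη3 : η ^ 3 ≤ η := by
    calc η ^ 3 ≤ η ^ 1 := pow_le_pow_of_le_one hη0.le hη1 (by norm_num)
      _ = η := pow_one η
  have h3 : -(η * (L ^ 3 * Q)) ≤ (η * (p + q - 2 * s)) ^ 3 * s :=
    calc -(η * (L ^ 3 * Q)) ≤ -(η ^ 3 * (L ^ 3 * Q)) := by gcongr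
      _ = η ^ 3 * -(L ^ 3 * Q) := by ring
      _ ≤ η ^ 3 * ((p + q - 2 * s) ^ 3 * s) := by gcongr
      _ = _ := by ring
  have h1 : η * -L ≤ η * (p + q - 2 * s) := by gcongr
  have h2 : η * s ≤ η * Q := by gcongr
  have h4 : η * K = 8 * (η * Q) + 4 * (η * L) + 8 * (η * (L ^ 3 * Q)) + η := by rw [hK]; ring
  nlinarith

/-- The concave profile `s ↦ m - A (s - s₀) - B (s - s₀)²`. -/
def bend (m A B s₀ s : ℝ) : ℝ := m - A * (s - s₀) - B * (s - s₀) ^ 2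

lemma contDiff_bend (m A B s₀ : ℝ) : ContDiff ℝ 2 (bend m A B s₀) := by
  unfold bend; fun_prop

lemma hasDerivAt_bend (m A B s₀ s : ℝ) :
    HasDerivAt (bend m A B s₀) (-A - 2 * B * (s - s₀)) s := by
  have h := (hasDerivAt_id s).sub_const s₀
  refine (((h.const_mul A).const_sub m).sub ((h.pow 2).const_mul B)).congr_deriv ?_
  simp
  ring

lemma deriv_bend (m A B s₀ : ℝ) : deriv (bend m A B s₀) = fun s => -A - 2 * B * (s - s₀) :=
  funext fun s => (hasDerivAt_bend m A B s₀ s).deriv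

lemma deriv_deriv_bend (m A B s₀ s : ℝ) : deriv (deriv (bend m A B s₀)) s = -2 * B := by
  rw [deriv_bend]
  refine ((((hasDerivAt_id s).sub_const s₀).const_mul (2 * B)).const_sub (-A)).deriv.trans ?_
  simp

lemma exists_meanCurv_bend_lt {H ρ Q : ℝ} (hH : H < 0) (hρ : 0 < ρ) :
    ∃ τ > 0, ∀ (m A s₀ : ℝ) (y x : Plane), ρ ≤ ‖x - y‖ → ‖x - y‖ ^ 2 ≤ Q →
      |A + 2 * (-H / ρ ^ 2) * (‖x - y‖ ^ 2 - s₀)| ≤ τ →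
      meanCurv (fun x => bend m A (-H / ρ ^ 2) s₀ (‖x - y‖ ^ 2)) x < H := by
  have h1 : ∀ᶠ τ : ℝ in nhds 0, 4 * τ + 8 * τ ^ 3 * Q < -H :=
    ContinuousAt.eventually_lt (by fun_prop) continuousAt_const (by simpa using hH)
  have h2 : ∀ᶠ τ : ℝ in nhds 0, √(1 + 4 * τ ^ 2 * Q) ^ 3 < 2 :=
    ContinuousAt.eventually_lt (by fun_prop) continuousAt_const (by simp)
  obtain ⟨τ, ⟨hτ1, hτ2⟩, hτ0⟩ := (((h1.and h2).filter_mono nhdsWithin_le_nhds).and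
    (self_mem_nhdsWithin (s := Ioi (0 : ℝ)))).exists
  refine ⟨τ, hτ0, fun m A s₀ y x hx hxQ hAτ => ?_⟩
  have hτ : 0 < τ := hτ0
  rw [meanCurv_comp_norm_sub_sq (contDiff_bend _ _ _ _), deriv_deriv_bend, deriv_bend]
  have hρs : ρ ^ 2 ≤ ‖x - y‖ ^ 2 := by gcongr
  have hs0 : 0 ≤ ‖x - y‖ ^ 2 := sq_nonneg _
  set s := ‖x - y‖ ^ 2
  simp only
  have hBs : -H ≤ -H / ρ ^ 2 * s := by
    rw [div_mul_eq_mul_div, le_div_iff₀ (by positivity)]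
    exact mul_le_mul_of_nonneg_left hρs (by linarith)
  set B := -H / ρ ^ 2
  obtain ⟨ℓ, hℓ⟩ : ∃ ℓ, -A - 2 * B * (s - s₀) = ℓ := ⟨_, rfl⟩
  have hℓτ : |ℓ| ≤ τ := by
    rw [← hℓ, ← abs_neg]
    convert hAτ using 2
    ring
  rw [hℓ]
  have hℓ1 : ℓ ≤ τ := le_of_abs_le hℓτ
  have hℓ3 : ℓ ^ 3 * s ≤ τ ^ 3 * Q := by
    refine le_of_abs_le ?_
    rw [abs_mul, abs_pow, abs_of_nonneg hs0]
    gcongr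
  have hsq : √(1 + 4 * ℓ ^ 2 * s) ^ 3 ≤ √(1 + 4 * τ ^ 2 * Q) ^ 3 := by
    have : ℓ ^ 2 ≤ τ ^ 2 := sq_le_sq.2 (by rwa [abs_of_pos hτ])
    gcongr
  have hpos : 0 < √(1 + 4 * ℓ ^ 2 * s) ^ 3 := pow_pos (Real.sqrt_pos.2 (by positivity)) 3
  rw [div_lt_iff₀ hpos]
  nlinarith

lemma norm_le_and_le_norm_sub_of_mem_closure {z x : Plane} {ρ R : ℝ}
    (hx : x ∈ closure (annulus z ρ R)) : ‖x‖ ≤ R ∧ ρ ≤ ‖x - z‖ :=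
  closure_minimal (t := {x | ‖x‖ ≤ R ∧ ρ ≤ ‖x - z‖})
    (fun _ h => ⟨(mem_annulus.1 h).1.le, (mem_annulus.1 h).2.le⟩)
    ((isClosed_le continuous_norm continuous_const).inter
      (isClosed_le (g := fun x => ‖x - z‖) continuous_const (by fun_prop))) hx

lemma norm_eq_or_norm_sub_eq_of_mem_frontier {z x : Plane} {ρ R : ℝ}
    (hx : x ∈ frontier (annulus z ρ R)) : ‖x‖ = R ∨ ‖x - z‖ = ρ := by
  rw [isOpen_annulus.frontier_eq] at hx
  obtain ⟨h1, h2⟩ := norm_le_and_le_norm_sub_of_mem_closure hx.1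
  by_contra! h
  exact hx.2 (mem_annulus.2 ⟨lt_of_le_of_ne h1 h.1, lt_of_le_of_ne h2 h.2.symm⟩)

namespace IsAnnulusSolution

lemma le_of_lt_meanCurv {z : Plane} {ρ R H : ℝ} {u V : Plane → ℝ}
    (hu : IsAnnulusSolution z ρ R H u) (hV : ContDiff ℝ 2 V)
    (hVH : ∀ x ∈ annulus z ρ R, H < meanCurv V x)
    (hVf : ∀ x ∈ frontier (annulus z ρ R), V x ≤ 0) {x : Plane} (hx : x ∈ annulus z ρ R) :
    V x ≤ u x := by
  obtain ⟨y, hy, hmin⟩ := isBounded_annulus.isCompact_closure.exists_isMinOn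
    ⟨x, subset_closure hx⟩ (hu.continuousOn.sub hV.continuous.continuousOn)
  have hyx : u y - V y ≤ u x - V x := hmin (subset_closure hx)
  by_cases hyΩ : y ∈ annulus z ρ R
  · have h := meanCurv_le_of_isLocalMin_sub (hu.contDiffAt hyΩ) hV.contDiffAt
      ((hmin.on_subset subset_closure).isLocalMin (isOpen_annulus.mem_nhds hyΩ))
    rw [hu.meanCurv_eq y hyΩ] at h
    exact absurd (hVH y hyΩ) h.not_gt
  · have hyf := mem_frontier hy hyΩ
    linarith [hVf y hyf, hu.frontier_eq y hyf]

/-- A lower barrier vanishing on the inner circle. -/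
lemma exists_hump_le_inner {z : Plane} {ρ R H : ℝ} {u : Plane → ℝ}
    (hu : IsAnnulusSolution z ρ R H u) :
    ∃ η > 0, ∀ x ∈ annulus z ρ R, hump η (ρ ^ 2) ((R - ‖z‖) ^ 2) (‖x - z‖ ^ 2) ≤ u x := by
  obtain ⟨η, hη, h⟩ := exists_lt_meanCurv_hump hu.neg (ρ ^ 2) ((R - ‖z‖) ^ 2) ((R + ‖z‖) ^ 2)
  have hR := hu.norm_add_lt
  have hρ := hu.radius_pos
  refine ⟨η, hη, fun x hx => hu.le_of_lt_meanCurv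
    (V := fun x => hump η (ρ ^ 2) ((R - ‖z‖) ^ 2) (‖x - z‖ ^ 2))
    (contDiff_comp_norm_sub_sq (contDiff_hump _ _ _) z) (fun y hy => h z y ?_) (fun y hy => ?_) hx⟩
  · have := (norm_sub_le y z).trans (add_le_add_left (mem_annulus.1 hy).1.le _)
    gcongr
  · have h1 := (norm_le_and_le_norm_sub_of_mem_closure (frontier_subset_closure hy)).2
    refine mul_nonpos_of_nonneg_of_nonpos hη.le ?_
    rcases norm_eq_or_norm_sub_eq_of_mem_frontier hy with h2 | h2
    · refine mul_nonpos_of_nonneg_of_nonpos (sub_nonneg.2 (by gcongr)) (sub_nonpos.2 ?_)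
      have := norm_sub_norm_le y z
      rw [h2] at this
      exact pow_le_pow_left₀ (by linarith) this 2
    · rw [h2, sub_self, zero_mul]

/-- A lower barrier vanishing on the outer circle. -/
lemma exists_hump_le_outer {z : Plane} {ρ R H : ℝ} {u : Plane → ℝ}
    (hu : IsAnnulusSolution z ρ R H u) :
    ∃ η > 0, ∀ x ∈ annulus z ρ R, hump η ((‖z‖ + ρ) ^ 2) (R ^ 2) (‖x‖ ^ 2) ≤ u x := by
  obtain ⟨η, hη, h⟩ := exists_lt_meanCurv_hump hu.neg ((‖z‖ + ρ) ^ 2) (R ^ 2) (R ^ 2)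
  have hρ := hu.radius_pos
  refine ⟨η, hη, fun x hx => ?_⟩
  suffices h : hump η ((‖z‖ + ρ) ^ 2) (R ^ 2) (‖x - 0‖ ^ 2) ≤ u x by rwa [sub_zero] at h
  refine hu.le_of_lt_meanCurv (V := fun x => hump η ((‖z‖ + ρ) ^ 2) (R ^ 2) (‖x - 0‖ ^ 2))
    (contDiff_comp_norm_sub_sq (contDiff_hump _ _ _) 0) (fun y hy => h 0 y ?_) (fun y hy => ?_)
    hx
  · rw [sub_zero]
    gcongr
    exact (mem_annulus.1 hy).1.le
  · obtain ⟨h1, -⟩ := norm_le_and_le_norm_sub_of_mem_closure (frontier_subset_closure hy)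
    rw [sub_zero]
    refine mul_nonpos_of_nonneg_of_nonpos hη.le ?_
    rcases norm_eq_or_norm_sub_eq_of_mem_frontier hy with h2 | h2
    · rw [h2, sub_self, mul_zero]
    · refine mul_nonpos_of_nonpos_of_nonneg (sub_nonpos.2 ?_) (sub_nonneg.2 (by gcongr))
      have := norm_sub_norm_le y z
      rw [h2] at this
      gcongr
      linarith

/-- The parameters of the points of the annulus on the short side of the axis. -/
lemma add_smul_mem {e : Plane} (he : ‖e‖ = 1) {a ρ R t : ℝ} (ha : 0 < a) (hρ : 0 < ρ)
    (ht : t ∈ Ioo ρ (R - a)) : a • e + t • e ∈ annulus (a • e) ρ R := by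
  rw [mem_annulus, add_sub_cancel_left, ← add_smul, norm_smul, norm_smul, he, mul_one, mul_one,
    Real.norm_of_nonneg (by linarith [ht.1]), Real.norm_of_nonneg (by linarith [ht.1])]
  exact ⟨by linarith [ht.2], ht.1⟩

lemma sub_smul_mem {e : Plane} (he : ‖e‖ = 1) {a ρ R t : ℝ} (hρ : 0 < ρ) (haR : a + ρ < R)
    (ht : t ∈ Ioo ρ (R + a)) : a • e - t • e ∈ annulus (a • e) ρ R := by
  rw [mem_annulus, sub_sub_cancel_left, ← sub_smul, norm_neg, norm_smul, norm_smul, he, mul_one,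
    mul_one, Real.norm_of_nonneg (by linarith [ht.1] : 0 ≤ t), Real.norm_eq_abs, abs_lt]
  exact ⟨⟨by linarith [ht.2], by linarith [ht.1]⟩, ht.1⟩

lemma tendsto_norm_sub (z x : Plane) :
    Filter.Tendsto (fun y => ‖y - z‖) (nhds x) (nhds ‖x - z‖) := by
  have : Continuous fun y => ‖y - z‖ := by fun_prop
  exact this.tendsto x

lemma inner_smul_smul_of_norm_eq_one {e : Plane} (he : ‖e‖ = 1) (a r : ℝ) :
    inner ℝ (a • e) (r • e) = a * r := by
  rw [inner_smul_left, inner_smul_right, real_inner_self_eq_norm_sq, he]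
  simp

/-- Comparison with a radial function at a contact point on the short side of the axis. -/
lemma meanCurv_le_of_isLocalMin_axis {e : Plane} (he : ‖e‖ = 1) {a ρ R H : ℝ} (ha : 0 < a)
    {u : Plane → ℝ} (hu : IsAnnulusSolution (a • e) ρ R H u) {Φ : ℝ → ℝ} (hΦ : ContDiff ℝ 2 Φ)
    {t : ℝ} (ht : t ∈ Ioo ρ (R - a))
    (h : IsLocalMin (fun t => u (a • e + t • e) - Φ (t ^ 2)) t) :
    meanCurv (fun x => Φ (‖x - a • e‖ ^ 2)) (a • e + t • e) ≤ H := by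
  have ht0 : 0 < t := hu.radius_pos.trans ht.1
  have hmem : ∀ s ∈ Ioo ρ (R - a), a • e + s • e ∈ annulus (a • e) ρ R :=
    fun s hs => add_smul_mem he ha hu.radius_pos hs
  have hnorm : ∀ s : ℝ, 0 < s → ‖a • e + s • e - a • e‖ = s := fun s hs => by
    rw [add_sub_cancel_left, norm_smul, he, mul_one, Real.norm_of_nonneg hs.le]
  rw [← hu.meanCurv_eq _ (hmem t ht)]
  refine meanCurv_le_of_isLocalMin_sub (hu.contDiffAt (hmem t ht))
    (contDiff_comp_norm_sub_sq hΦ _).contDiffAt ?_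
  have htd := tendsto_norm_sub (a • e) (a • e + t • e)
  rw [hnorm t ht0] at htd
  filter_upwards [htd.eventually h, htd.eventually (Ioo_mem_nhds ht.1 ht.2),
    isOpen_annulus.mem_nhds (hmem t ht)] with x hx1 hx2 hx3
  have hr : 0 < ‖x - a • e‖ := hu.radius_pos.trans hx2.1
  have hle := (hu.mem_and_le_of_norm_sub_eq (hmem _ hx2) (y := x) (hnorm _ hr).symm ?_).2
  · rw [hnorm t ht0]
    linarith
  · have h1 := (le_abs_self _).trans (abs_real_inner_le_norm (a • e) (x - a • e))
    rw [norm_smul, he, mul_one, Real.norm_of_nonneg ha.le] at h1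
    rw [inner_sub_right] at h1
    rw [inner_add_right, inner_smul_smul_of_norm_eq_one he a ‖x - a • e‖]
    linarith

/-- Comparison with a radial function at a contact point on the long side of the axis. -/
lemma le_meanCurv_of_isLocalMax_axis {e : Plane} (he : ‖e‖ = 1) {a ρ R H : ℝ} (ha : 0 < a)
    {u : Plane → ℝ} (hu : IsAnnulusSolution (a • e) ρ R H u) {Φ : ℝ → ℝ} (hΦ : ContDiff ℝ 2 Φ)
    {t : ℝ} (ht : t ∈ Ioo ρ (R + a))
    (h : IsLocalMax (fun t => u (a • e - t • e) - Φ (t ^ 2)) t) :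
    H ≤ meanCurv (fun x => Φ (‖x - a • e‖ ^ 2)) (a • e - t • e) := by
  have ht0 : 0 < t := hu.radius_pos.trans ht.1
  have hmem : a • e - t • e ∈ annulus (a • e) ρ R := by
    refine sub_smul_mem he hu.radius_pos ?_ ht
    simpa [norm_smul, he, abs_of_pos ha] using hu.norm_add_lt
  have hnorm : ∀ s : ℝ, 0 < s → ‖a • e - s • e - a • e‖ = s := fun s hs => by
    rw [sub_sub_cancel_left, norm_neg, norm_smul, he, mul_one, Real.norm_of_nonneg hs.le]
  rw [← hu.meanCurv_eq _ hmem]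
  refine meanCurv_le_of_isLocalMin_sub (contDiff_comp_norm_sub_sq hΦ _).contDiffAt
    (hu.contDiffAt hmem) ?_
  have htd := tendsto_norm_sub (a • e) (a • e - t • e)
  rw [hnorm t ht0] at htd
  filter_upwards [htd.eventually h, isOpen_annulus.mem_nhds hmem] with x hx1 hx3
  have hr : 0 < ‖x - a • e‖ := hu.radius_pos.trans (mem_annulus.1 hx3).2
  have hle := (hu.mem_and_le_of_norm_sub_eq hx3 (hnorm _ hr) ?_).2
  · rw [hnorm t ht0]
    linarith
  · have h1 := (neg_le_abs _).trans (abs_real_inner_le_norm (a • e) (x - a • e))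
    rw [norm_smul, he, mul_one, Real.norm_of_nonneg ha.le] at h1
    rw [inner_sub_right] at h1
    rw [inner_sub_right, inner_smul_smul_of_norm_eq_one he a ‖x - a • e‖]
    linarith

end IsAnnulusSolution

namespace IsAnnulusSolution

lemma norm_smul_add_lt {e : Plane} (he : ‖e‖ = 1) {a ρ R H : ℝ} (ha : 0 < a) {u : Plane → ℝ}
    (hu : IsAnnulusSolution (a • e) ρ R H u) : a + ρ < R := by
  simpa [norm_smul, he, abs_of_pos ha] using hu.norm_add_lt

lemma hasDerivAt_comp_smul {e : Plane} {a σ t : ℝ} {u : Plane → ℝ}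
    (hd : DifferentiableAt ℝ u (a • e + (σ * t) • e)) :
    HasDerivAt (fun t : ℝ => u (a • e + (σ * t) • e))
      (fderiv ℝ u (a • e + (σ * t) • e) (σ • e)) t := by
  have h : HasDerivAt (fun t : ℝ => a • e + (σ * t) • e) (σ • e) t := by
    simpa using (((hasDerivAt_id t).const_mul σ).smul_const e).const_add (a • e)
  exact hd.hasFDerivAt.comp_hasDerivAt t h

lemma hasDerivAt_short_axis {e : Plane} (he : ‖e‖ = 1) {a ρ R H : ℝ} (ha : 0 < a)
    {u : Plane → ℝ} (hu : IsAnnulusSolution (a • e) ρ R H u) {t : ℝ} (ht : t ∈ Ioo ρ (R - a)) :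
    HasDerivAt (fun t : ℝ => u (a • e + t • e)) (fderiv ℝ u (a • e + t • e) e) t := by
  have h := hasDerivAt_comp_smul (σ := 1) (t := t) (e := e) (a := a) (u := u)
  simp only [one_mul, one_smul] at h
  exact h ((hu.contDiffAt (add_smul_mem he ha hu.radius_pos ht)).differentiableAt (by simp))

lemma hasDerivAt_long_axis {e : Plane} (he : ‖e‖ = 1) {a ρ R H : ℝ} (ha : 0 < a)
    {u : Plane → ℝ} (hu : IsAnnulusSolution (a • e) ρ R H u) {t : ℝ} (ht : t ∈ Ioo ρ (R + a)) :
    HasDerivAt (fun t : ℝ => u (a • e - t • e)) (fderiv ℝ u (a • e - t • e) (-e)) t := by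
  have h := hasDerivAt_comp_smul (σ := -1) (t := t) (e := e) (a := a) (u := u)
  simp only [neg_mul, one_mul, neg_smul, one_smul, ← sub_eq_add_neg] at h
  exact h ((hu.contDiffAt (sub_smul_mem he hu.radius_pos (hu.norm_smul_add_lt he ha)
    ht)).differentiableAt (by simp))

/-- There is at most one critical point on the short side of the axis. -/
lemma subsingleton_short_axis {e : Plane} (he : ‖e‖ = 1) {a ρ R H : ℝ} (ha : 0 < a)
    {u : Plane → ℝ} (hu : IsAnnulusSolution (a • e) ρ R H u) :
    {t ∈ Ioo ρ (R - a) | fderiv ℝ u (a • e + t • e) = 0}.Subsingleton := by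
  suffices key : ∀ t₁ ∈ Ioo ρ (R - a), ∀ t₂ ∈ Ioo ρ (R - a), fderiv ℝ u (a • e + t₁ • e) = 0 →
      fderiv ℝ u (a • e + t₂ • e) = 0 → ¬ t₁ < t₂ by
    intro t₁ h₁ t₂ h₂
    exact le_antisymm (not_lt.1 (key t₂ h₂.1 t₁ h₁.1 h₂.2 h₁.2))
      (not_lt.1 (key t₁ h₁.1 t₂ h₂.1 h₁.2 h₂.2))
  intro t₁ ht₁ t₂ ht₂ h₁ h₂ hlt
  have ht0 : 0 < t₁ := hu.radius_pos.trans ht₁.1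
  have hsq : t₁ ^ 2 < t₂ ^ 2 := by gcongr
  obtain ⟨η, hη, hhump⟩ := exists_lt_meanCurv_hump hu.neg (t₁ ^ 2) (t₂ ^ 2) (t₂ ^ 2)
  set f : ℝ → ℝ := fun t => hump η (t₁ ^ 2) (t₂ ^ 2) (t ^ 2) - u (a • e + t • e) with hf
  have hsub : Icc t₁ t₂ ⊆ Ioo ρ (R - a) := Icc_subset_Ioo ht₁.1 ht₂.2
  have hder : ∀ t ∈ Ioo ρ (R - a), HasDerivAt f (η * (t₁ ^ 2 + t₂ ^ 2 - 2 * t ^ 2) * (2 * t) -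
      fderiv ℝ u (a • e + t • e) e) t := fun t ht => by
    have h := (hasDerivAt_hump η (t₁ ^ 2) (t₂ ^ 2) (t ^ 2)).comp t (hasDerivAt_pow 2 t)
    refine (h.sub (hu.hasDerivAt_short_axis he ha ht)).congr_deriv ?_
    simp
  have hcont : ContinuousOn f (Icc t₁ t₂) := fun t ht =>
    (hder t (hsub ht)).continuousAt.continuousWithinAt
  have hd₁ := hder t₁ ht₁
  have hd₂ := hder t₂ ht₂
  simp only [h₁, h₂, zero_apply, sub_zero] at hd₁ hd₂
  obtain ⟨m₁, hm₁, hfm₁⟩ := exists_mem_Ioo_lt_of_deriv_pos hlt hd₁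
    (mul_pos (mul_pos hη (by linarith)) (by linarith))
  obtain ⟨m₂, hm₂, hfm₂⟩ := exists_mem_Ioo_lt_of_deriv_neg hlt hd₂
    (mul_neg_of_neg_of_pos (mul_neg_of_pos_of_neg hη (by linarith)) (by linarith))
  obtain ⟨c, hc, hmax⟩ : ∃ c ∈ Ioo t₁ t₂, IsLocalMax f c := by
    rcases le_total (f m₁) (f m₂) with h | h
    · exact exists_isLocalMax_of_lt hcont hm₂ (hfm₁.trans_le h) hfm₂
    · exact exists_isLocalMax_of_lt hcont hm₁ hfm₁ (hfm₂.trans_le h)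
  have hcI := hsub (Ioo_subset_Icc_self hc)
  have hc0 : 0 < c := ht0.trans hc.1
  refine (hu.meanCurv_le_of_isLocalMin_axis he ha (contDiff_hump η (t₁ ^ 2) (t₂ ^ 2)) hcI
    ?_).not_gt (hhump _ _ ?_)
  · simpa [hf] using hmax.neg
  · rw [add_sub_cancel_left, norm_smul, he, mul_one, Real.norm_of_nonneg hc0.le]
    exact pow_le_pow_left₀ hc0.le hc.2.le 2

lemma mapsTo_long_axis {e : Plane} (he : ‖e‖ = 1) {a ρ R H : ℝ} (ha : 0 < a)
    {u : Plane → ℝ} (hu : IsAnnulusSolution (a • e) ρ R H u) :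
    MapsTo (fun t : ℝ => a • e - t • e) (Icc ρ (R + a)) (closure (annulus (a • e) ρ R)) := by
  have haR := hu.norm_smul_add_lt he ha
  rw [← closure_Ioo (by linarith)]
  exact MapsTo.closure (fun t ht => sub_smul_mem he hu.radius_pos haR ht) (by fun_prop)

/-- If the solution grows linearly off the endpoint `T` of the long side of the axis, then there
are no critical points on the axis near `T`. -/
lemma exists_not_hasDerivAt_zero {e : Plane} (he : ‖e‖ = 1) {a ρ R H : ℝ} (ha : 0 < a)
    {u : Plane → ℝ} (hu : IsAnnulusSolution (a • e) ρ R H u) {T : ℝ} (hT : T = ρ ∨ T = R + a)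
    {c δ₀ : ℝ} (hc : 0 < c) (hδ₀ : 0 < δ₀) (hlow : ∀ t ∈ Ioo ρ (R + a), |T ^ 2 - t ^ 2| < δ₀ →
      c * |T ^ 2 - t ^ 2| ≤ u (a • e - t • e)) :
    ∃ δ > 0, ∀ t ∈ Ioo ρ (R + a), |T ^ 2 - t ^ 2| < δ →
      ¬ HasDerivAt (fun t : ℝ => u (a • e - t • e)) 0 t := by
  have hρ := hu.radius_pos
  have haR := hu.norm_smul_add_lt he ha
  obtain ⟨τ, hτ, hbend⟩ := exists_meanCurv_bend_lt (Q := (R + a) ^ 2) hu.neg hρ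
  have hB : 0 < -H / ρ ^ 2 := div_pos (neg_pos.2 hu.neg) (by positivity)
  set B := -H / ρ ^ 2 with hBdef
  obtain ⟨A, hA, hAc, hAτ⟩ : ∃ A > 0, A ≤ c / 2 ∧ A ≤ τ / 2 :=
    ⟨min (c / 2) (τ / 2), by positivity, min_le_left _ _, min_le_right _ _⟩
  refine ⟨min δ₀ (min (c / (2 * B)) (τ / (4 * B))), by positivity, fun t₀ ht₀ hd hder => ?_⟩
  have hm := hlow t₀ ht₀ (hd.trans_le (min_le_left _ _))
  have hdc : |T ^ 2 - t₀ ^ 2| * (2 * B) < c :=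
    (lt_div_iff₀ (by positivity)).1 (hd.trans_le ((min_le_right _ _).trans (min_le_left _ _)))
  have hdτ : |T ^ 2 - t₀ ^ 2| * (4 * B) < τ :=
    (lt_div_iff₀ (by positivity)).1 (hd.trans_le ((min_le_right _ _).trans (min_le_right _ _)))
  have ht0 : 0 < t₀ := hρ.trans ht₀.1
  obtain ⟨σ, hσ, hσT⟩ : ∃ σ : ℝ, |σ| = 1 ∧ σ * (T ^ 2 - t₀ ^ 2) = |T ^ 2 - t₀ ^ 2| := by
    rcases le_total 0 (T ^ 2 - t₀ ^ 2) with h | h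
    · exact ⟨1, by simp, by rw [abs_of_nonneg h, one_mul]⟩
    · exact ⟨-1, by simp, by rw [abs_of_nonpos h, neg_one_mul]⟩
  set m := u (a • e - t₀ • e) with hmdef
  set Φ := bend m (σ * A) B (t₀ ^ 2) with hΦ
  set f : ℝ → ℝ := fun t => u (a • e - t • e) - Φ (t ^ 2) with hf
  have hcont : ContinuousOn f (Icc ρ (R + a)) :=
    (hu.continuousOn.comp (by fun_prop) (hu.mapsTo_long_axis he ha)).sub
      ((contDiff_bend _ _ _ _).continuous.comp (continuous_pow 2)).continuousOn
  have hf0 : f t₀ = 0 := by simp [hf, hΦ, bend, hmdef]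
  have hfd : HasDerivAt f (2 * t₀ * σ * A) t₀ := by
    have h := (hasDerivAt_bend m (σ * A) B (t₀ ^ 2) (t₀ ^ 2)).comp t₀ (hasDerivAt_pow 2 t₀)
    refine (hder.sub h).congr_deriv ?_
    simp
    ring
  have hfT : f T ≤ 0 := by
    have hTI : T ∈ Icc ρ (R + a) := by
      rcases hT with rfl | rfl
      · exact left_mem_Icc.2 (by linarith)
      · exact right_mem_Icc.2 (by linarith)
    have h0 : u (a • e - T • e) = 0 := by
      refine hu.frontier_eq _ (mem_frontier (hu.mapsTo_long_axis he ha hTI) fun h => ?_)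
      rw [mem_annulus, sub_sub_cancel_left, ← sub_smul, norm_neg, norm_smul, norm_smul, he, mul_one,
        mul_one, Real.norm_of_nonneg (hρ.le.trans hTI.1), Real.norm_eq_abs, abs_lt] at h
      rcases hT with rfl | rfl
      · exact h.2.false
      · linarith [h.1.1]
    have h1 : Φ (T ^ 2) = m - A * |T ^ 2 - t₀ ^ 2| - B * |T ^ 2 - t₀ ^ 2| ^ 2 := by
      rw [hΦ, bend, sq_abs, ← hσT]
      ring
    have h2 : 0 ≤ |T ^ 2 - t₀ ^ 2| := abs_nonneg _
    simp only [hf, h0, h1]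
    nlinarith
  have key : ∀ s ∈ Ioo ρ (R + a), |s ^ 2 - t₀ ^ 2| ≤ |T ^ 2 - t₀ ^ 2| → ¬ IsLocalMax f s := by
    intro s hs hsT hmax
    have hs0 : 0 < s := hρ.trans hs.1
    have hnorm : ‖a • e - s • e - a • e‖ = s := by
      rw [sub_sub_cancel_left, norm_neg, norm_smul, he, mul_one, Real.norm_of_nonneg hs0.le]
    refine (hu.le_meanCurv_of_isLocalMax_axis he ha (contDiff_bend m (σ * A) B (t₀ ^ 2)) hs
      hmax).not_gt (hbend m (σ * A) (t₀ ^ 2) _ _ ?_ ?_ ?_)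
    · rw [hnorm]; exact hs.1.le
    · rw [hnorm]; exact pow_le_pow_left₀ hs0.le hs.2.le 2
    · rw [hnorm]
      refine (abs_add_le _ _).trans ?_
      rw [abs_mul, hσ, abs_of_pos hA, abs_mul, abs_of_pos (by positivity : 0 < 2 * B)]
      nlinarith
  rcases hT with rfl | rfl
  · have hlt : T ^ 2 - t₀ ^ 2 < 0 := by
      have : T ^ 2 < t₀ ^ 2 := by gcongr; exact ht₀.1
      linarith
    have hσ0 : σ < 0 := by
      by_contra! h
      nlinarith [abs_pos.2 hlt.ne]
    obtain ⟨μ, hμ, hfμ⟩ := exists_mem_Ioo_lt_of_deriv_neg ht₀.1 hfd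
      (mul_neg_of_neg_of_pos (mul_neg_of_pos_of_neg (by linarith) hσ0) hA)
    obtain ⟨s, hs, hmax⟩ := exists_isLocalMax_of_lt (hcont.mono (Icc_subset_Icc_right ht₀.2.le)) hμ
      ((hfT.trans_eq hf0.symm).trans_lt hfμ) hfμ
    refine key s ⟨hs.1, hs.2.trans ht₀.2⟩ ?_ hmax
    have h1 : T ^ 2 ≤ s ^ 2 := by gcongr; exact hs.1.le
    have h2 : s ^ 2 ≤ t₀ ^ 2 := pow_le_pow_left₀ (hρ.trans hs.1).le hs.2.le 2
    rw [abs_of_neg hlt, abs_of_nonpos (by linarith)]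
    linarith
  · have hgt : 0 < (R + a) ^ 2 - t₀ ^ 2 := by
      have : t₀ ^ 2 < (R + a) ^ 2 := by gcongr; exact ht₀.2
      linarith
    have hσ0 : 0 < σ := by
      by_contra! h
      nlinarith [abs_pos.2 hgt.ne']
    obtain ⟨μ, hμ, hfμ⟩ := exists_mem_Ioo_lt_of_deriv_pos ht₀.2 hfd
      (mul_pos (mul_pos (by linarith) hσ0) hA)
    obtain ⟨s, hs, hmax⟩ := exists_isLocalMax_of_lt (hcont.mono (Icc_subset_Icc_left ht₀.1.le)) hμ
      hfμ ((hfT.trans_eq hf0.symm).trans_lt hfμ)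
    refine key s ⟨ht₀.1.trans hs.1, hs.2⟩ ?_ hmax
    have h1 : t₀ ^ 2 ≤ s ^ 2 := pow_le_pow_left₀ ht0.le hs.1.le 2
    have h2 : s ^ 2 ≤ (R + a) ^ 2 := pow_le_pow_left₀ (ht0.trans hs.1).le hs.2.le 2
    rw [abs_of_pos hgt, abs_of_nonneg (by linarith)]
    linarith

lemma exists_not_hasDerivAt_zero_inner {e : Plane} (he : ‖e‖ = 1) {a ρ R H : ℝ} (ha : 0 < a)
    {u : Plane → ℝ} (hu : IsAnnulusSolution (a • e) ρ R H u) :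
    ∃ δ > 0, ∀ t ∈ Ioo ρ (R + a), |ρ ^ 2 - t ^ 2| < δ →
      ¬ HasDerivAt (fun t : ℝ => u (a • e - t • e)) 0 t := by
  have hρ := hu.radius_pos
  have haR := hu.norm_smul_add_lt he ha
  obtain ⟨η, hη, hlow⟩ := hu.exists_hump_le_inner
  have hδ₀ : 0 < ((R - a) ^ 2 - ρ ^ 2) / 2 := by nlinarith
  refine hu.exists_not_hasDerivAt_zero he ha (Or.inl rfl) (mul_pos hη hδ₀) hδ₀ fun t ht htδ => ?_
  have h := hlow _ (sub_smul_mem he hρ haR ht)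
  have ht0 : 0 < t := hρ.trans ht.1
  rw [sub_sub_cancel_left, norm_neg, norm_smul, norm_smul, he, mul_one, mul_one,
    Real.norm_of_nonneg ht0.le, Real.norm_of_nonneg ha.le, hump] at h
  have h1 : ρ ^ 2 < t ^ 2 := by gcongr; exact ht.1
  rw [abs_of_neg (by linarith)] at htδ ⊢
  refine le_trans ?_ h
  rw [mul_assoc]
  refine mul_le_mul_of_nonneg_left ?_ hη.le
  nlinarith

lemma exists_not_hasDerivAt_zero_outer {e : Plane} (he : ‖e‖ = 1) {a ρ R H : ℝ} (ha : 0 < a)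
    {u : Plane → ℝ} (hu : IsAnnulusSolution (a • e) ρ R H u) :
    ∃ δ > 0, ∀ t ∈ Ioo ρ (R + a), |(R + a) ^ 2 - t ^ 2| < δ →
      ¬ HasDerivAt (fun t : ℝ => u (a • e - t • e)) 0 t := by
  have hρ := hu.radius_pos
  have haR := hu.norm_smul_add_lt he ha
  obtain ⟨η, hη, hlow⟩ := hu.exists_hump_le_outer
  set δ₀ := (R ^ 2 - (a + ρ) ^ 2) / 2 with hδ
  have hδ₀ : 0 < δ₀ := by rw [hδ]; nlinarith
  set k := (R - a) / (2 * (R + a)) with hk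
  have hk0 : 0 < k := div_pos (by linarith) (by linarith)
  have hk1 : k * (2 * (R + a)) = R - a := div_mul_cancel₀ _ (by linarith)
  refine hu.exists_not_hasDerivAt_zero he ha (Or.inr rfl) (mul_pos hη (mul_pos hδ₀ hk0)) hδ₀
    fun t ht htδ => ?_
  have h := hlow _ (sub_smul_mem he hρ haR ht)
  have ht0 : 0 < t := hρ.trans ht.1
  rw [← sub_smul, norm_smul, norm_smul, he, mul_one, mul_one, Real.norm_of_nonneg ha.le,
    Real.norm_eq_abs, sq_abs, hump] at h
  have h1 : t ^ 2 < (R + a) ^ 2 := by gcongr; exact ht.2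
  rw [abs_of_pos (by linarith)] at htδ ⊢
  rw [← sub_smul]
  refine le_trans ?_ h
  rw [mul_assoc]
  refine mul_le_mul_of_nonneg_left ?_ hη.le
  have h2 : δ₀ ≤ (a - t) ^ 2 - (a + ρ) ^ 2 := by
    have : 0 ≤ a * (R + a - t) := mul_nonneg ha.le (by linarith [ht.2])
    nlinarith
  have h3 : k * ((R + a) ^ 2 - t ^ 2) ≤ R ^ 2 - (a - t) ^ 2 := by
    have h4 : k * (R + a + t) ≤ R - a + t := by nlinarith [ht.2]
    have h5 := mul_le_mul_of_nonneg_left h4 (by linarith [ht.2] : 0 ≤ R + a - t)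
    linarith
  calc δ₀ * k * ((R + a) ^ 2 - t ^ 2) = δ₀ * (k * ((R + a) ^ 2 - t ^ 2)) := by ring
    _ ≤ _ := mul_le_mul h2 h3 (mul_nonneg hk0.le (by linarith)) (hδ₀.le.trans h2)

lemma finite_long_axis {e : Plane} (he : ‖e‖ = 1) {a ρ R H : ℝ} (ha : 0 < a)
    {u : Plane → ℝ} (hu : IsAnnulusSolution (a • e) ρ R H u)
    (huan : AnalyticOnNhd ℝ u (annulus (a • e) ρ R)) :
    {t ∈ Ioo ρ (R + a) | HasDerivAt (fun t : ℝ => u (a • e - t • e)) 0 t}.Finite := by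
  have hρ := hu.radius_pos
  have haR := hu.norm_smul_add_lt he ha
  obtain ⟨δ₁, hδ₁, h₁⟩ := hu.exists_not_hasDerivAt_zero_inner he ha
  obtain ⟨δ₂, hδ₂, h₂⟩ := hu.exists_not_hasDerivAt_zero_outer he ha
  set g : ℝ → ℝ := fun t => u (a • e - t • e) with hg
  set Z := {t ∈ Ioo ρ (R + a) | HasDerivAt g 0 t} with hZ
  have hgan : AnalyticOnNhd ℝ g (Ioo ρ (R + a)) := by
    refine huan.comp (f := fun t : ℝ => a • e - t • e) (fun t _ => ?_)
      fun t ht => sub_smul_mem he hρ haR ht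
    fun_prop
  by_contra hinf
  set K := {t ∈ Icc ρ (R + a) | δ₁ ≤ |ρ ^ 2 - t ^ 2| ∧ δ₂ ≤ |(R + a) ^ 2 - t ^ 2|} with hK
  have hKc : IsCompact K := by
    have h : ∀ r δ : ℝ, IsClosed {t : ℝ | δ ≤ |r ^ 2 - t ^ 2|} := fun r δ =>
      isClosed_le continuous_const (by fun_prop)
    exact isCompact_Icc.inter_right ((h ρ δ₁).inter (h (R + a) δ₂))
  have hZK : Z ⊆ K := fun t ht => ⟨Ioo_subset_Icc_self ht.1,
    not_lt.1 fun h => h₁ t ht.1 h ht.2, not_lt.1 fun h => h₂ t ht.1 h ht.2⟩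
  obtain ⟨t₀, ht₀, hacc⟩ := Set.Infinite.exists_accPt_of_subset_isCompact hinf hKc hZK
  have ht₀I : t₀ ∈ Ioo ρ (R + a) := by
    refine ⟨lt_of_le_of_ne ht₀.1.1 ?_, lt_of_le_of_ne ht₀.1.2 ?_⟩
    · rintro rfl
      simpa using hδ₁.trans_le ht₀.2.1
    · rintro rfl
      simpa using hδ₂.trans_le ht₀.2.2
  have hzero : EqOn (deriv g) 0 (Ioo ρ (R + a)) :=
    hgan.deriv.eqOn_zero_of_preconnected_of_frequently_eq_zero isPreconnected_Ioo ht₀I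
      ((accPt_iff_frequently_nhdsNE.1 hacc).mono fun t ht => ht.2.deriv)
  have hev : ∀ᶠ t in nhdsWithin ρ (Ioi ρ), |ρ ^ 2 - t ^ 2| < δ₁ :=
    (ContinuousAt.eventually_lt (by fun_prop) continuousAt_const (by simpa using hδ₁)).filter_mono
      nhdsWithin_le_nhds
  obtain ⟨t, htδ, htI⟩ := (hev.and (Ioo_mem_nhdsGT (show ρ < R + a by linarith))).exists
  refine h₁ t htI htδ ?_
  have := (hgan t htI).differentiableAt.hasDerivAt
  rwa [hzero htI] at this

lemma finite_setOf_fderiv_eq_zero {z : Plane} (hz : z ≠ 0) {ρ R H : ℝ} {u : Plane → ℝ}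
    (hu : IsAnnulusSolution z ρ R H u) (huan : AnalyticOnNhd ℝ u (annulus z ρ R)) :
    {x ∈ annulus z ρ R | fderiv ℝ u x = 0}.Finite := by
  obtain ⟨a, e, ha, he, rfl⟩ : ∃ (a : ℝ) (e : Plane), 0 < a ∧ ‖e‖ = 1 ∧ z = a • e := by
    have h := norm_pos_iff.2 hz
    exact ⟨‖z‖, ‖z‖⁻¹ • z, h, by rw [norm_smul, norm_inv, norm_norm, inv_mul_cancel₀ h.ne'],
      by rw [smul_smul, mul_inv_cancel₀ h.ne', one_smul]⟩
  have haR := hu.norm_smul_add_lt he ha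
  refine (((hu.subsingleton_short_axis he ha).finite.image fun t => a • e + t • e).union
    ((hu.finite_long_axis he ha huan).image fun t => a • e - t • e)).subset ?_
  rintro x ⟨hx, hx0⟩
  obtain ⟨c, rfl⟩ := hu.exists_eq_add_smul_of_fderiv_eq_zero hz hx hx0
  rw [smul_smul] at hx hx0 ⊢
  have hx' := hx
  rw [mem_annulus, add_sub_cancel_left, ← add_smul, norm_smul, norm_smul, he, mul_one, mul_one,
    Real.norm_eq_abs, Real.norm_eq_abs, abs_lt] at hx'
  rcases le_or_gt 0 (c * a) with h | h
  · rw [abs_of_nonneg h] at hx'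
    exact Or.inl ⟨c * a, ⟨⟨hx'.2, by linarith [hx'.1.2]⟩, hx0⟩, rfl⟩
  · rw [abs_of_neg h] at hx'
    have hI : -(c * a) ∈ Ioo ρ (R + a) := ⟨hx'.2, by linarith [hx'.1.1]⟩
    refine Or.inr ⟨-(c * a), ⟨hI, ?_⟩, by simp⟩
    have := hu.hasDerivAt_long_axis he ha hI
    simpa [hx0] using this

end IsAnnulusSolution

lemma meanCurv_neg (u : Plane → ℝ) (x : Plane) : meanCurv (fun y => -u y) x = -meanCurv u x := by
  have h1 : fderiv ℝ (fun y => -u y) = fun y => -fderiv ℝ u y := funext fun y => fderiv_fun_neg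
  have h2 : gradient (fun y => -u y) x = -gradient u x := by simp [gradient]
  have h3 : rot (-gradient u x) = -rot (gradient u x) := by
    ext i; fin_cases i <;> simp [rot]
  rw [_root_.meanCurv_eq, _root_.meanCurv_eq, h2, h1, fderiv_fun_neg, norm_neg, ← neg_div]
  congr 1
  simp [jetOp, h3]
  ring

lemma gradient_eq_zero_iff {u : Plane → ℝ} {x : Plane} : gradient u x = 0 ↔ fderiv ℝ u x = 0 := by
  simp [gradient]

lemma norm_add_lt_of_closedBall_subset {z : Plane} (hz : z ≠ 0) {ρ R : ℝ} (hρ : 0 < ρ)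
    (h : closedBall z ρ ⊆ ball 0 R) : ‖z‖ + ρ < R := by
  have hz0 := norm_pos_iff.2 hz
  have hmem : (1 + ρ * ‖z‖⁻¹) • z ∈ closedBall z ρ := by
    rw [mem_closedBall, dist_eq_norm, add_smul, one_smul, add_sub_cancel_left, norm_smul,
      Real.norm_of_nonneg (by positivity), inv_mul_cancel_right₀ hz0.ne']
  have := h hmem
  rw [mem_ball_zero_iff, norm_smul, Real.norm_of_nonneg (by positivity), add_mul, one_mul,
    inv_mul_cancel_right₀ hz0.ne'] at this
  exact this

lemma eq_zero_of_meanCurv_eq_zero {S : Set Plane} {u : Plane → ℝ} (hS : IsOpen S)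
    (hb : Bornology.IsBounded S) (hu : ContDiffOn ℝ 2 u S) (huc : ContinuousOn u (closure S))
    (h : ∀ x ∈ S, meanCurv u x = 0) (hfr : ∀ x ∈ frontier S, u x = 0) : ∀ x ∈ S, u x = 0 :=
  fun x hx => le_antisymm
    (le_of_meanCurv_eq_of_frontier hS hb contDiffOn_const hu continuousOn_const huc
      (fun y hy => (meanCurv_const 0 y).trans (h y hy).symm) (fun y hy => (hfr y hy).le) x hx)
    (le_of_meanCurv_eq_of_frontier hS hb hu contDiffOn_const huc continuousOn_const
      (fun y hy => (h y hy).trans (meanCurv_const 0 y).symm) (fun y hy => (hfr y hy).ge) x hx)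

/-- In a planar eccentric circular annulus, the critical set of a
nontrivial real-analytic solution of the constant mean curvature equation with zero
Dirichlet data is finite. -/
theorem critical_set_finite_eccentric_annulus_planar
    (z : EuclideanSpace ℝ (Fin 2)) (hz : z ≠ 0) (ρ R : ℝ) (hρ : 0 < ρ) (hρR : ρ < R)
    (hsub : closure (Metric.ball z ρ) ⊆ Metric.ball (0 : EuclideanSpace ℝ (Fin 2)) R)
    (Ω : Set (EuclideanSpace ℝ (Fin 2)))
    (hΩ : Ω = Metric.ball (0 : EuclideanSpace ℝ (Fin 2)) R \ closure (Metric.ball z ρ))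
    (H : ℝ) (u : EuclideanSpace ℝ (Fin 2) → ℝ)
    (huC2 : ContDiffOn ℝ 2 u Ω) (huC : ContinuousOn u (closure Ω))
    (hu : ∀ x ∈ Ω, meanCurv u x = H)
    (hbdry : ∀ x ∈ frontier Ω, u x = 0)
    (huan : AnalyticOnNhd ℝ u Ω)
    (hune : ∃ x ∈ Ω, u x ≠ 0) :
    {x | x ∈ Ω ∧ gradient u x = 0}.Finite := by
  have hΩ' : Ω = annulus z ρ R := by rw [hΩ, closure_ball z hρ.ne']; rfl
  rw [closure_ball z hρ.ne'] at hsub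
  have hR := norm_add_lt_of_closedBall_subset hz hρ hsub
  clear hΩ
  subst hΩ'
  simp only [gradient_eq_zero_iff]
  rcases lt_trichotomy H 0 with hH | rfl | hH
  · exact IsAnnulusSolution.finite_setOf_fderiv_eq_zero hz
      ⟨hρ, hR, hH, huC2, huC, hu, hbdry⟩ huan
  · obtain ⟨x, hx, hne⟩ := hune
    exact absurd
      (eq_zero_of_meanCurv_eq_zero isOpen_annulus isBounded_annulus huC2 huC hu hbdry x hx) hne
  · have hneg : IsAnnulusSolution z ρ R (-H) (fun x => -u x) :=
      ⟨hρ, hR, neg_neg_of_pos hH, huC2.neg, huC.neg, fun x hx => by rw [meanCurv_neg, hu x hx],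
        fun x hx => by rw [hbdry x hx, neg_zero]⟩
    have hfin := hneg.finite_setOf_fderiv_eq_zero hz huan.neg
    simpa [fderiv_fun_neg] using hfin
end
end

section
/- Let n ≥ 3 and let Ω = B(0,R) \ closure B(z,ρ) ⊂ ℝⁿ be an eccentric spherical annulus, where z = a·eₙ with a ≠ 0, 0 < ρ < R, and closure B(z,ρ) ⊂ B(0,R); thus Ω is rotationally symmetric about the xₙ-axis. Let H ∈ ℝ, and let u ∈ C²(Ω) ∩ C(closure Ω) solve the constant mean curvature equation div(∇u/√(1+|∇u|²)) = H in Ω with u = 0 on ∂Ω and u not identically zero. Let K = {x ∈ Ω : ∇u(x) = 0}. Then K contains no rotationally symmetric closed hypersurface: there is no open set U ⊂ ℝⁿ, invariant under every rotation about the xₙ-axis, whose topological frontier is contained in K and which satisfies either (i) closure U ⊆ Ω, or (ii) closure B(z,ρ) ⊆ U and closure U ⊆ B(0,R). -/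
open Set Metric

noncomputable section

/-- A rotation about the `k`-th coordinate axis: a linear isometry fixing `e_k` and
preserving the hyperplane spanned by the other coordinate vectors. -/
def IsAxisRotation {n : ℕ} (k : Fin n)
    (g : EuclideanSpace ℝ (Fin n) ≃ₗᵢ[ℝ] EuclideanSpace ℝ (Fin n)) : Prop :=
  g (EuclideanSpace.single k 1) = EuclideanSpace.single k 1 ∧
    ∀ x : EuclideanSpace ℝ (Fin n), x k = 0 → g x k = 0

open InnerProductSpace Topology Filter

section FormTrace

variable {E : Type*} [NormedAddCommGroup E] [InnerProductSpace ℝ E] [FiniteDimensional ℝ E]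

/-- The trace of a bilinear form with respect to the inner product. -/
def formTrace (B : E →L[ℝ] E →L[ℝ] ℝ) : ℝ :=
  ∑ i, B (stdOrthonormalBasis ℝ E i) (stdOrthonormalBasis ℝ E i)

theorem formTrace_eq_sum {ι : Type*} [Fintype ι] (b : OrthonormalBasis ι ℝ E)
    (B : E →L[ℝ] E →L[ℝ] ℝ) : formTrace B = ∑ i, B (b i) (b i) := by
  have h : TensorProduct.lift B.toLinearMap₁₂ (InnerProductSpace.canonicalCovariantTensor E)
        = formTrace B := by
    simp [formTrace, InnerProductSpace.canonicalCovariantTensor_eq_sum E (stdOrthonormalBasis ℝ E)]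
  have h' : TensorProduct.lift B.toLinearMap₁₂ (InnerProductSpace.canonicalCovariantTensor E)
        = ∑ i, B (b i) (b i) := by
    simp [InnerProductSpace.canonicalCovariantTensor_eq_sum E b]
  rw [← h', h]

theorem formTrace_sub (B C : E →L[ℝ] E →L[ℝ] ℝ) :
    formTrace (B - C) = formTrace B - formTrace C := by
  simp [formTrace, Finset.sum_sub_distrib]

/-- The principal part `(1+|p|²) tr B - B(p,p)` of the (rescaled) mean curvature operator. -/
def mcForm (p : E) (B : E →L[ℝ] E →L[ℝ] ℝ) : ℝ :=
  (1 + ‖p‖ ^ 2) * formTrace B - B p p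

theorem mcForm_sub (p : E) (B C : E →L[ℝ] E →L[ℝ] ℝ) :
    mcForm p (B - C) = mcForm p B - mcForm p C := by
  simp only [mcForm, formTrace_sub, sub_apply]; ring

theorem mcForm_add (p : E) (B C : E →L[ℝ] E →L[ℝ] ℝ) :
    mcForm p (B + C) = mcForm p B + mcForm p C := by
  simp only [mcForm, formTrace, add_apply, Finset.sum_add_distrib]; ring

theorem apply_self_le_of_nonpos {B : E →L[ℝ] E →L[ℝ] ℝ} (hB : ∀ v, B v v ≤ 0) (p : E) :
    ‖p‖ ^ 2 * formTrace B ≤ B p p := by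
  classical
  by_cases hp : p = 0
  · simp [hp]
  have hp' : ‖p‖ ≠ 0 := norm_ne_zero_iff.mpr hp
  set e : E := ‖p‖⁻¹ • p with he
  have hn : ‖e‖ = 1 := by rw [he, norm_smul, norm_inv, norm_norm, inv_mul_cancel₀ hp']
  have ho : Orthonormal ℝ ((↑) : ({e} : Set E) → E) := by
    rw [orthonormal_subtype_iff_ite]
    intro v hv w hw
    rw [Set.mem_singleton_iff] at hv hw
    subst hv; subst hw
    simp [hn]
  obtain ⟨s, b, hs, hb⟩ := ho.exists_orthonormalBasis_extension
  have hes : e ∈ s := by exact_mod_cast hs (Set.mem_singleton e)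
  have hpe : p = ‖p‖ • e := by rw [he, smul_smul, mul_inv_cancel₀ hp', one_smul]
  have hle : formTrace B ≤ B e e := by
    rw [formTrace_eq_sum b]
    have := Finset.add_sum_erase Finset.univ (fun i => B (b i) (b i))
      (Finset.mem_univ (⟨e, hes⟩ : s))
    rw [← this]
    have h2 : ∑ i ∈ Finset.univ.erase (⟨e, hes⟩ : s), B (b i) (b i) ≤ 0 :=
      Finset.sum_nonpos fun i _ => hB _
    have h3 : b ⟨e, hes⟩ = e := by simp [hb]
    simp only [h3]
    linarith
  have h4 : B p p = ‖p‖ ^ 2 * B e e := by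
    conv_lhs => rw [hpe]
    simp only [map_smul, smul_apply, smul_eq_mul]; ring
  rw [h4]
  exact mul_le_mul_of_nonneg_left hle (by positivity)

theorem mcForm_nonpos {B : E →L[ℝ] E →L[ℝ] ℝ} (hB : ∀ v, B v v ≤ 0) (p : E) :
    mcForm p B ≤ 0 := by
  have h1 := apply_self_le_of_nonpos hB p
  have h2 : formTrace B ≤ 0 := Finset.sum_nonpos fun i _ => hB _
  unfold mcForm; linarith

theorem mcForm_comp_isometry (A : E ≃ₗᵢ[ℝ] E) {B C : E →L[ℝ] E →L[ℝ] ℝ}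
    (hC : ∀ v w, C v w = B (A v) (A w)) {p q : E} (hq : A q = p) : mcForm q C = mcForm p B := by
  have h1 : formTrace C = formTrace B := by
    rw [formTrace_eq_sum ((stdOrthonormalBasis ℝ E).map A) B]
    simp [formTrace, hC]
  have h2 : ‖q‖ = ‖p‖ := by rw [← hq, A.norm_map]
  unfold mcForm
  rw [h1, h2, hC, hq]

/-- The rank one form `(v, w) ↦ c ⟪e, v⟫ ⟪e, w⟫`. -/
def rankOneForm (c : ℝ) (e : E) : E →L[ℝ] E →L[ℝ] ℝ :=
  (c • innerSL ℝ e).smulRight (innerSL ℝ e)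

omit [FiniteDimensional ℝ E] in
theorem rankOneForm_apply (c : ℝ) (e v w : E) :
    rankOneForm c e v w = c * inner ℝ e v * inner ℝ e w := by
  simp [rankOneForm]

theorem le_mcForm_rankOneForm {c : ℝ} (hc : 0 ≤ c) {e : E} (he : ‖e‖ = 1) (p : E) :
    c ≤ mcForm p (rankOneForm c e) := by
  have ht : formTrace (rankOneForm c e) = c := by
    have := (stdOrthonormalBasis ℝ E).sum_sq_norm_inner_left e
    simp only [formTrace, rankOneForm_apply, mul_assoc, ← Finset.mul_sum]
    simp only [Real.norm_eq_abs, sq_abs, he] at this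
    simp only [← pow_two]
    rw [this]; ring
  unfold mcForm
  rw [ht, rankOneForm_apply]
  have h1 : |inner ℝ e p| ≤ ‖p‖ := by simpa [he] using abs_real_inner_le_norm e p
  have h2 : (inner ℝ e p) ^ 2 ≤ ‖p‖ ^ 2 := sq_le_sq.mpr (by simpa using h1)
  nlinarith

theorem abs_mcForm_sub_le {M : ℝ} (B : E →L[ℝ] E →L[ℝ] ℝ) (hB : ‖B‖ ≤ M)
    (hT : |formTrace B| ≤ M) {p q : E} (hp : ‖p‖ ≤ M) (hq : ‖q‖ ≤ M) :
    |mcForm p B - mcForm q B| ≤ 4 * M ^ 2 * ‖p - q‖ := by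
  have hM : 0 ≤ M := (norm_nonneg p).trans hp
  have e1 : mcForm p B - mcForm q B =
      (‖p‖ - ‖q‖) * (‖p‖ + ‖q‖) * formTrace B - (B (p - q) p + B q (p - q)) := by
    simp only [mcForm, map_sub, sub_apply]; ring
  have h0 : |‖p‖ - ‖q‖| ≤ ‖p - q‖ := abs_norm_sub_norm_le p q
  have hd := norm_nonneg (p - q)
  have h1 : |(‖p‖ - ‖q‖) * (‖p‖ + ‖q‖) * formTrace B| ≤ ‖p - q‖ * (M + M) * M := by
    rw [abs_mul, abs_mul, abs_of_nonneg (by positivity : 0 ≤ ‖p‖ + ‖q‖)]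
    gcongr
  have h2 : |B (p - q) p| ≤ M * ‖p - q‖ * M := by
    refine (B.le_opNorm₂ _ _).trans ?_
    gcongr
  have h3 : |B q (p - q)| ≤ M * M * ‖p - q‖ := by
    refine (B.le_opNorm₂ _ _).trans ?_
    gcongr
  rw [e1]
  rw [abs_le] at *
  constructor <;> nlinarith

omit [InnerProductSpace ℝ E] [FiniteDimensional ℝ E] in
theorem abs_sqrt_cube_sub_le {M : ℝ} {p q : E} (hp : ‖p‖ ≤ M) (hq : ‖q‖ ≤ M) :
    |√(1 + ‖p‖ ^ 2) ^ 3 - √(1 + ‖q‖ ^ 2) ^ 3| ≤ 3 * (1 + M) ^ 2 * ‖p - q‖ := by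
  set s := √(1 + ‖p‖ ^ 2)
  set t := √(1 + ‖q‖ ^ 2)
  have hs : s ^ 2 = 1 + ‖p‖ ^ 2 := Real.sq_sqrt (by positivity)
  have ht : t ^ 2 = 1 + ‖q‖ ^ 2 := Real.sq_sqrt (by positivity)
  have s0 : 0 ≤ s := Real.sqrt_nonneg _
  have t0 : 0 ≤ t := Real.sqrt_nonneg _
  have hp0 := norm_nonneg p
  have hq0 := norm_nonneg q
  have s1 : s ≤ 1 + M := by nlinarith
  have t1 : t ≤ 1 + M := by nlinarith
  have sp : ‖p‖ ≤ s := Real.le_sqrt_of_sq_le (by linarith)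
  have tq : ‖q‖ ≤ t := Real.le_sqrt_of_sq_le (by linarith)
  have hst : 0 < s + t := by nlinarith
  have h0 : |‖p‖ - ‖q‖| ≤ ‖p - q‖ := abs_norm_sub_norm_le p q
  have h1 : |s - t| ≤ ‖p - q‖ := by
    refine le_trans ?_ h0
    have : |s - t| * (s + t) = |‖p‖ - ‖q‖| * (‖p‖ + ‖q‖) := by
      have hsum : 0 ≤ ‖p‖ + ‖q‖ := by positivity
      calc |s - t| * (s + t) = |(s - t) * (s + t)| := by rw [abs_mul, abs_of_pos hst]
        _ = |(‖p‖ - ‖q‖) * (‖p‖ + ‖q‖)| := by congr 1; nlinarith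
        _ = _ := by rw [abs_mul, abs_of_nonneg hsum]
    have h2 : |s - t| * (s + t) ≤ |‖p‖ - ‖q‖| * (s + t) := by
      rw [this]; gcongr
    exact le_of_mul_le_mul_right h2 hst
  have h3 : s ^ 3 - t ^ 3 = (s - t) * (s ^ 2 + s * t + t ^ 2) := by ring
  rw [h3, abs_mul, abs_of_nonneg (by positivity : 0 ≤ s ^ 2 + s * t + t ^ 2), mul_comm]
  have : s ^ 2 + s * t + t ^ 2 ≤ 3 * (1 + M) ^ 2 := by nlinarith
  gcongr

end FormTrace

section Comparison

/-- The equation `(1+|∇u|²) Δu - D²u(∇u,∇u) = H (1+|∇u|²)^{3/2}` at the point `x`. -/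
def IsCMCAt {E : Type*} [NormedAddCommGroup E] [InnerProductSpace ℝ E] [FiniteDimensional ℝ E]
    (H : ℝ) (u : E → ℝ) (x : E) : Prop :=
  mcForm (gradient u x) (fderiv ℝ (fderiv ℝ u) x) = H * √(1 + ‖gradient u x‖ ^ 2) ^ 3

theorem isCMCAt_meanCurv {n : ℕ} (u : EuclideanSpace ℝ (Fin n) → ℝ)
    (x : EuclideanSpace ℝ (Fin n)) : IsCMCAt (meanCurv u x) u x := by
  unfold IsCMCAt
  set p := gradient u x
  set B := fderiv ℝ (fderiv ℝ u) x with hB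
  have h1 : formTrace B = ∑ i, hessEntry u x i i := by
    rw [formTrace_eq_sum (EuclideanSpace.basisFun (Fin n) ℝ)]
    simp [hessEntry, iteratedFDeriv_two_apply, hB]
  have h2 : B p p = ∑ i, ∑ j, p i * p j * hessEntry u x i j := by
    have hp : p = ∑ i, p i • EuclideanSpace.single i (1 : ℝ) := by
      have := (EuclideanSpace.basisFun (Fin n) ℝ).sum_repr p
      simpa using this.symm
    conv_lhs => rw [hp]
    simp only [map_sum, map_smul, sum_apply, smul_apply, smul_eq_mul, hessEntry,
      iteratedFDeriv_two_apply, Finset.mul_sum]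
    rw [Finset.sum_comm]
    refine Finset.sum_congr rfl fun i _ => Finset.sum_congr rfl fun j _ => ?_
    simp [hB]; ring
  set s := √(1 + ‖p‖ ^ 2) with hs
  have hs2 : 1 + ‖p‖ ^ 2 = s ^ 2 := (Real.sq_sqrt (by positivity)).symm
  have hs0 : 0 < s := Real.sqrt_pos.mpr (by positivity)
  have h3 : meanCurv u x = s⁻¹ * (formTrace B - B p p / s ^ 2) := by
    rw [h1, h2, meanCurv, Finset.sum_div, ← Finset.sum_sub_distrib, Finset.mul_sum]
    refine Finset.sum_congr rfl fun i _ => ?_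
    have : hessEntry u x i i = ∑ j, (if i = j then 1 else 0) * hessEntry u x i j := by simp
    rw [this, Finset.sum_div, ← Finset.sum_sub_distrib, Finset.mul_sum]
    refine Finset.sum_congr rfl fun j _ => ?_
    change (√(1 + ‖p‖ ^ 2))⁻¹ * ((if i = j then 1 else 0) - p i * p j / (1 + ‖p‖ ^ 2)) * _ = _
    rw [← hs, hs2]
    ring
  rw [h3, mcForm, hs2]
  field_simp

variable {E : Type*} [NormedAddCommGroup E] [InnerProductSpace ℝ E] [FiniteDimensional ℝ E]

omit [FiniteDimensional ℝ E] in
theorem fderiv_fderiv_apply_self_nonpos_of_isLocalMax {f : E → ℝ} {x : E}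
    (hf : ContDiffAt ℝ 2 f x) (hx : IsLocalMax f x) (v : E) :
    fderiv ℝ (fderiv ℝ f) x v v ≤ 0 := by
  by_contra! hpos
  set g : ℝ → ℝ := fun t => f (x + t • v) with hg
  have hline : ∀ t : ℝ, HasDerivAt (fun t : ℝ => x + t • v) v t := fun t => by
    simpa using ((hasDerivAt_id t).smul_const v).const_add x
  have hcont : Tendsto (fun t : ℝ => x + t • v) (𝓝 0) (𝓝 x) := by
    have := (hline 0).continuousAt.tendsto
    simpa using this
  have hd : ∀ᶠ t in 𝓝 (0 : ℝ), HasDerivAt g (fderiv ℝ f (x + t • v) v) t := by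
    have h1 : ∀ᶠ y in 𝓝 x, DifferentiableAt ℝ f y := by
      have := hf.eventually (by simp)
      filter_upwards [this] with y hy using hy.differentiableAt (by norm_num)
    filter_upwards [hcont.eventually h1] with t ht
    exact ht.hasFDerivAt.comp_hasDerivAt t (hline t)
  have hd0 : deriv g =ᶠ[𝓝 0] fun t => fderiv ℝ f (x + t • v) v := hd.mono fun t ht => ht.deriv
  have hD : DifferentiableAt ℝ (fderiv ℝ f) x :=
    (hf.fderiv_right (m := 1) (by norm_num)).differentiableAt (by norm_num)
  have hdd : HasDerivAt (deriv g) (fderiv ℝ (fderiv ℝ f) x v v) 0 := by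
    refine HasDerivAt.congr_of_eventuallyEq ?_ hd0
    have h0 : HasFDerivAt (fderiv ℝ f) (fderiv ℝ (fderiv ℝ f) x) (x + (0 : ℝ) • v) := by
      simpa using hD.hasFDerivAt
    have := h0.comp_hasDerivAt (0 : ℝ) (hline 0)
    exact (this.clm_apply (hasDerivAt_const (0 : ℝ) v)).congr_deriv (by simp)
  have hgmax : IsLocalMax g 0 := by
    have := hcont.eventually hx
    filter_upwards [this] with t ht
    simpa [hg] using ht
  have hgmin : IsLocalMin g 0 :=
    isLocalMin_of_deriv_deriv_pos (by rw [hdd.deriv]; exact hpos) hgmax.deriv_eq_zero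
      hd.self_of_nhds.continuousAt
  have hconst : g =ᶠ[𝓝 0] fun _ => g 0 := by
    filter_upwards [hgmax, hgmin] with t h1 h2 using le_antisymm h1 h2
  have h0 : deriv g =ᶠ[𝓝 0] fun _ => 0 := by
    have := hconst.deriv
    simpa using this
  have : deriv (deriv g) 0 = 0 := by
    rw [h0.deriv_eq]; simp
  rw [hdd.deriv] at this
  linarith

omit [FiniteDimensional ℝ E] in
theorem contDiff_exp_inner (l : ℝ) (e : E) {m : WithTop ℕ∞} :
    ContDiff ℝ m fun y : E => Real.exp (l * inner ℝ e y) :=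
  (contDiff_const.mul (innerSL ℝ e).contDiff).exp

omit [FiniteDimensional ℝ E] in
theorem fderiv_exp_inner (l : ℝ) (e : E) :
    fderiv ℝ (fun y : E => Real.exp (l * inner ℝ e y)) =
      fun y => (Real.exp (l * inner ℝ e y) * l) • innerSL ℝ e := by
  ext1 y
  have h := (((innerSL ℝ e).hasFDerivAt (x := y)).const_mul l).exp
  have := h.fderiv
  simpa [smul_smul] using this

omit [FiniteDimensional ℝ E] in
theorem fderiv_fderiv_exp_inner (l : ℝ) (e x : E) :
    fderiv ℝ (fderiv ℝ (fun y : E => Real.exp (l * inner ℝ e y))) x =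
      rankOneForm (l ^ 2 * Real.exp (l * inner ℝ e x)) e := by
  rw [fderiv_exp_inner]
  have h := (((((innerSL ℝ e).hasFDerivAt (x := x)).const_mul l).exp).mul_const l).smul_const
    (innerSL ℝ e)
  have := h.fderiv
  simp only [innerSL_apply_apply] at this
  rw [this]
  ext v w
  simp only [rankOneForm_apply, ContinuousLinearMap.smulRight_apply, smul_apply,
    innerSL_apply_apply, smul_eq_mul]
  ring

omit [FiniteDimensional ℝ E] in
theorem norm_gradient_sub [CompleteSpace E] (u v : E → ℝ) (x : E) :
    ‖gradient u x - gradient v x‖ = ‖fderiv ℝ u x - fderiv ℝ v x‖ := by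
  rw [gradient, gradient, ← map_sub, LinearIsometryEquiv.norm_map]

omit [FiniteDimensional ℝ E] in
theorem norm_gradient [CompleteSpace E] (u : E → ℝ) (x : E) :
    ‖gradient u x‖ = ‖fderiv ℝ u x‖ := by
  rw [gradient, LinearIsometryEquiv.norm_map]

/-- On a compact set, the perturbed difference of two solutions of the constant mean curvature
equation cannot attain an interior local maximum. -/
theorem exists_forall_not_isLocalMax {S : Set E} (hS : IsCompact S) {e : E} (he : ‖e‖ = 1)
    {H : ℝ} {u v : E → ℝ} (hu : ∀ x ∈ S, ContDiffAt ℝ 2 u x) (hv : ∀ x ∈ S, ContDiffAt ℝ 2 v x)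
    (hHu : ∀ x ∈ S, IsCMCAt H u x) (hHv : ∀ x ∈ S, IsCMCAt H v x) :
    ∃ l : ℝ, ∀ ε > 0, ∀ x ∈ S,
      ¬ IsLocalMax (fun y => u y - v y + ε * Real.exp (l * inner ℝ e y)) x := by
  have hD1 : ∀ {w : E → ℝ}, (∀ x ∈ S, ContDiffAt ℝ 2 w x) → ∀ x ∈ S,
      ContDiffAt ℝ 1 (fderiv ℝ w) x := fun hw x hx =>
    (hw x hx).fderiv_right (by norm_num)
  have hD2 : ContinuousOn (fderiv ℝ (fderiv ℝ v)) S := fun x hx =>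
    ((hD1 hv x hx).fderiv_right (m := 0) (by norm_num)).continuousAt.continuousWithinAt
  have hD2norm : ContinuousOn (fun x => ‖fderiv ℝ (fderiv ℝ v) x‖) S :=
    (continuous_norm (E := E →L[ℝ] E →L[ℝ] ℝ)).comp_continuousOn hD2
  have hcu : ContinuousOn (fderiv ℝ u) S := fun x hx =>
    (hD1 hu x hx).continuousAt.continuousWithinAt
  have hcv : ContinuousOn (fderiv ℝ v) S := fun x hx =>
    (hD1 hv x hx).continuousAt.continuousWithinAt
  have hcT : ContinuousOn (fun x => formTrace (fderiv ℝ (fderiv ℝ v) x)) S := by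
    unfold formTrace
    refine continuousOn_finsetSum _ fun i _ => ?_
    exact (hD2.clm_apply continuousOn_const).clm_apply continuousOn_const
  obtain ⟨M1, hM1⟩ := hS.exists_bound_of_continuousOn hcu
  obtain ⟨M2, hM2⟩ := hS.exists_bound_of_continuousOn hcv
  obtain ⟨M3, hM3⟩ := hS.exists_bound_of_continuousOn
    (f := fun x => ‖fderiv ℝ (fderiv ℝ v) x‖) hD2norm
  obtain ⟨M4, hM4⟩ := hS.exists_bound_of_continuousOn hcT
  obtain ⟨M, hMM1, hMM2, hMM3, hMM4⟩ : ∃ M, M1 ≤ M ∧ M2 ≤ M ∧ M3 ≤ M ∧ M4 ≤ M :=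
    ⟨max (max M1 M2) (max M3 M4), by simp, by simp, by simp, by simp⟩
  set C := 4 * M ^ 2 + |H| * (3 * (1 + M) ^ 2) with hC
  have hC0 : 0 ≤ C := by positivity
  refine ⟨C + 1, fun ε hε x hx hmax => ?_⟩
  set l := C + 1 with hl
  set ψ : E → ℝ := fun y => Real.exp (l * inner ℝ e y) with hψ
  set p := gradient u x
  set q := gradient v x
  have hψ2 : ContDiffAt ℝ 2 ψ x := (contDiff_exp_inner l e).contDiffAt
  have hψpos : 0 < ψ x := Real.exp_pos _
  have hu2 := hu x hx
  have hv2 := hv x hx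
  have hf2 : ContDiffAt ℝ 2 (fun y => u y - v y + ε * ψ y) x :=
    (hu2.sub hv2).add (contDiffAt_const.mul hψ2)
  -- first order condition
  have hdu := hu2.differentiableAt (by norm_num)
  have hdv := hv2.differentiableAt (by norm_num)
  have hdψ := hψ2.differentiableAt (by norm_num)
  have hfd : fderiv ℝ u x - fderiv ℝ v x + ε • fderiv ℝ ψ x = 0 := by
    rw [← ((hdu.hasFDerivAt.sub hdv.hasFDerivAt).add (hdψ.hasFDerivAt.const_mul ε)).fderiv]
    exact hmax.fderiv_eq_zero
  have hpq : ‖p - q‖ = ε * (ψ x * l) := by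
    rw [norm_gradient_sub, eq_neg_of_add_eq_zero_left hfd, norm_neg, fderiv_exp_inner]
    simp only [norm_smul, innerSL_apply_norm, he, mul_one, Real.norm_eq_abs]
    rw [abs_of_pos hε, abs_of_pos (by positivity)]
  -- second order condition
  have hfd2 : fderiv ℝ (fderiv ℝ (fun y => u y - v y + ε * ψ y)) x =
      fderiv ℝ (fderiv ℝ u) x - fderiv ℝ (fderiv ℝ v) x + ε • fderiv ℝ (fderiv ℝ ψ) x := by
    have hev : fderiv ℝ (fun y => u y - v y + ε * ψ y) =ᶠ[𝓝 x]
        fun y => fderiv ℝ u y - fderiv ℝ v y + ε • fderiv ℝ ψ y := by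
      filter_upwards [hu2.eventually (by simp), hv2.eventually (by simp)] with y h1 h2
      have h1' := h1.differentiableAt (by norm_num)
      have h2' := h2.differentiableAt (by norm_num)
      have h3' : DifferentiableAt ℝ ψ y := (contDiff_exp_inner l e (m := 1)).differentiable
        (by norm_num) y
      exact ((h1'.hasFDerivAt.sub h2'.hasFDerivAt).add (h3'.hasFDerivAt.const_mul ε)).fderiv
    rw [hev.fderiv_eq]
    have h1 := ((hD1 hu x hx).differentiableAt (by norm_num)).hasFDerivAt
    have h2 := ((hD1 hv x hx).differentiableAt (by norm_num)).hasFDerivAt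
    have h3 := ((hψ2.fderiv_right (m := 1) (by norm_num)).differentiableAt
      (by norm_num)).hasFDerivAt
    exact ((h1.sub h2).add (h3.const_smul ε)).fderiv
  have hneg := fun w => fderiv_fderiv_apply_self_nonpos_of_isLocalMax hf2 hmax w
  have hF := mcForm_nonpos hneg p
  rw [hfd2, fderiv_fderiv_exp_inner] at hF
  have hR : ε • rankOneForm (l ^ 2 * ψ x) e = rankOneForm (ε * (l ^ 2 * ψ x)) e := by
    ext v w; simp [rankOneForm_apply]; ring
  change mcForm p (_ + ε • rankOneForm (l ^ 2 * ψ x) e) ≤ 0 at hF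
  rw [hR, mcForm_add, mcForm_sub] at hF
  have hlow := le_mcForm_rankOneForm (c := ε * (l ^ 2 * ψ x)) (by positivity) he p
  have hpM : ‖p‖ ≤ M := by rw [norm_gradient]; exact (hM1 x hx).trans hMM1
  have hqM : ‖q‖ ≤ M := by rw [norm_gradient]; exact (hM2 x hx).trans hMM2
  have hlip := abs_mcForm_sub_le (fderiv ℝ (fderiv ℝ v) x) (((le_abs_self _).trans (hM3 x hx)).trans hMM3)
    ((hM4 x hx).trans hMM4) hpM hqM
  have hcube := abs_sqrt_cube_sub_le hpM hqM
  have h1 : mcForm p (fderiv ℝ (fderiv ℝ u) x) = H * √(1 + ‖p‖ ^ 2) ^ 3 := hHu x hx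
  have h2 : mcForm q (fderiv ℝ (fderiv ℝ v) x) = H * √(1 + ‖q‖ ^ 2) ^ 3 := hHv x hx
  have hH : |H * √(1 + ‖p‖ ^ 2) ^ 3 - H * √(1 + ‖q‖ ^ 2) ^ 3| ≤
      |H| * (3 * (1 + M) ^ 2 * ‖p - q‖) := by
    rw [← mul_sub, abs_mul]; gcongr
  have hkey : ε * (l ^ 2 * ψ x) ≤ C * ‖p - q‖ := by
    have := (abs_le.mp hH).1
    have := (abs_le.mp hlip).2
    rw [hC]
    nlinarith
  rw [hpq] at hkey
  have hpos : 0 < ε * ψ x * l := by positivity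
  have : ε * ψ x * l * l ≤ ε * ψ x * l * C := by nlinarith
  have := le_of_mul_le_mul_left this hpos
  linarith

/-- Comparison principle for the constant mean curvature equation. -/
theorem sub_le_of_frontier [Nontrivial E] {V : Set E} (hV : IsOpen V) (hVb : Bornology.IsBounded V)
    {H : ℝ} {u v : E → ℝ} (hu : ∀ x ∈ V, ContDiffAt ℝ 2 u x) (hv : ∀ x ∈ V, ContDiffAt ℝ 2 v x)
    (hcu : ContinuousOn u (closure V)) (hcv : ContinuousOn v (closure V))
    (hHu : ∀ x ∈ V, IsCMCAt H u x) (hHv : ∀ x ∈ V, IsCMCAt H v x) {m : ℝ}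
    (hm : ∀ x ∈ frontier V, u x - v x ≤ m) : ∀ x ∈ V, u x - v x ≤ m := by
  intro x₀ hx₀
  by_contra! hlt
  obtain ⟨e, he⟩ := exists_norm_eq E (zero_le_one (α := ℝ))
  have hK : IsCompact (closure V) := hVb.isCompact_closure
  have hcw : ContinuousOn (fun y => u y - v y) (closure V) := hcu.sub hcv
  set c := (u x₀ - v x₀ + m) / 2 with hc
  set S := closure V ∩ (fun y => u y - v y) ⁻¹' Set.Ici c with hSdef
  have hS : IsCompact S := by
    refine hK.of_isClosed_subset ?_ Set.inter_subset_left
    exact hcw.preimage_isClosed_of_isClosed isClosed_closure isClosed_Ici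
  have hSV : S ⊆ V := by
    rintro y ⟨hy, hyc⟩
    by_contra hyV
    have := hm y ⟨hy, by rwa [hV.interior_eq]⟩
    simp only [Set.mem_preimage, Set.mem_Ici] at hyc
    linarith
  obtain ⟨l, hl⟩ := exists_forall_not_isLocalMax hS he (fun x hx => hu x (hSV hx))
    (fun x hx => hv x (hSV hx)) (fun x hx => hHu x (hSV hx)) (fun x hx => hHv x (hSV hx))
  have hcψ : Continuous fun y : E => Real.exp (l * inner ℝ e y) := (contDiff_exp_inner l e
    (m := 0)).continuous
  obtain ⟨T, hT⟩ := hK.exists_bound_of_continuousOn hcψ.continuousOn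
  have hT0 : 0 < T := by
    have := hT x₀ (subset_closure hx₀)
    rw [Real.norm_eq_abs, abs_of_pos (Real.exp_pos _)] at this
    exact (Real.exp_pos _).trans_le this
  set ε := (u x₀ - v x₀ - m) / (2 * T) with hε
  have hε0 : 0 < ε := by apply div_pos <;> linarith
  have hεT : ε * T = (u x₀ - v x₀ - m) / 2 := by rw [hε]; field_simp
  obtain ⟨y, hy, hymax⟩ := hK.exists_isMaxOn ⟨x₀, subset_closure hx₀⟩
    (f := fun y => u y - v y + ε * Real.exp (l * inner ℝ e y))
    (hcw.add (continuousOn_const.mul hcψ.continuousOn))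
  have hyS : y ∈ S := by
    refine ⟨hy, ?_⟩
    have h1 := hymax (subset_closure hx₀)
    have h2 := hT y hy
    rw [Real.norm_eq_abs, abs_of_pos (Real.exp_pos _)] at h2
    have h3 : 0 < ε * Real.exp (l * inner ℝ e x₀) := by positivity
    have h4 : ε * Real.exp (l * inner ℝ e y) ≤ ε * T := by gcongr
    simp only [Set.mem_ofPred_eq] at h1
    simp only [Set.mem_preimage, Set.mem_Ici]
    linarith
  refine hl ε hε0 y hyS ?_
  filter_upwards [hV.mem_nhds (hSV hyS)] with w hw using hymax (subset_closure hw)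

theorem abs_sub_le_of_frontier [Nontrivial E] {V : Set E} (hV : IsOpen V)
    (hVb : Bornology.IsBounded V)
    {H : ℝ} {u v : E → ℝ} (hu : ∀ x ∈ V, ContDiffAt ℝ 2 u x) (hv : ∀ x ∈ V, ContDiffAt ℝ 2 v x)
    (hcu : ContinuousOn u (closure V)) (hcv : ContinuousOn v (closure V))
    (hHu : ∀ x ∈ V, IsCMCAt H u x) (hHv : ∀ x ∈ V, IsCMCAt H v x) {m : ℝ}
    (hm : ∀ x ∈ frontier V, |u x - v x| ≤ m) : ∀ x ∈ V, |u x - v x| ≤ m := by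
  intro x hx
  have h1 := sub_le_of_frontier hV hVb hu hv hcu hcv hHu hHv
    (fun y hy => (abs_le.mp (hm y hy)).2) x hx
  have h2 := sub_le_of_frontier hV hVb hv hu hcv hcu hHv hHu
    (fun y hy => by have := (abs_le.mp (hm y hy)).1; linarith) x hx
  exact abs_le.mpr ⟨by linarith, h1⟩

end Comparison

section IsometryFamilies

variable {E : Type*} [NormedAddCommGroup E] [InnerProductSpace ℝ E] [FiniteDimensional ℝ E]

theorem IsCMCAt.comp_isometry {H : ℝ} {u : E → ℝ} (A : E ≃ₗᵢ[ℝ] E) (b : E) {x : E}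
    (hu : ContDiffAt ℝ 2 u (A x + b)) (h : IsCMCAt H u (A x + b)) :
    IsCMCAt H (fun y => u (A y + b)) x := by
  set T : E →L[ℝ] E := (A.toContinuousLinearEquiv : E →L[ℝ] E) with hT
  have hTA : ∀ y, T y = A y := fun y => rfl
  have hφ : ∀ y, HasFDerivAt (fun y => A y + b) T y := fun y => T.hasFDerivAt.add_const b
  have hφc : Continuous fun y => A y + b := A.continuous.add continuous_const
  have hd : ∀ᶠ y in 𝓝 x, fderiv ℝ (fun y => u (A y + b)) y =
      (fderiv ℝ u (A y + b)).comp T := by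
    filter_upwards [hφc.continuousAt.eventually (hu.eventually (by simp))] with y hy
    exact ((hy.differentiableAt (by norm_num)).hasFDerivAt.comp y (hφ y)).fderiv
  have hd2 : ∀ v w, fderiv ℝ (fderiv ℝ (fun y => u (A y + b))) x v w =
      fderiv ℝ (fderiv ℝ u) (A x + b) (A v) (A w) := by
    intro v w
    have hD : DifferentiableAt ℝ (fderiv ℝ u) (A x + b) :=
      (hu.fderiv_right (m := 1) (by norm_num)).differentiableAt (by norm_num)
    have h1 : HasFDerivAt (fun y => fderiv ℝ u (A y + b))
        ((fderiv ℝ (fderiv ℝ u) (A x + b)).comp T) x := hD.hasFDerivAt.comp x (hφ x)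
    have h2 := h1.clm_comp (hasFDerivAt_const T x)
    have hd' : fderiv ℝ (fun y => u (A y + b)) =ᶠ[𝓝 x]
      fun y => (fderiv ℝ u (A y + b)).comp T := hd
    rw [hd'.fderiv_eq, h2.fderiv]
    simp [hTA]
  have hg : A (gradient (fun y => u (A y + b)) x) = gradient u (A x + b) := by
    refine ext_inner_right ℝ fun w => ?_
    have : inner ℝ (A (gradient (fun y => u (A y + b)) x)) w =
        inner ℝ (gradient (fun y => u (A y + b)) x) (A.symm w) := by
      rw [← A.inner_map_map _ (A.symm w), A.apply_symm_apply]
    rw [this, inner_gradient_left, inner_gradient_left, hd.self_of_nhds]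
    simp [hTA]
  unfold IsCMCAt
  rw [mcForm_comp_isometry A hd2 hg, ← A.norm_map (gradient (fun y => u (A y + b)) x), hg]
  exact h

/-- If `∇u` vanishes on the free part `S` of the frontier of `V`, and `u` vanishes on the remaining
part `P`, then `u` changes little along isometries preserving `P` and close to the identity. -/
theorem exists_forall_abs_sub_le [Nontrivial E] {Ω V S P : Set E} {H : ℝ} {u : E → ℝ}
    (hΩ : IsOpen Ω) (hV : IsOpen V) (hVb : Bornology.IsBounded V) (hVΩ : V ⊆ Ω)
    (hu2 : ContDiffOn ℝ 2 u Ω) (huc : ContinuousOn u (closure Ω)) (hH : ∀ x ∈ Ω, IsCMCAt H u x)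
    (hS : IsCompact S) (hSΩ : S ⊆ Ω) (hS0 : ∀ x ∈ S, fderiv ℝ u x = 0) (hP : ∀ x ∈ P, u x = 0)
    (hfr : frontier V ⊆ S ∪ P) {ε : ℝ} (hε : 0 < ε) :
    ∃ δ > 0, ∀ (A : E ≃ₗᵢ[ℝ] E) (b : E) (η : ℝ), η < δ → (∀ x, A x + b ∈ P ↔ x ∈ P) →
      (∀ x ∈ closure V, ‖A x + b - x‖ ≤ η) →
      ∀ x ∈ V, A x + b ∈ V → |u (A x + b) - u x| ≤ ε * η := by
  have hcd : ∀ x ∈ Ω, ContDiffAt ℝ 2 u x := fun x hx => hu2.contDiffAt (hΩ.mem_nhds hx)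
  have hopen : IsOpen (Ω ∩ (fun x => ‖fderiv ℝ u x‖) ⁻¹' Set.Iio ε) := by
    refine ContinuousOn.isOpen_inter_preimage ?_ hΩ isOpen_Iio
    exact fun x hx => ((hcd x hx).fderiv_right (m := 1) (by norm_num)).continuousAt.norm
      |>.continuousWithinAt
  obtain ⟨δ, hδ, hδS⟩ := hS.exists_thickening_subset_open hopen
    (fun x hx => ⟨hSΩ hx, by simp [hS0 x hx, hε]⟩)
  have hnear : ∀ x ∈ S, ∀ y, ‖y - x‖ < δ → |u y - u x| ≤ ε * ‖y - x‖ := by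
    intro x hx y hy
    have hb : Metric.ball x δ ⊆ Ω ∩ (fun x => ‖fderiv ℝ u x‖) ⁻¹' Set.Iio ε :=
      fun w hw => hδS (Metric.mem_thickening_iff.mpr ⟨x, hx, hw⟩)
    exact (convex_ball x δ).norm_image_sub_le_of_norm_fderiv_le (𝕜 := ℝ)
      (fun w hw => (hcd w (hb hw).1).differentiableAt (by norm_num))
      (fun w hw => (hb hw).2.le) (Metric.mem_ball_self hδ) (by rwa [mem_ball_iff_norm])
  refine ⟨δ, hδ, fun A b η hη hAP hdisp => ?_⟩
  set φ : E → E := fun y => A y + b with hφ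
  have hφc : Continuous φ := A.continuous.add continuous_const
  set W := V ∩ φ ⁻¹' V with hW
  have hWo : IsOpen W := hV.inter (hV.preimage hφc)
  have hclW : closure W ⊆ closure V := closure_mono Set.inter_subset_left
  have hclφ : Set.MapsTo φ (closure W) (closure V) :=
    Set.MapsTo.closure (fun y hy => hy.2) hφc
  have hclΩ : closure V ⊆ closure Ω := closure_mono hVΩ
  intro x hx hφx
  refine abs_sub_le_of_frontier hWo (hVb.subset Set.inter_subset_left) (H := H)
    (u := fun y => u (φ y)) (v := u) ?_ (fun y hy => hcd y (hVΩ hy.1)) ?_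
    (huc.mono (hclW.trans hclΩ)) (fun y hy => ?_) (fun y hy => hH y (hVΩ hy.1)) ?_ x ⟨hx, hφx⟩
  · intro y hy
    have hA : ContDiff ℝ 2 φ := A.contDiff.add contDiff_const
    exact (hcd _ (hVΩ hy.2)).comp y hA.contDiffAt
  · exact huc.comp hφc.continuousOn (fun y hy => hclΩ (hclφ hy))
  · exact IsCMCAt.comp_isometry A b (hcd _ (hVΩ hy.2)) (hH _ (hVΩ hy.2))
  · intro y hy
    have hycl : y ∈ closure V := hclW hy.1
    have hyφ : φ y ∈ closure V := hclφ hy.1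
    have hnot : y ∉ W := by
      have := hy.2
      rwa [hWo.interior_eq] at this
    have hd := hdisp y hycl
    have hη0 : 0 ≤ η := (norm_nonneg _).trans hd
    have hPcase : y ∈ P → |u (φ y) - u y| ≤ ε * η := by
      intro hyP
      rw [hP _ ((hAP y).mpr hyP), hP y hyP, sub_zero, abs_zero]
      positivity
    by_cases hyV : y ∈ V
    · have hφy : φ y ∈ frontier V := ⟨hyφ, by
        rw [hV.interior_eq]; exact fun h => hnot ⟨hyV, h⟩⟩
      rcases hfr hφy with h | h
      · have hd' : ‖y - φ y‖ ≤ η := by rw [norm_sub_rev]; exact hd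
        rw [abs_sub_comm]
        exact (hnear _ h y (hd'.trans_lt hη)).trans (by gcongr)
      · exact hPcase ((hAP y).mp h)
    · have hyf : y ∈ frontier V := ⟨hycl, by rwa [hV.interior_eq]⟩
      rcases hfr hyf with h | h
      · exact (hnear y h _ (hd.trans_lt hη)).trans (by gcongr)
      · exact hPcase h

/-- The infinitesimal version of `exists_forall_abs_sub_le`: `u` is invariant under the generator
of a family of isometries preserving `P`. -/
theorem fderiv_apply_eq_zero_of_family [Nontrivial E] {Ω V S P : Set E} {H : ℝ} {u : E → ℝ}
    (hΩ : IsOpen Ω) (hV : IsOpen V) (hVb : Bornology.IsBounded V) (hVΩ : V ⊆ Ω)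
    (hu2 : ContDiffOn ℝ 2 u Ω) (huc : ContinuousOn u (closure Ω)) (hH : ∀ x ∈ Ω, IsCMCAt H u x)
    (hS : IsCompact S) (hSΩ : S ⊆ Ω) (hS0 : ∀ x ∈ S, fderiv ℝ u x = 0) (hP : ∀ x ∈ P, u x = 0)
    (hfr : frontier V ⊆ S ∪ P) (A : ℝ → E ≃ₗᵢ[ℝ] E) (b : ℝ → E)
    (hAP : ∀ t x, A t x + b t ∈ P ↔ x ∈ P) {C : ℝ}
    (hC : ∀ t, ∀ x ∈ closure V, ‖A t x + b t - x‖ ≤ C * |t|) {x w : E} (hx : x ∈ V)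
    (hw : HasDerivAt (fun t => A t x + b t) w 0) : fderiv ℝ u x w = 0 := by
  have h0 : A 0 x + b 0 = x := by
    have := hC 0 x (subset_closure hx)
    rw [abs_zero, mul_zero] at this
    exact sub_eq_zero.mp (norm_le_zero_iff.mp this)
  have hdu : HasFDerivAt u (fderiv ℝ u x) (A 0 x + b 0) := by
    rw [h0]
    exact ((hu2.contDiffAt (hΩ.mem_nhds (hVΩ hx))).differentiableAt (by norm_num)).hasFDerivAt
  have hd1 : HasDerivAt (fun t => u (A t x + b t)) (fderiv ℝ u x w) 0 :=
    hdu.comp_hasDerivAt (0 : ℝ) hw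
  refine hd1.unique ?_
  rw [hasDerivAt_iff_isLittleO]
  rw [Asymptotics.isLittleO_iff]
  intro κ hκ
  set C' := max C 1 with hC'
  have hC'0 : 0 < C' := lt_max_of_lt_right one_pos
  obtain ⟨δ, hδ, h⟩ := exists_forall_abs_sub_le hΩ hV hVb hVΩ hu2 huc hH hS hSΩ hS0 hP hfr
    (div_pos hκ hC'0)
  have hin : ∀ᶠ t in 𝓝 (0 : ℝ), A t x + b t ∈ V :=
    hw.continuousAt.eventually (hV.mem_nhds (by simpa only [h0] using hx))
  have hsmall : ∀ᶠ t in 𝓝 (0 : ℝ), C' * |t| < δ := by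
    have : ContinuousAt (fun t : ℝ => C' * |t|) 0 := by fun_prop
    exact this.eventually (Iio_mem_nhds (by simpa using hδ))
  filter_upwards [hin, hsmall] with t ht1 ht2
  have := h (A t) (b t) (C' * |t|) ht2 (hAP t)
    (fun y hy => (hC t y hy).trans (by gcongr; exact le_max_left _ _)) x hx ht1
  rw [h0]
  simp only [sub_zero, smul_zero, Real.norm_eq_abs]
  refine this.trans (le_of_eq ?_)
  field_simp

/-- Rotation of angle `2 * t` in the plane spanned by the orthonormal vectors `e` and `f`. -/
def planeRotation (e f : E) (t : ℝ) : E ≃ₗᵢ[ℝ] E :=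
  (Submodule.reflection (ℝ ∙ e)).trans
    (Submodule.reflection (ℝ ∙ (Real.cos t • e + Real.sin t • f)))

variable {e f : E}

omit [FiniteDimensional ℝ E] in
theorem norm_cos_smul_add_sin_smul (he : ‖e‖ = 1) (hf : ‖f‖ = 1) (hef : inner ℝ e f = 0) (t : ℝ) :
    ‖Real.cos t • e + Real.sin t • f‖ = 1 := by
  have h : ‖Real.cos t • e + Real.sin t • f‖ ^ 2 = 1 := by
    rw [norm_add_sq_real]
    simp only [norm_smul, he, hf, inner_smul_left, inner_smul_right, hef, Real.norm_eq_abs]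
    simp
  have := norm_nonneg (Real.cos t • e + Real.sin t • f)
  nlinarith

omit [FiniteDimensional ℝ E] in
theorem reflection_unit_apply (he : ‖e‖ = 1) (w : E) :
    Submodule.reflection (ℝ ∙ e) w = (2 * inner ℝ e w) • e - w := by
  rw [Submodule.reflection_singleton_apply]
  simp [he, two_smul, two_mul, add_smul]

omit [FiniteDimensional ℝ E] in
theorem norm_planeRotation_sub_le (he : ‖e‖ = 1) (hf : ‖f‖ = 1) (hef : inner ℝ e f = 0)
    (t : ℝ) (w : E) : ‖planeRotation e f t w - w‖ ≤ 8 * |t| * ‖w‖ := by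
  set e' := Real.cos t • e + Real.sin t • f with he'
  have hn : ‖e'‖ = 1 := norm_cos_smul_add_sin_smul he hf hef t
  set y := Submodule.reflection (ℝ ∙ e) w with hy
  have hyw : ‖y‖ = ‖w‖ := LinearIsometryEquiv.norm_map _ _
  have hw : w = Submodule.reflection (ℝ ∙ e) y := by
    rw [hy, Submodule.reflection_reflection]
  have h1 : planeRotation e f t w - w =
      (2 * inner ℝ (e' - e) y) • e' + (2 * inner ℝ e y) • (e' - e) := by
    have : planeRotation e f t w = Submodule.reflection (ℝ ∙ e') y := rfl
    rw [this]
    conv_lhs => rw [hw]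
    rw [reflection_unit_apply hn, reflection_unit_apply he, inner_sub_left]
    module
  have hdiff : ‖e' - e‖ ≤ 2 * |t| := by
    have : e' - e = (Real.cos t - 1) • e + Real.sin t • f := by rw [he']; module
    rw [this]
    refine (norm_add_le _ _).trans ?_
    rw [norm_smul, norm_smul, he, hf, Real.norm_eq_abs, Real.norm_eq_abs]
    have h2 : |Real.sin t| ≤ |t| := Real.abs_sin_le_abs
    have h3 : |Real.cos t - 1| ≤ |t| := by
      have := Real.abs_cos_sub_cos_le t 0
      simpa using this
    linarith
  rw [h1]
  refine (norm_add_le _ _).trans ?_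
  rw [norm_smul, norm_smul, hn, Real.norm_eq_abs, Real.norm_eq_abs, abs_mul, abs_mul, abs_two]
  have h2 : |inner ℝ (e' - e) y| ≤ 2 * |t| * ‖w‖ :=
    (abs_real_inner_le_norm _ _).trans (by rw [hyw]; gcongr)
  have h3 : |inner ℝ e y| ≤ ‖w‖ := by simpa [he, hyw] using abs_real_inner_le_norm e y
  have h4 : |inner ℝ e y| * ‖e' - e‖ ≤ ‖w‖ * (2 * |t|) := by gcongr
  nlinarith

omit [FiniteDimensional ℝ E] in
theorem planeRotation_apply_left (he : ‖e‖ = 1) (hf : ‖f‖ = 1) (hef : inner ℝ e f = 0)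
    (t : ℝ) : planeRotation e f t e = Real.cos (2 * t) • e + Real.sin (2 * t) • f := by
  have hn := norm_cos_smul_add_sin_smul he hf hef t
  have h0 : Submodule.reflection (ℝ ∙ e) e = e :=
    Submodule.reflection_mem_subspace_eq_self (Submodule.mem_span_singleton_self e)
  have : planeRotation e f t e =
    Submodule.reflection (ℝ ∙ (Real.cos t • e + Real.sin t • f))
      (Submodule.reflection (ℝ ∙ e) e) := rfl
  have hfe : inner ℝ f e = 0 := by rw [real_inner_comm]; exact hef
  rw [this, h0, reflection_unit_apply hn, inner_add_left, inner_smul_left, inner_smul_left,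
    real_inner_self_eq_norm_sq, he, hfe, Real.cos_two_mul, Real.sin_two_mul]
  simp only [conj_trivial]
  module

/-- If `∇u` vanishes on the free part `S` of the frontier of `V`, and `u` vanishes on the remaining
part, contained in a sphere centred at `c`, then `∇u` is radial with respect to `c` in `V`. -/
theorem fderiv_apply_eq_zero_of_inner_eq_zero [Nontrivial E] {Ω V S : Set E} {H : ℝ} {u : E → ℝ}
    {c : E} {r : ℝ}
    (hΩ : IsOpen Ω) (hV : IsOpen V) (hVb : Bornology.IsBounded V) (hVΩ : V ⊆ Ω)
    (hu2 : ContDiffOn ℝ 2 u Ω) (huc : ContinuousOn u (closure Ω)) (hH : ∀ x ∈ Ω, IsCMCAt H u x)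
    (hS : IsCompact S) (hSΩ : S ⊆ Ω) (hS0 : ∀ x ∈ S, fderiv ℝ u x = 0)
    (hP : ∀ x ∈ Metric.sphere c r, u x = 0)
    (hfr : frontier V ⊆ S ∪ Metric.sphere c r) {x w : E} (hx : x ∈ V) (hxc : x ≠ c)
    (hw : inner ℝ (x - c) w = 0) : fderiv ℝ u x w = 0 := by
  by_cases hw0 : w = 0
  · simp [hw0]
  have hr0 : ‖x - c‖ ≠ 0 := norm_ne_zero_iff.mpr (sub_ne_zero.mpr hxc)
  have hwn : ‖w‖ ≠ 0 := norm_ne_zero_iff.mpr hw0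
  set e := ‖x - c‖⁻¹ • (x - c) with he
  set f := ‖w‖⁻¹ • w with hf
  have hen : ‖e‖ = 1 := by rw [he, norm_smul, norm_inv, norm_norm, inv_mul_cancel₀ hr0]
  have hfn : ‖f‖ = 1 := by rw [hf, norm_smul, norm_inv, norm_norm, inv_mul_cancel₀ hwn]
  have hef : inner ℝ e f = 0 := by rw [he, hf, inner_smul_left, inner_smul_right, hw]; simp
  have hxe : x - c = ‖x - c‖ • e := by rw [he, smul_smul, mul_inv_cancel₀ hr0, one_smul]
  have hwf : w = ‖w‖ • f := by rw [hf, smul_smul, mul_inv_cancel₀ hwn, one_smul]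
  obtain ⟨M, hM⟩ := hVb.closure.exists_norm_le
  have hform : ∀ t y, planeRotation e f t y + (c - planeRotation e f t c) =
      planeRotation e f t (y - c) + c := fun t y => by rw [map_sub]; abel
  have key := fderiv_apply_eq_zero_of_family hΩ hV hVb hVΩ hu2 huc hH hS hSΩ hS0 hP hfr
    (planeRotation e f) (fun t => c - planeRotation e f t c) (C := 8 * (M + ‖c‖))
    (x := x) (w := (2 * ‖x - c‖) • f) ?_ ?_ hx ?_
  · rw [map_smul, smul_eq_mul] at key
    have hfz : fderiv ℝ u x f = 0 := by
      rcases mul_eq_zero.mp key with h | h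
      · exact absurd h (mul_ne_zero two_ne_zero hr0)
      · exact h
    rw [hwf, map_smul, hfz, smul_zero]
  · intro t y
    rw [hform, mem_sphere_iff_norm, mem_sphere_iff_norm, add_sub_cancel_right,
      LinearIsometryEquiv.norm_map]
  · intro t y hy
    rw [hform]
    have h1 := norm_planeRotation_sub_le hen hfn hef t (y - c)
    have h2 : planeRotation e f t (y - c) + c - y = planeRotation e f t (y - c) - (y - c) := by
      abel
    have h3 : ‖y - c‖ ≤ M + ‖c‖ := (norm_sub_le _ _).trans (by gcongr; exact hM y hy)
    rw [h2]
    refine h1.trans ?_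
    have := mul_le_mul_of_nonneg_left h3 (abs_nonneg t)
    nlinarith
  · have h1 : (fun t => planeRotation e f t x + (c - planeRotation e f t c)) =
        fun t => ‖x - c‖ • (Real.cos (2 * t) • e + Real.sin (2 * t) • f) + c := by
      ext1 t
      rw [hform, ← planeRotation_apply_left hen hfn hef, ← map_smul, ← hxe]
    rw [h1]
    have h2 : HasDerivAt (fun t : ℝ => 2 * t) 2 0 := by
      simpa using (hasDerivAt_id (0 : ℝ)).const_mul 2
    have h3 := ((((h2.cos).smul_const e).add ((h2.sin).smul_const f)).const_smul ‖x - c‖).add_const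
      c
    refine h3.congr_deriv ?_
    simp [smul_smul, mul_comm]

/-- If `∇u` vanishes on the frontier of `V` then it vanishes in `V`. -/
theorem fderiv_eq_zero_of_frontier [Nontrivial E] {Ω V : Set E} {H : ℝ} {u : E → ℝ}
    (hΩ : IsOpen Ω) (hV : IsOpen V) (hVb : Bornology.IsBounded V) (hVΩ : closure V ⊆ Ω)
    (hu2 : ContDiffOn ℝ 2 u Ω) (huc : ContinuousOn u (closure Ω)) (hH : ∀ x ∈ Ω, IsCMCAt H u x)
    (h0 : ∀ x ∈ frontier V, fderiv ℝ u x = 0) {x : E} (hx : x ∈ V) : fderiv ℝ u x = 0 := by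
  ext w
  refine fderiv_apply_eq_zero_of_family hΩ hV hVb (subset_closure.trans hVΩ) hu2 huc hH
    (S := frontier V) (P := ∅)
    (hVb.isCompact_closure.of_isClosed_subset isClosed_frontier frontier_subset_closure)
    (frontier_subset_closure.trans hVΩ) h0 (by simp) (by simp)
    (fun _ => LinearIsometryEquiv.refl ℝ E) (fun t => t • w) (by simp) (C := ‖w‖) ?_ hx ?_
  · intro t y _
    simp [norm_smul, mul_comm]
  · simpa using ((hasDerivAt_id (0 : ℝ)).smul_const w).const_add x

end IsometryFamilies

section Annulus

variable {E : Type*} [NormedAddCommGroup E] [InnerProductSpace ℝ E] [FiniteDimensional ℝ E]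

theorem HasDerivAt.eq_zero_of_eventually_nhdsGT {g : ℝ → ℝ} {d t₀ : ℝ} (hg : HasDerivAt g d t₀)
    (h : ∀ᶠ t in 𝓝[>] t₀, g t = 0) : d = 0 := by
  have h0 : g t₀ = 0 := by
    have h1 : Tendsto g (𝓝[>] t₀) (𝓝 (g t₀)) := hg.continuousAt.tendsto.mono_left nhdsWithin_le_nhds
    have h2 : Tendsto g (𝓝[>] t₀) (𝓝 0) := tendsto_const_nhds.congr' (h.mono fun t ht => ht.symm)
    exact tendsto_nhds_unique h1 h2
  have h3 : HasDerivWithinAt g 0 (Set.Ioi t₀) t₀ :=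
    (hasDerivWithinAt_const t₀ _ (0 : ℝ)).congr_of_eventuallyEq h h0
  exact (uniqueDiffWithinAt_Ioi t₀).eq_deriv _ hg.hasDerivWithinAt h3

theorem IsCMCAt.eq_zero {H : ℝ} {u : E → ℝ} {x : E} (h : IsCMCAt H u x)
    (h1 : fderiv ℝ u x = 0) (h2 : fderiv ℝ (fderiv ℝ u) x = 0) : H = 0 := by
  have hg : gradient u x = 0 := by rw [← norm_eq_zero, norm_gradient, h1, norm_zero]
  unfold IsCMCAt at h
  rw [hg, h2] at h
  simpa [mcForm, formTrace] using h.symm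

/-- A solution of the minimal surface equation with zero boundary values vanishes. -/
theorem eq_zero_of_isCMCAt_zero [Nontrivial E] {Ω : Set E} {u : E → ℝ} (hΩ : IsOpen Ω)
    (hb : Bornology.IsBounded Ω) (hu2 : ContDiffOn ℝ 2 u Ω) (huc : ContinuousOn u (closure Ω))
    (hH : ∀ x ∈ Ω, IsCMCAt 0 u x) (h0 : ∀ x ∈ frontier Ω, u x = 0) {x : E} (hx : x ∈ Ω) :
    u x = 0 := by
  have := abs_sub_le_of_frontier hΩ hb (H := 0) (u := u) (v := fun _ => 0) (m := 0)
    (fun x hx => hu2.contDiffAt (hΩ.mem_nhds hx)) (fun _ _ => contDiffAt_const) huc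
    continuousOn_const hH (fun y _ => by simp [IsCMCAt, mcForm, formTrace])
    (fun y hy => by simp [h0 y hy]) x hx
  simpa using this

omit [FiniteDimensional ℝ E] in
theorem exists_unit_inner_eq_zero (hdim : 3 ≤ Module.finrank ℝ E) (x y : E) :
    ∃ f : E, ‖f‖ = 1 ∧ inner ℝ x f = 0 ∧ inner ℝ y f = 0 := by
  classical
  set W := Submodule.span ℝ ((({x, y} : Finset E)) : Set E) with hW
  have hne : Wᗮ ≠ ⊥ := by
    rw [Ne, Submodule.orthogonal_eq_bot_iff]
    intro h
    have h1 : Module.finrank ℝ W ≤ ({x, y} : Finset E).card := finrank_span_finset_le_card _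
    have h2 : ({x, y} : Finset E).card ≤ 2 := Finset.card_le_two
    rw [h, finrank_top] at h1
    omega
  obtain ⟨f, hf, hf0⟩ := Submodule.exists_mem_ne_zero_of_ne_bot hne
  have hfn : ‖f‖ ≠ 0 := norm_ne_zero_iff.mpr hf0
  have hx : x ∈ W := Submodule.subset_span (by simp)
  have hy : y ∈ W := Submodule.subset_span (by simp)
  refine ⟨‖f‖⁻¹ • f, by rw [norm_smul, norm_inv, norm_norm, inv_mul_cancel₀ hfn], ?_, ?_⟩
  · rw [inner_smul_right, (Submodule.mem_orthogonal W f).mp hf x hx, mul_zero]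
  · rw [inner_smul_right, (Submodule.mem_orthogonal W f).mp hf y hy, mul_zero]

omit [FiniteDimensional ℝ E] in
/-- A function with radial gradient along a sphere is constant on it. -/
theorem eq_of_norm_eq_of_radial (hdim : 3 ≤ Module.finrank ℝ E) {u : E → ℝ} {r : ℝ}
    (hd : ∀ x, ‖x‖ = r → DifferentiableAt ℝ u x)
    (hrad : ∀ x, ‖x‖ = r → ∀ w, inner ℝ x w = 0 → fderiv ℝ u x w = 0) {x y : E}
    (hx : ‖x‖ = r) (hy : ‖y‖ = r) : u x = u y := by
  have perp : ∀ x y : E, ‖x‖ = r → ‖y‖ = r → inner ℝ x y = 0 → u x = u y := by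
    intro x y hx hy hxy
    set γ : ℝ → E := fun t => Real.cos t • x + Real.sin t • y with hγ
    set γ' : ℝ → E := fun t => -Real.sin t • x + Real.cos t • y with hγ'
    have hyx : inner ℝ y x = 0 := by rw [real_inner_comm]; exact hxy
    have hdγ : ∀ t, HasDerivAt γ (γ' t) t := fun t =>
      ((Real.hasDerivAt_cos t).smul_const x).add ((Real.hasDerivAt_sin t).smul_const y)
    have hn : ∀ t, ‖γ t‖ = r := by
      intro t
      have h1 : ‖γ t‖ ^ 2 = r ^ 2 := by
        rw [hγ, norm_add_sq_real]
        simp only [norm_smul, hx, hy, inner_smul_left, inner_smul_right, hxy, Real.norm_eq_abs,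
          mul_pow, sq_abs, mul_zero, add_zero]
        linear_combination r ^ 2 * Real.sin_sq_add_cos_sq t
      exact (sq_eq_sq₀ (norm_nonneg _) (hx ▸ norm_nonneg _)).mp h1
    have ho : ∀ t, inner ℝ (γ t) (γ' t) = 0 := by
      intro t
      simp only [hγ, hγ', inner_add_left, inner_add_right, inner_smul_left, inner_smul_right, hxy,
        hyx, real_inner_self_eq_norm_sq, hx, hy, conj_trivial]
      ring
    have hdu : ∀ t, HasDerivAt (fun t => u (γ t)) 0 t := fun t =>
      ((hd _ (hn t)).hasFDerivAt.comp_hasDerivAt t (hdγ t)).congr_deriv (hrad _ (hn t) _ (ho t))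
    have := is_const_of_deriv_eq_zero (fun t => (hdu t).differentiableAt)
      (fun t => (hdu t).deriv) 0 (Real.pi / 2)
    simpa [hγ] using this
  obtain ⟨f, hf, hxf, hyf⟩ := exists_unit_inner_eq_zero hdim x y
  have hr : 0 ≤ r := hx ▸ norm_nonneg _
  have hrf : ‖r • f‖ = r := by rw [norm_smul, hf, Real.norm_eq_abs, abs_of_nonneg hr, mul_one]
  rw [perp x (r • f) hx hrf (by rw [inner_smul_right, hxf, mul_zero]),
    perp y (r • f) hy hrf (by rw [inner_smul_right, hyf, mul_zero])]

omit [FiniteDimensional ℝ E] in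
/-- If `∇u` is radial in the shell `s < |x| < R` and vanishes at one point of the inner sphere,
then it vanishes on the whole inner sphere. -/
theorem fderiv_eq_zero_on_sphere (hdim : 3 ≤ Module.finrank ℝ E) {u : E → ℝ} {s R : ℝ}
    (hs : 0 < s) (hsR : s < R) (hu : ∀ x, s ≤ ‖x‖ → ‖x‖ < R → ContDiffAt ℝ 2 u x)
    (hrad : ∀ x, s < ‖x‖ → ‖x‖ < R → ∀ w, inner ℝ x w = 0 → fderiv ℝ u x w = 0)
    {x₀ y : E} (hx₀ : ‖x₀‖ = s) (h0 : fderiv ℝ u x₀ = 0) (hy : ‖y‖ = s) : fderiv ℝ u y = 0 := by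
  have hshell : ∀ᶠ t in 𝓝[>] (1 : ℝ), ∀ x : E, ‖x‖ = s → s < ‖t • x‖ ∧ ‖t • x‖ < R := by
    have h1 : Set.Ioo (1 : ℝ) (R / s) ∈ 𝓝[>] (1 : ℝ) :=
      Ioo_mem_nhdsGT ((one_lt_div hs).mpr hsR)
    filter_upwards [h1] with t ht x hx
    have ht0 : 0 < t := one_pos.trans ht.1
    rw [norm_smul, hx, Real.norm_eq_abs, abs_of_pos ht0]
    exact ⟨by nlinarith [ht.1], (lt_div_iff₀ hs).mp ht.2⟩
  have hdiff : ∀ x : E, ‖x‖ = s → HasDerivAt (fun t : ℝ => u (t • x)) (fderiv ℝ u x x) 1 := by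
    intro x hx
    have h1 : HasFDerivAt u (fderiv ℝ u x) ((1 : ℝ) • x) := by
      rw [one_smul]
      exact ((hu x hx.ge (hx.trans_lt hsR)).differentiableAt (by norm_num)).hasFDerivAt
    have h2 : HasDerivAt (fun t : ℝ => t • x) x 1 := by
      simpa using (hasDerivAt_id (1 : ℝ)).smul_const x
    exact h1.comp_hasDerivAt (1 : ℝ) h2
  have hradial : fderiv ℝ u y y = 0 := by
    have h1 := (hdiff y hy).sub (hdiff x₀ hx₀)
    have h2 := h1.eq_zero_of_eventually_nhdsGT ?_
    · simpa [h0] using h2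
    · filter_upwards [hshell] with t ht
      have h3 := ht x₀ hx₀
      have h4 : ‖t • y‖ = ‖t • x₀‖ := by rw [norm_smul, norm_smul, hx₀, hy]
      have := eq_of_norm_eq_of_radial hdim (u := u) (r := ‖t • x₀‖)
        (fun x hx => (hu x (by rw [hx]; exact h3.1.le) (by rw [hx]; exact h3.2)).differentiableAt
          (by norm_num))
        (fun x hx => hrad x (by rw [hx]; exact h3.1) (by rw [hx]; exact h3.2)) h4 rfl
      exact sub_eq_zero.mpr this
  have htan : ∀ w, inner ℝ y w = 0 → fderiv ℝ u y w = 0 := by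
    intro w hw
    have hc : ContinuousAt (fderiv ℝ u) ((1 : ℝ) • y) := by
      rw [one_smul]
      exact ((hu y hy.ge (hy.trans_lt hsR)).fderiv_right (m := 1) (by norm_num)).continuousAt
    have hc2 : ContinuousAt (fun t : ℝ => t • y) 1 := by fun_prop
    have h1 : ContinuousAt (fun t : ℝ => fderiv ℝ u (t • y) w) 1 :=
      (ContinuousAt.comp (f := fun t : ℝ => t • y) hc hc2).clm_apply continuousAt_const
    have h2 : Tendsto (fun t : ℝ => fderiv ℝ u (t • y) w) (𝓝[>] 1) (𝓝 0) := by
      refine tendsto_const_nhds.congr' ?_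
      filter_upwards [hshell] with t ht
      obtain ⟨h3, h4⟩ := ht y hy
      exact (hrad _ h3 h4 w (by rw [inner_smul_left, hw, mul_zero])).symm
    have h3 := tendsto_nhds_unique (h1.tendsto.mono_left nhdsWithin_le_nhds) h2
    simpa using h3
  ext w
  have hys : inner ℝ y y = s ^ 2 := by rw [real_inner_self_eq_norm_sq, hy]
  have hdec : w = (inner ℝ y w / s ^ 2) • y + (w - (inner ℝ y w / s ^ 2) • y) := by abel
  rw [hdec, map_add, map_smul, hradial, htan _ ?_]
  · simp
  · rw [inner_sub_right, inner_smul_right, hys]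
    field_simp
    ring

/-- A constant mean curvature graph whose gradient vanishes on a sphere centred at `0` and is
radial with respect to another point `z` inside that sphere is minimal. -/
theorem eq_zero_of_radial_of_sphere (hdim : 3 ≤ Module.finrank ℝ E) {V : Set E} {u : E → ℝ}
    {H s : ℝ} {z : E} (hs : 0 < s) (hz : z ≠ 0) (hu : ∀ x, ‖x‖ = s → ContDiffAt ℝ 2 u x)
    (hH : ∀ x, ‖x‖ = s → IsCMCAt H u x) (h0 : ∀ x, ‖x‖ = s → fderiv ℝ u x = 0)
    (hV : ∀ x, ‖x‖ = s → ∀ᶠ t in 𝓝[>] (0 : ℝ), x - t • x ∈ V)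
    (hrad : ∀ x ∈ V, x ≠ z → ∀ w, inner ℝ (x - z) w = 0 → fderiv ℝ u x w = 0) : H = 0 := by
  obtain ⟨f, hf, hzf, -⟩ := exists_unit_inner_eq_zero hdim z z
  have hfz : inner ℝ f z = 0 := by rw [real_inner_comm]; exact hzf
  set q : E := s • f with hq
  have hqn : ‖q‖ = s := by rw [hq, norm_smul, hf, Real.norm_eq_abs, abs_of_pos hs, mul_one]
  have huq := hu q hqn
  have hD : HasFDerivAt (fderiv ℝ u) (fderiv ℝ (fderiv ℝ u) q) q :=
    ((huq.fderiv_right (m := 1) (by norm_num)).differentiableAt (by norm_num)).hasFDerivAt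
  set B := fderiv ℝ (fderiv ℝ u) q with hB
  have hsymm : ∀ v w, B v w = B w v := huq.isSymmSndFDerivAt (by simp)
  -- the gradient vanishes along the sphere
  have htan_unit : ∀ w, ‖w‖ = 1 → inner ℝ f w = 0 → B w = 0 := by
    intro w hw hfw
    set γ : ℝ → E := fun t => s • (Real.cos t • f + Real.sin t • w) with hγ
    have hγn : ∀ t, ‖γ t‖ = s := fun t => by
      rw [hγ, norm_smul, norm_cos_smul_add_sin_smul hf hw hfw, Real.norm_eq_abs, abs_of_pos hs,
        mul_one]
    have hγ0 : γ 0 = q := by simp [hγ, hq]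
    have hγd : HasDerivAt γ (s • w) 0 := by
      have := (((Real.hasDerivAt_cos 0).smul_const f).add
        ((Real.hasDerivAt_sin 0).smul_const w)).const_smul s
      exact this.congr_deriv (by simp)
    have h1 : HasDerivAt (fun t => fderiv ℝ u (γ t)) (B (s • w)) 0 :=
      HasFDerivAt.comp_hasDerivAt (0 : ℝ) (by rw [hγ0]; exact hD) hγd
    have h2 : (fun t => fderiv ℝ u (γ t)) = fun _ => 0 := funext fun t => h0 _ (hγn t)
    rw [h2] at h1
    have h3 := h1.unique (hasDerivAt_const (0 : ℝ) _)
    rw [map_smul] at h3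
    exact (smul_eq_zero.mp h3).resolve_left hs.ne'
  have htan : ∀ w, inner ℝ f w = 0 → B w = 0 := by
    intro w hfw
    by_cases hw : w = 0
    · simp [hw]
    have hwn : ‖w‖ ≠ 0 := norm_ne_zero_iff.mpr hw
    have h1 := htan_unit (‖w‖⁻¹ • w) (by rw [norm_smul, norm_inv, norm_norm, inv_mul_cancel₀ hwn])
      (by rw [inner_smul_right, hfw, mul_zero])
    rw [map_smul] at h1
    exact (smul_eq_zero.mp h1).resolve_left (inv_ne_zero hwn)
  -- the gradient is radial with respect to `z`
  set T : E →L[ℝ] E := (innerSL ℝ f).smulRight z - (innerSL ℝ z).smulRight f with hT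
  have hTapp : ∀ w, T w = (inner ℝ f w : ℝ) • z - (inner ℝ z w : ℝ) • f := fun w => by simp [hT]
  have hTskew : ∀ w, inner ℝ w (T w) = 0 := fun w => by
    rw [hTapp, inner_sub_right, inner_smul_right, inner_smul_right, real_inner_comm w z,
      real_inner_comm w f]
    ring
  have hrot : B q (T (q - z)) = 0 := by
    have hline : HasDerivAt (fun t : ℝ => q - t • q) (-q) 0 := by
      simpa using ((hasDerivAt_id (0 : ℝ)).smul_const q).const_sub q
    have h1 : HasDerivAt (fun t : ℝ => fderiv ℝ u (q - t • q)) (B (-q)) 0 :=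
      HasFDerivAt.comp_hasDerivAt (0 : ℝ) (by simpa using hD) hline
    have h2 : HasDerivAt (fun t : ℝ => T (q - t • q - z)) (T (-q)) 0 :=
      T.hasFDerivAt.comp_hasDerivAt (0 : ℝ) (hline.sub_const z)
    have h3 := (h1.clm_apply h2).eq_zero_of_eventually_nhdsGT ?_
    · have h4 : B q (T z) - B q (T q) = 0 := by simpa [h0 q hqn] using h3
      rw [map_sub, map_sub]
      linarith
    · filter_upwards [hV q hqn] with t ht
      by_cases hc : q - t • q = z
      · rw [hc, sub_self, map_zero, map_zero]
      · exact hrad _ ht hc _ (hTskew _)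
  have hzB : B f z = 0 := by rw [hsymm, htan z hfz]; simp
  have hBff : B f f = 0 := by
    have h1 : T (q - z) = s • z + (‖z‖ ^ 2) • f := by
      rw [hTapp, hq, inner_sub_right, inner_sub_right, inner_smul_right, inner_smul_right,
        real_inner_self_eq_norm_sq, real_inner_self_eq_norm_sq, hf, hfz, hzf]
      simp [sub_neg_eq_add]
    rw [h1, hq, map_smul, smul_apply, map_add, map_smul, map_smul, hzB] at hrot
    simpa [hs.ne', hz] using hrot
  have hBf : B f = 0 := by
    ext w
    have hdec : w = (inner ℝ f w : ℝ) • f + (w - (inner ℝ f w : ℝ) • f) := by abel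
    have h1 : B (w - (inner ℝ f w : ℝ) • f) = 0 := htan _ (by
      rw [inner_sub_right, inner_smul_right, real_inner_self_eq_norm_sq, hf]; ring)
    rw [hdec, map_add, map_smul, hBff, hsymm f, h1]
    simp
  refine (hH q hqn).eq_zero (h0 q hqn) ?_
  rw [← hB]
  ext1 w
  have hdec : w = (inner ℝ f w : ℝ) • f + (w - (inner ℝ f w : ℝ) • f) := by abel
  have h1 : B (w - (inner ℝ f w : ℝ) • f) = 0 := htan _ (by
    rw [inner_sub_right, inner_smul_right, real_inner_self_eq_norm_sq, hf]; ring)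
  rw [hdec, map_add, map_smul, hBf, h1]
  simp

omit [FiniteDimensional ℝ E] in
theorem sphere_subset_frontier_annulus [Nontrivial E] {z : E} {ρ R : ℝ} (hR : 0 < R)
    (hsub : Metric.closedBall z ρ ⊆ Metric.ball (0 : E) R) :
    Metric.sphere (0 : E) R ⊆ frontier (Metric.ball (0 : E) R \ Metric.closedBall z ρ) := by
  intro x hx
  have hxR : x ∉ Metric.ball (0 : E) R := fun h => (Metric.mem_ball.mp h).ne hx
  have hxc : x ∈ (Metric.closedBall z ρ)ᶜ := fun h => hxR (hsub h)
  refine ⟨?_, fun h => hxR (interior_subset h).1⟩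
  rw [Set.sdiff_eq, Set.inter_comm]
  refine Metric.isClosed_closedBall.isOpen_compl.inter_closure ⟨hxc, ?_⟩
  rw [closure_ball _ hR.ne']
  exact Metric.sphere_subset_closedBall hx

omit [FiniteDimensional ℝ E] in
theorem inner_sphere_subset_frontier_annulus [Nontrivial E] {z : E} {ρ R : ℝ} (hρ : 0 < ρ)
    (hsub : Metric.closedBall z ρ ⊆ Metric.ball (0 : E) R) :
    Metric.sphere z ρ ⊆ frontier (Metric.ball (0 : E) R \ Metric.closedBall z ρ) := by
  intro x hx
  have hxc : x ∈ Metric.closedBall z ρ := Metric.sphere_subset_closedBall hx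
  refine ⟨?_, fun h => (interior_subset h).2 hxc⟩
  rw [Set.sdiff_eq]
  refine Metric.isOpen_ball.inter_closure ⟨hsub hxc, ?_⟩
  rw [closure_compl, interior_closedBall _ hρ.ne']
  exact fun h => (Metric.mem_ball.mp h).ne hx

omit [InnerProductSpace ℝ E] [FiniteDimensional ℝ E] in
theorem frontier_ball_diff_closedBall_subset (c z : E) (s ρ : ℝ) :
    frontier (Metric.ball c s \ Metric.closedBall z ρ) ⊆ Metric.sphere c s ∪ Metric.sphere z ρ := by
  rw [Set.sdiff_eq]
  refine (frontier_inter_subset _ _).trans ?_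
  rw [frontier_compl]
  exact Set.union_subset_union (Set.inter_subset_left.trans Metric.frontier_ball_subset_sphere)
    (Set.inter_subset_right.trans Metric.frontier_closedBall_subset_sphere)

/-- An open set enclosing the inner ball of an eccentric annulus cannot have a frontier contained
in the critical set of a solution of the constant mean curvature equation, unless `H = 0`. -/
theorem eq_zero_of_enclosing (hdim : 3 ≤ Module.finrank ℝ E) {z : E} (hz : z ≠ 0) {ρ R : ℝ}
    (hρ : 0 < ρ) (hsub : Metric.closedBall z ρ ⊆ Metric.ball (0 : E) R) {Ω : Set E}
    (hΩ : Ω = Metric.ball (0 : E) R \ Metric.closedBall z ρ) {H : ℝ} {u : E → ℝ}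
    (hu2 : ContDiffOn ℝ 2 u Ω) (huc : ContinuousOn u (closure Ω)) (hH : ∀ x ∈ Ω, IsCMCAt H u x)
    (hbdry : ∀ x ∈ frontier Ω, u x = 0) {U : Set E} (hU : IsOpen U) (hfrΩ : frontier U ⊆ Ω)
    (hfr : ∀ x ∈ frontier U, fderiv ℝ u x = 0) (hzU : Metric.closedBall z ρ ⊆ U)
    (hUR : closure U ⊆ Metric.ball (0 : E) R) : H = 0 := by
  have hnt : Nontrivial E := Module.nontrivial_of_finrank_pos (R := ℝ) (by omega)
  have hΩo : IsOpen Ω := hΩ ▸ Metric.isOpen_ball.sdiff Metric.isClosed_closedBall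
  have hzz : z ∈ U := hzU (Metric.mem_closedBall_self hρ.le)
  have hUb : Bornology.IsBounded (closure U) := Metric.isBounded_ball.subset hUR
  have hUc : IsCompact (closure U) := Metric.isCompact_of_isClosed_isBounded isClosed_closure hUb
  obtain ⟨x₀, hx₀, hmax⟩ := hUc.exists_isMaxOn ⟨z, subset_closure hzz⟩ continuous_norm.continuousOn
  set s := ‖x₀‖ with hs_def
  have hle : ∀ x ∈ closure U, ‖x‖ ≤ s := fun x hx => hmax hx
  have hs : 0 < s := (norm_pos_iff.mpr hz).trans_le (hle z (subset_closure hzz))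
  have hsR : s < R := by simpa using hUR hx₀
  have hR : 0 < R := hs.trans hsR
  have hUs : U ⊆ Metric.ball (0 : E) s := by
    rw [← interior_closedBall _ hs.ne']
    exact interior_maximal (fun x hx => by simpa using hle x (subset_closure hx)) hU
  have hx₀fr : x₀ ∈ frontier U := by
    refine ⟨hx₀, ?_⟩
    rw [hU.interior_eq]
    intro h
    have := hUs h
    simp [← hs_def] at this
  have hshell : ∀ x, s ≤ ‖x‖ → ‖x‖ < R → x ∈ Ω := by
    intro x h1 h2
    rw [hΩ]
    refine ⟨by simpa using h2, fun h => ?_⟩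
    have := hUs (hzU h)
    simp only [mem_ball_zero_iff] at this
    linarith
  have hcd : ∀ x, s ≤ ‖x‖ → ‖x‖ < R → ContDiffAt ℝ 2 u x := fun x h1 h2 =>
    hu2.contDiffAt (hΩo.mem_nhds (hshell x h1 h2))
  -- outer region
  set O := Metric.ball (0 : E) R \ closure U with hO
  have hOΩ : O ⊆ Ω := by
    rw [hΩ]
    exact Set.sdiff_subset_sdiff_right (hzU.trans subset_closure)
  have hOfr : frontier O ⊆ frontier U ∪ Metric.sphere (0 : E) R := by
    rw [hO, Set.sdiff_eq, Set.union_comm]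
    refine (frontier_inter_subset _ _).trans ?_
    rw [frontier_compl]
    exact Set.union_subset_union (Set.inter_subset_left.trans Metric.frontier_ball_subset_sphere)
      (Set.inter_subset_right.trans frontier_closure_subset)
  have houter : ∀ x, s < ‖x‖ → ‖x‖ < R → ∀ w, inner ℝ x w = 0 → fderiv ℝ u x w = 0 := by
    intro x h1 h2 w hw
    refine fderiv_apply_eq_zero_of_inner_eq_zero (c := 0) (r := R) hΩo
      (Metric.isOpen_ball.sdiff isClosed_closure) (Metric.isBounded_ball.subset Set.sdiff_subset)
      hOΩ hu2 huc hH (hUc.of_isClosed_subset isClosed_frontier frontier_subset_closure) hfrΩ hfr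
      (fun y hy => hbdry y (hΩ ▸ sphere_subset_frontier_annulus hR hsub hy)) hOfr ?_ ?_ ?_
    · exact ⟨by simpa using h2, fun h => (hle x h).not_gt h1⟩
    · exact norm_pos_iff.mp (hs.trans h1)
    · simpa using hw
  have hsphere : ∀ y, ‖y‖ = s → fderiv ℝ u y = 0 := fun y hy =>
    fderiv_eq_zero_on_sphere hdim hs hsR hcd houter rfl (hfr x₀ hx₀fr) hy
  -- inner region
  set V := Metric.ball (0 : E) s \ Metric.closedBall z ρ with hV
  have hVΩ : V ⊆ Ω := by
    rw [hΩ]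
    exact Set.sdiff_subset_sdiff_left (Metric.ball_subset_ball hsR.le)
  refine eq_zero_of_radial_of_sphere hdim (V := V) hs hz
    (fun x hx => hcd x hx.ge (hx.trans_lt hsR)) (fun x hx => hH x (hshell x hx.ge (hx.trans_lt hsR)))
    hsphere ?_ ?_
  · intro x hx
    have hxc : x ∈ (Metric.closedBall z ρ)ᶜ := by
      have := hshell x hx.ge (hx.trans_lt hsR)
      rw [hΩ] at this
      exact this.2
    have hcont : ContinuousAt (fun t : ℝ => x - t • x) 0 := by fun_prop
    have h1 : ∀ᶠ t in 𝓝 (0 : ℝ), x - t • x ∈ (Metric.closedBall z ρ)ᶜ :=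
      hcont.eventually (Metric.isClosed_closedBall.isOpen_compl.mem_nhds (by simpa using hxc))
    have h2 : Set.Ioo (0 : ℝ) 1 ∈ 𝓝[>] (0 : ℝ) := Ioo_mem_nhdsGT one_pos
    filter_upwards [nhdsWithin_le_nhds h1, h2] with t ht1 ht2
    refine ⟨?_, ht1⟩
    have h3 : x - t • x = (1 - t) • x := by module
    rw [mem_ball_zero_iff, h3, norm_smul, hx, Real.norm_eq_abs, abs_of_pos (by linarith [ht2.2])]
    nlinarith [ht2.1]
  · intro x hx hxz w hw
    refine fderiv_apply_eq_zero_of_inner_eq_zero (c := z) (r := ρ) (S := Metric.sphere (0 : E) s) hΩo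
      (Metric.isOpen_ball.sdiff Metric.isClosed_closedBall)
      (Metric.isBounded_ball.subset Set.sdiff_subset) hVΩ hu2 huc hH (isCompact_sphere _ _) ?_ ?_
      (fun y hy => hbdry y (hΩ ▸ inner_sphere_subset_frontier_annulus hρ hsub hy))
      (frontier_ball_diff_closedBall_subset _ _ _ _) hx hxz hw
    · intro y hy
      have hy' : ‖y‖ = s := by simpa using hy
      exact hshell y hy'.ge (hy'.trans_lt hsR)
    · intro y hy
      exact hsphere y (by simpa using hy)

end Annulus

/-- In an eccentric spherical annulus of `ℝⁿ` (`n ≥ 3`), the critical set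
of a nontrivial solution of the constant mean curvature equation with zero Dirichlet data
contains no rotationally symmetric closed hypersurface: there is no rotationally invariant
open set `U` with frontier contained in `K` such that either `closure U ⊆ Ω`, or `U`
encloses the inner ball and `closure U ⊆ B(0,R)`. -/
theorem no_rotationally_symmetric_critical_hypersurface
    (n : ℕ) (hn : 3 ≤ n) (k : Fin n) (hk : (k : ℕ) = n - 1)
    (a : ℝ) (ha : a ≠ 0)
    (z : EuclideanSpace ℝ (Fin n)) (hz : z = a • EuclideanSpace.single k 1)
    (ρ R : ℝ) (hρ : 0 < ρ) (hρR : ρ < R)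
    (hsub : closure (Metric.ball z ρ) ⊆ Metric.ball (0 : EuclideanSpace ℝ (Fin n)) R)
    (Ω : Set (EuclideanSpace ℝ (Fin n)))
    (hΩ : Ω = Metric.ball (0 : EuclideanSpace ℝ (Fin n)) R \ closure (Metric.ball z ρ))
    (H : ℝ) (u : EuclideanSpace ℝ (Fin n) → ℝ)
    (huC2 : ContDiffOn ℝ 2 u Ω) (huC : ContinuousOn u (closure Ω))
    (hu : ∀ x ∈ Ω, meanCurv u x = H)
    (hbdry : ∀ x ∈ frontier Ω, u x = 0)
    (hune : ∃ x ∈ Ω, u x ≠ 0)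
    (K : Set (EuclideanSpace ℝ (Fin n))) (hK : K = {x | x ∈ Ω ∧ gradient u x = 0}) :
    ¬ ∃ U : Set (EuclideanSpace ℝ (Fin n)), U.Nonempty ∧ IsOpen U ∧
        (∀ g : EuclideanSpace ℝ (Fin n) ≃ₗᵢ[ℝ] EuclideanSpace ℝ (Fin n),
          IsAxisRotation k g → g '' U = U) ∧
        frontier U ⊆ K ∧
        (closure U ⊆ Ω ∨
          (closure (Metric.ball z ρ) ⊆ U ∧
            closure U ⊆ Metric.ball (0 : EuclideanSpace ℝ (Fin n)) R)) := by
  rintro ⟨U, hUne, hU, -, hfr, hcase⟩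
  have hdim : 3 ≤ Module.finrank ℝ (EuclideanSpace ℝ (Fin n)) := by simpa using hn
  have hnt : Nontrivial (EuclideanSpace ℝ (Fin n)) :=
    Module.nontrivial_of_finrank_pos (R := ℝ) (by omega)
  rw [closure_ball _ hρ.ne'] at hsub hΩ hcase
  have hz0 : z ≠ 0 := by
    rw [hz]
    exact smul_ne_zero ha (by simp)
  have hΩo : IsOpen Ω := hΩ ▸ Metric.isOpen_ball.sdiff Metric.isClosed_closedBall
  have hΩb : Bornology.IsBounded Ω := hΩ ▸ Metric.isBounded_ball.subset Set.sdiff_subset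
  have hcmc : ∀ x ∈ Ω, IsCMCAt H u x := fun x hx => hu x hx ▸ isCMCAt_meanCurv u x
  have hfrΩ : frontier U ⊆ Ω := fun x hx => by
    have := hfr hx
    rw [hK] at this
    exact this.1
  have hfr0 : ∀ x ∈ frontier U, fderiv ℝ u x = 0 := fun x hx => by
    have := hfr hx
    rw [hK] at this
    rw [← norm_eq_zero, ← norm_gradient, this.2, norm_zero]
  have hH0 : H = 0 := by
    rcases hcase with hUΩ | ⟨hzU, hUR⟩
    · obtain ⟨x, hx⟩ := hUne
      have h0 : ∀ y ∈ U, fderiv ℝ u y = 0 := fun y hy =>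
        fderiv_eq_zero_of_frontier hΩo hU (hΩb.subset (subset_closure.trans hUΩ)) hUΩ huC2 huC
          hcmc hfr0 hy
      have hev : fderiv ℝ u =ᶠ[𝓝 x] fun _ => 0 := by
        filter_upwards [hU.mem_nhds hx] with y hy using h0 y hy
      refine (hcmc x (hUΩ (subset_closure hx))).eq_zero (h0 x hx) ?_
      rw [hev.fderiv_eq]
      simp
    · exact eq_zero_of_enclosing hdim hz0 hρ hsub hΩ huC2 huC hcmc hbdry hU hfrΩ hfr0 hzU hUR
  obtain ⟨x, hx, hxu⟩ := hune
  subst hH0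
  exact hxu (eq_zero_of_isCMCAt_zero hΩo hΩb huC2 huC hcmc hbdry hx)
end
end
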